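/- arXiv:0903.2867 — 3 statements merged into one kernel-verified Lean document; each statement's English description precedes it below -/
import Mathlib

section
/- For all k ≥ 3, 1 ≤ ℓ ≤ k−1 and every η > 0 there exists n₀ such that: if n > n₀, (k−ℓ) divides n, and H is a k-graph on n vertices with minimum degree δ(H) ≥ (1/2 + η)n, then H contains a Hamilton ℓ-cycle. -/
open Finset

/-- `H` is (the edge set of) a `k`-uniform hypergraph on vertex set `Fin n`. -/
def IsKGraph (n k : ℕ) (H : Finset (Finset (Fin n))) : Prop := ∀ e ∈ H, e.card = k

/-- The degree of a vertex set `A` in `H`: the number of edges containing `A`. -/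
def degree (n : ℕ) (H : Finset (Finset (Fin n))) (A : Finset (Fin n)) : ℕ :=
  (H.filter (fun e => A ⊆ e)).card

/-- The minimum `(k-1)`-degree of `H` is at least `x`. -/
def MinDegreeGe (n k : ℕ) (H : Finset (Finset (Fin n))) (x : ℝ) : Prop :=
  ∀ A : Finset (Fin n), A.card = k - 1 → x ≤ (degree n H A : ℝ)

/-- The edge of a Hamilton `ℓ`-cycle starting at position `j * (k - ℓ)` in the
cyclic ordering `f` of the vertices: it consists of the `k` consecutive vertices
from that position on. -/
def cycleEdge (n k ℓ : ℕ) (f : ZMod n ≃ Fin n) (j : ℕ) : Finset (Fin n) :=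
  (Finset.range k).image (fun t => f ((j * (k - ℓ) + t : ℕ) : ZMod n))

/-- `H` contains a Hamilton `ℓ`-cycle: there is a cyclic ordering of all `n`
vertices and `m` edges of `H`, each consisting of `k` consecutive vertices, with
consecutive edges (in the natural ordering of the edges) sharing exactly `ℓ`
vertices, i.e. successive starting positions differ by `k - ℓ`, going around the
whole cycle exactly once (so `m * (k - ℓ) = n`). -/
def HasHamiltonLCycle (n k ℓ : ℕ) (H : Finset (Finset (Fin n))) : Prop :=
  ∃ (f : ZMod n ≃ Fin n) (m : ℕ), 0 < m ∧ m * (k - ℓ) = n ∧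
    ∀ j < m, cycleEdge n k ℓ f j ∈ H ∧ (cycleEdge n k ℓ f j).card = k

section Proof
open scoped Classical

/-- All windows of length `k` of the list satisfy `E`. -/
def Tight {V : Type} (k : ℕ) (E : Multiset V → Prop) (l : List V) : Prop :=
  ∀ i, i + k ≤ l.length → E (((l.drop i).take k : List V) : Multiset V)

/-- The link of a vertex. -/
def lnk {V : Type} (E : Multiset V → Prop) (x : V) : Multiset V → Prop := fun m => E (x ::ₘ m)

lemma tight_infix {V : Type} {k : ℕ} {E : Multiset V → Prop} {p l q : List V}
    (H : Tight k E (p ++ l ++ q)) : Tight k E l := by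
  intro i hi
  have := H (p.length + i) (by simp; omega)
  simpa [List.drop_append, List.take_append, show k - (l.length - i) = 0 by omega,
    show p.length + i - p.length = i by omega,
    show (p.drop (p.length + i)) = [] from List.drop_eq_nil_of_le (by omega)] using this

lemma tight_right {V : Type} {k : ℕ} {E : Multiset V → Prop} {p l : List V}
    (H : Tight k E (p ++ l)) : Tight k E l := by
  exact tight_infix (p := p) (q := []) (by simpa using H)

lemma tight_left {V : Type} {k : ℕ} {E : Multiset V → Prop} {p l : List V}
    (H : Tight k E (p ++ l)) : Tight k E p := by
  exact tight_infix (p := []) (q := l) (by simpa using H)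

lemma tight_short {V : Type} {k : ℕ} {E : Multiset V → Prop} {l : List V}
    (H : l.length < k) : Tight k E l := by
  intro i hi; omega

lemma tight_join {V : Type} {h : ℕ} {E : Multiset V → Prop} {p a q : List V}
    (ha : h ≤ a.length) (H1 : Tight (h+1) E (p ++ a)) (H2 : Tight (h+1) E (a ++ q)) :
    Tight (h+1) E (p ++ a ++ q) := by
  intro i hi
  by_cases hc : i + (h+1) ≤ (p ++ a).length
  · have := H1 i hc
    rw [List.drop_append_of_le_length (by omega), List.take_append_of_le_length (by simp at *; omega)]
    exact this
  · have h1 : p.length ≤ i := by simp at hc; omega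
    have := H2 (i - p.length) (by simp at *; omega)
    rw [List.append_assoc, List.drop_append, List.drop_eq_nil_of_le h1, List.nil_append]
    exact this

lemma tight_cons {V : Type} {k : ℕ} {E : Multiset V → Prop} {x : V} {l : List V} :
    Tight (k+1) E (x :: l) ↔ (k ≤ l.length → E (x ::ₘ (l.take k : Multiset V))) ∧ Tight (k+1) E l := by
  constructor
  · intro H
    refine ⟨fun hk => ?_, tight_right (p := [x]) H⟩
    have := H 0 (by simp; omega)
    simpa using this
  · rintro ⟨H1, H2⟩ i hi
    rcases i with _ | i
    · simpa using H1 (by simp at hi; omega)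
    · simpa using H2 i (by simp at hi; omega)

lemma tight_link {V : Type} {h : ℕ} {E : Multiset V → Prop} {x : V} {a b : List V}
    (ha : a.length = h) (hb : b.length = h) (H : Tight h (lnk E x) (a ++ b)) :
    Tight (h+1) E (a ++ x :: b) := by
  intro i hi
  have hi' : i ≤ h := by simp at hi; omega
  have := H i (by simp; omega)
  have e1 : ((a ++ x :: b).drop i).take (h+1) = a.drop i ++ x :: b.take i := by
    rw [List.drop_append_of_le_length (by omega), List.take_append, List.take_of_length_le (by simp; omega)]
    simp [ha, show h + 1 - (h - i) = i + 1 by omega]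
  have e2 : ((a ++ b).drop i).take h = a.drop i ++ b.take i := by
    rw [List.drop_append_of_le_length (by omega), List.take_append, List.take_of_length_le (by simp; omega)]
    simp [ha, show h - (h - i) = i by omega]
  rw [e1]; rw [e2] at this
  unfold lnk at this
  convert this using 1
  simp only [← Multiset.coe_add, ← Multiset.cons_coe, Multiset.add_cons]

/-- Insert an element of `xs` before every block of `h` elements. -/
def weave {V : Type} (h : ℕ) : List V → List V → List V
  | [], us => us
  | x :: xs, us => x :: (us.take h ++ weave h xs (us.drop h))

lemma weave_perm {V : Type} (h : ℕ) (xs : List V) : ∀ us, (weave h xs us).Perm (xs ++ us) := by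
  induction xs with
  | nil => intro us; simp [weave]
  | cons x xs ih =>
    intro us
    simp only [weave, List.cons_append, List.perm_cons]
    refine ((ih (us.drop h)).append_left _).trans ?_
    rw [← List.append_assoc]
    refine (List.perm_append_comm.append_right _).trans ?_
    rw [List.append_assoc, List.take_append_drop]

lemma weave_tight {V : Type} {h : ℕ} {E : Multiset V → Prop} (xs : List V) :
    ∀ a us : List V, a.length = h → us.length = h * xs.length →
      (∀ x ∈ xs, Tight h (lnk E x) (a ++ us)) →
      Tight (h+1) E (a ++ weave h xs us) := by
  induction xs with
  | nil => 
    intro a us ha hu _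
    have : us = [] := by simpa using hu
    subst this
    simp only [weave, List.append_nil]
    exact tight_short (by omega)
  | cons x xs ih =>
    intro a us ha hu H
    simp only [List.length_cons, Nat.mul_succ] at hu
    have hB : (us.take h).length = h := by simp; omega
    have hs : a ++ us = (a ++ us.take h) ++ us.drop h := by simp
    have IH := ih (us.take h) (us.drop h) hB (by simp; omega) (fun y hy => by
      rw [List.take_append_drop]
      exact tight_right (H y (by simp [hy])))
    have T1 := H x (by simp)
    rw [hs] at T1
    have T2 := tight_link (E := E) ha hB (tight_left T1)
    have := tight_join (p := a ++ [x]) (a := us.take h) (h := h) hB.ge (by simpa using T2) IH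
    simpa [weave] using this

lemma weave_append {V : Type} {h : ℕ} (vs : List V) : ∀ u b : List V, b.length = h →
    u.length + h = h * vs.length → vs ≠ [] → weave h vs (u ++ b) = weave h vs u ++ b := by
  induction vs with
  | nil => intro u b _ _ h; exact absurd rfl h
  | cons v vs ih =>
    intro u b hb hu _
    by_cases hv : vs = []
    · subst hv
      have : u = [] := by simpa using hu
      subst this
      simp [weave]
    · have hl : 0 < vs.length := List.length_pos_iff.mpr hv
      simp only [List.length_cons, Nat.mul_succ] at hu
      have : h ≤ h * vs.length := Nat.le_mul_of_pos_right _ hl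
      have hu' : h ≤ u.length := by omega
      simp only [weave]
      rw [List.take_append_of_le_length hu', List.drop_append_of_le_length hu',
        ih (u.drop h) b hb (by simp; omega) hv]
      simp

end Proof

section Proof
open scoped Classical

/-- Expectation over uniformly random lists of length `N`. -/
noncomputable def Ex {V : Type} [Fintype V] : ℕ → (List V → ℝ) → ℝ
  | 0, f => f []
  | N + 1, f => (∑ x : V, Ex N (fun l => f (x :: l))) / (Fintype.card V : ℝ)

/-- Indicator of a proposition. -/
noncomputable def ind (P : Prop) : ℝ := if P then 1 else 0

lemma ind_true {P : Prop} (h : P) : ind P = 1 := if_pos h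
lemma ind_false {P : Prop} (h : ¬ P) : ind P = 0 := if_neg h
lemma ind_nonneg (P : Prop) : 0 ≤ ind P := by unfold ind; split_ifs <;> norm_num
lemma ind_le_one (P : Prop) : ind P ≤ 1 := by unfold ind; split_ifs <;> norm_num
lemma ind_mono {P Q : Prop} (h : P → Q) : ind P ≤ ind Q := by
  unfold ind; split_ifs <;> first | tauto | norm_num
lemma ind_pos {P : Prop} (h : 0 < ind P) : P := by
  by_contra hP; rw [ind_false hP] at h; exact lt_irrefl _ h

/-- The codegree condition. -/
def Dir (V : Type) [Fintype V] (h : ℕ) (η : ℝ) (E : Multiset V → Prop) : Prop :=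
  ∀ m : Multiset V, m.card = h →
    (1 / 2 + η) * (Fintype.card V : ℝ) ≤ ∑ x, ind (E (x ::ₘ m))

section
variable {V : Type} [Fintype V]

lemma Ex_mono (N : ℕ) : ∀ {f g : List V → ℝ}, (∀ l, l.length = N → f l ≤ g l) → Ex N f ≤ Ex N g := by
  induction N with
  | zero => intro f g h; exact h [] rfl
  | succ N ih =>
    intro f g h
    simp only [Ex]
    apply div_le_div_of_nonneg_right _ (by positivity)
    exact Finset.sum_le_sum fun x _ => ih fun l hl => h _ (by simp [hl])

lemma Ex_congr (N : ℕ) {f g : List V → ℝ} (h : ∀ l, l.length = N → f l = g l) : Ex N f = Ex N g :=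
  le_antisymm (Ex_mono N fun l hl => (h l hl).le) (Ex_mono N fun l hl => (h l hl).ge)

lemma Ex_const [Nonempty V] (N : ℕ) (c : ℝ) : Ex N (fun _ : List V => c) = c := by
  induction N with
  | zero => rfl
  | succ N ih =>
    have : (Fintype.card V : ℝ) ≠ 0 := by exact_mod_cast Fintype.card_ne_zero
    simp only [Ex, ih, Finset.sum_const, Finset.card_univ, nsmul_eq_mul]
    field_simp

lemma Ex_sum {ι : Type*} (s : Finset ι) (N : ℕ) : ∀ (f : ι → List V → ℝ),
    Ex N (fun l => ∑ i ∈ s, f i l) = ∑ i ∈ s, Ex N (f i) := by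
  induction N with
  | zero => intro f; rfl
  | succ N ih =>
    intro f
    simp only [Ex, ih]
    rw [Finset.sum_comm, Finset.sum_div]

lemma Ex_mul (N : ℕ) : ∀ (c : ℝ) (f : List V → ℝ), Ex N (fun l => c * f l) = c * Ex N f := by
  induction N with
  | zero => intro c f; rfl
  | succ N ih =>
    intro c f
    simp only [Ex, ih, ← Finset.mul_sum, mul_div_assoc]

lemma Ex_add (N : ℕ) : ∀ (f g : List V → ℝ), Ex N (fun l => f l + g l) = Ex N f + Ex N g := by
  induction N with
  | zero => intro f g; rfl
  | succ N ih =>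
    intro f g
    simp only [Ex, ih, Finset.sum_add_distrib, add_div]

lemma Ex_nonneg (N : ℕ) : ∀ {f : List V → ℝ}, (∀ l, 0 ≤ f l) → 0 ≤ Ex N f := by
  induction N with
  | zero => intro f h; exact h []
  | succ N ih =>
    intro f h
    simp only [Ex]
    have := Finset.sum_nonneg (s := univ) fun (x : V) _ => ih (f := fun l => f (x :: l)) fun l => h _
    positivity

lemma Ex_append (M N : ℕ) : ∀ (f : List V → ℝ),
    Ex (M + N) f = Ex M (fun l1 => Ex N (fun l2 => f (l1 ++ l2))) := by
  induction M with
  | zero => intro f; simp [Ex]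
  | succ M ih =>
    intro f
    rw [show M + 1 + N = (M + N) + 1 by omega]
    simp only [Ex, ih, List.cons_append]

lemma Ex_div (N : ℕ) (c : ℝ) (f : List V → ℝ) : Ex N (fun l => f l / c) = Ex N f / c := by
  have := Ex_mul N c⁻¹ f
  simp only [div_eq_inv_mul]; exact this

lemma Ex_swap (M N : ℕ) : ∀ (f : List V → List V → ℝ),
    Ex M (fun l1 => Ex N (fun l2 => f l1 l2)) = Ex N (fun l2 => Ex M (fun l1 => f l1 l2)) := by
  induction M with
  | zero => intro f; rfl
  | succ M ih =>
    intro f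
    simp only [Ex]
    rw [Ex_div, Ex_sum]
    congr 1
    exact Finset.sum_congr rfl fun x _ => ih _

lemma Ex_pow [Nonempty V] (p N : ℕ) : ∀ {f : List V → ℝ}, (∀ l, 0 ≤ f l) →
    (Ex N f) ^ p ≤ Ex N (fun l => f l ^ p) := by
  have hc : (Fintype.card V : ℝ) ≠ 0 := by exact_mod_cast Fintype.card_ne_zero
  induction N with
  | zero => intro f h; exact le_rfl
  | succ N ih =>
    intro f h
    simp only [Ex]
    have h1 := Real.pow_arith_mean_le_arith_mean_pow (univ : Finset V)
      (fun _ => (Fintype.card V : ℝ)⁻¹) (fun x => Ex N (fun l => f (x :: l)))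
      (fun _ _ => by positivity) (by simp [hc]) (fun x _ => Ex_nonneg N fun l => h _) p
    simp only [← Finset.mul_sum] at h1
    rw [div_eq_inv_mul, div_eq_inv_mul]
    refine h1.trans ?_
    apply mul_le_mul_of_nonneg_left _ (by positivity)
    exact Finset.sum_le_sum fun x _ => ih fun l => h _

lemma Ex_prod (N : ℕ) (g : V → ℝ) : 
    Ex N (fun l => (l.map g).prod) = ((∑ x, g x) / (Fintype.card V : ℝ)) ^ N := by
  induction N with
  | zero => simp [Ex]
  | succ N ih =>
    simp only [Ex, List.map_cons, List.prod_cons, Ex_mul, ih, ← Finset.sum_mul]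
    rw [pow_succ]; ring

lemma Ex_exists [Nonempty V] (N : ℕ) : ∀ {f : List V → ℝ} {t : ℝ}, t ≤ Ex N f →
    ∃ l, l.length = N ∧ t ≤ f l := by
  induction N with
  | zero => intro f t h; exact ⟨[], rfl, h⟩
  | succ N ih =>
    intro f t h
    simp only [Ex] at h
    have hc : (0 : ℝ) < (Fintype.card V : ℝ) := by exact_mod_cast Fintype.card_pos
    rw [le_div_iff₀ hc] at h
    obtain ⟨x, -, hx⟩ := Finset.exists_le_of_sum_le (s := (univ : Finset V)) (f := fun _ => t)
      (g := fun x => Ex N (fun l => f (x :: l))) ⟨Classical.arbitrary V, by simp⟩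
      (by simpa [mul_comm] using h)
    obtain ⟨l, hl, h⟩ := ih hx
    exact ⟨x :: l, by simp [hl], h⟩

/-- most lists are nodup and avoid a small set -/
lemma Ex_bad [Nonempty V] (N : ℕ) : ∀ (U : Finset V),
    Ex N (fun l => ind (¬ (l.Nodup ∧ ∀ x ∈ l, x ∉ U))) ≤ N * (U.card + N) / (Fintype.card V : ℝ) := by
  induction N with
  | zero => intro U; simp [Ex, ind]
  | succ N ih =>
    intro U
    simp only [Ex]
    have hc : (0 : ℝ) < (Fintype.card V : ℝ) := by exact_mod_cast Fintype.card_pos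
    apply div_le_div_of_nonneg_right _ hc.le
    have key : ∀ x : V, Ex N (fun l => ind (¬ ((x :: l).Nodup ∧ ∀ y ∈ x :: l, y ∉ U)))
        ≤ ind (x ∈ U) + N * (U.card + 1 + N) / (Fintype.card V : ℝ) := by
      intro x
      have h1 : Ex N (fun l => ind (¬ ((x :: l).Nodup ∧ ∀ y ∈ x :: l, y ∉ U))) ≤
          Ex N (fun l => ind (x ∈ U) + ind (¬ (l.Nodup ∧ ∀ y ∈ l, y ∉ insert x U))) := by
        apply Ex_mono
        intro l _
        by_cases hx : x ∈ U
        · rw [ind_true hx]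
          have := ind_le_one (¬ ((x :: l).Nodup ∧ ∀ y ∈ x :: l, y ∉ U))
          have := ind_nonneg (¬ (l.Nodup ∧ ∀ y ∈ l, y ∉ insert x U))
          linarith
        · rw [ind_false hx, zero_add]
          apply ind_mono
          intro h1 h2
          apply h1
          obtain ⟨h3, h4⟩ := h2
          refine ⟨List.nodup_cons.mpr ⟨fun hxl => h4 x hxl (by simp), h3⟩, ?_⟩
          intro y hy
          rcases List.mem_cons.mp hy with rfl | hy
          · exact hx
          · exact fun hyU => h4 y hy (by simp [hyU])
      rw [Ex_add, Ex_const] at h1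
      refine h1.trans (add_le_add le_rfl ((ih _).trans ?_))
      apply div_le_div_of_nonneg_right _ hc.le
      have : ((insert x U).card : ℝ) ≤ U.card + 1 := by exact_mod_cast Finset.card_insert_le x U
      gcongr
    refine (Finset.sum_le_sum fun x _ => key x).trans ?_
    rw [Finset.sum_add_distrib]
    have e1 : ∑ x : V, ind (x ∈ U) = U.card := by
      rw [← Finset.sum_subset (Finset.subset_univ U) (fun x _ hx => ind_false hx),
        Finset.sum_congr rfl (fun x hx => ind_true hx)]
      simp
    rw [e1]
    simp only [Finset.sum_const, Finset.card_univ, nsmul_eq_mul]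
    rw [mul_div_cancel₀ _ hc.ne']
    push_cast
    nlinarith [Nat.cast_nonneg (α := ℝ) N, Nat.cast_nonneg (α := ℝ) U.card]

end
end Proof

section Proof
open scoped Classical

section
variable {V : Type} [Fintype V]

lemma Dir.link {h : ℕ} {η : ℝ} {E : Multiset V → Prop} (H : Dir V (h+1) η E) (v : V) :
    Dir V h η (lnk E v) := by
  intro m hm
  have := H (v ::ₘ m) (by simp [hm])
  simpa only [lnk, Multiset.cons_swap] using this

lemma sum_ind_le (P : V → Prop) : ∑ x, ind (P x) ≤ (Fintype.card V : ℝ) := by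
  refine (Finset.sum_le_sum fun x _ => ind_le_one (P x)).trans ?_
  simp

lemma sum_ind_and (P Q : V → Prop) :
    ∑ x, ind (P x) + ∑ x, ind (Q x) - (Fintype.card V : ℝ) ≤ ∑ x, ind (P x ∧ Q x) := by
  have : (Fintype.card V : ℝ) = ∑ _x : V, (1 : ℝ) := by simp
  rw [this, ← Finset.sum_add_distrib, ← Finset.sum_sub_distrib]
  apply Finset.sum_le_sum
  intro x _
  by_cases h1 : P x <;> by_cases h2 : Q x <;> simp [ind, h1, h2]

lemma Dir.le [Nonempty V] {h : ℕ} {η : ℝ} {E : Multiset V → Prop} (H : Dir V h η E) :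
    (1 / 2 + η) * (Fintype.card V : ℝ) ≤ Fintype.card V :=
  (H (Multiset.replicate h (Classical.arbitrary V)) (by simp)).trans (sum_ind_le _)

lemma Dir.ext [Nonempty V] {h : ℕ} {η : ℝ} {E : Multiset V → Prop} (H : Dir V h η E) {l : List V}
    (hl : Tight (h+1) E l) :
    (1 / 2 + η) * (Fintype.card V : ℝ) ≤ ∑ x, ind (Tight (h+1) E (x :: l)) := by
  by_cases hh : h ≤ l.length
  · refine (H (l.take h : Multiset V) (by simp [hh])).trans ?_
    apply Finset.sum_le_sum
    intro x _
    apply ind_mono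
    intro hx
    exact tight_cons.mpr ⟨fun _ => hx, hl⟩
  · refine H.le.trans (le_of_eq ?_)
    rw [Finset.sum_congr rfl (fun x _ => ind_true (tight_cons.mpr ⟨fun h' => absurd h' hh, hl⟩))]
    simp

lemma Ex_ext [Nonempty V] (P : List V → Prop) (θ : ℝ) (hθ : 0 ≤ θ) (b : List V) (hb : P b)
    (H : ∀ l, P l → θ * (Fintype.card V : ℝ) ≤ ∑ x, ind (P (x :: l))) (N : ℕ) :
    θ ^ N ≤ Ex N (fun y => ind (P (y ++ b))) := by
  induction N with
  | zero => simp [Ex, ind, hb]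
  | succ N ih =>
    rw [add_comm N 1, Ex_append, Ex_swap, pow_add, pow_one]
    have : θ * Ex N (fun y => ind (P (y ++ b))) ≤ 
      Ex N (fun l2 => Ex 1 (fun l1 => ind (P (l1 ++ l2 ++ b)))) := by
      rw [← Ex_mul]
      apply Ex_mono
      intro l _
      simp only [Ex]
      have hc : (0 : ℝ) < (Fintype.card V : ℝ) := by exact_mod_cast Fintype.card_pos
      rw [le_div_iff₀ hc]
      by_cases hP : P (l ++ b)
      · rw [ind_true hP, mul_one]
        simpa using H _ hP
      · rw [ind_false hP, mul_zero, zero_mul]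
        exact Finset.sum_nonneg fun x _ => ind_nonneg _
    exact (mul_le_mul_of_nonneg_left ih hθ).trans this

lemma weave_Ex (h m : ℕ) : ∀ f : List V → ℝ, 
    Ex (h * m + (m+1)) f = Ex (h * m) (fun u => Ex (m+1) (fun vs => f (weave h vs u))) := by
  induction m with
  | zero => intro f; simp [Ex, weave]
  | succ m ih =>
    intro f
    rw [show h * (m+1) + (m+1+1) = 1 + (h + (h * m + (m+1))) by ring,
      show h * (m+1) = h + h * m by ring, show m + 1 + 1 = 1 + (m+1) by ring]
    simp only [Ex_append h, Ex_append 1, ih]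
    rw [Ex_swap 1 h]
    apply Ex_congr
    intro B hB
    rw [Ex_swap 1 (h * m)]
    apply Ex_congr
    intro u hu
    apply Ex_congr
    intro v hv
    apply Ex_congr
    intro vs hvs
    obtain ⟨v, rfl⟩ := List.length_eq_one_iff.mp hv
    simp [weave, ← hB]

lemma prod_ind {V : Type} (P : V → Prop) (l : List V) : (l.map (fun v => ind (P v))).prod ≤ ind (∀ v ∈ l, P v) := by
  induction l with
  | nil => simp [ind]
  | cons x l ih =>
    by_cases hx : P x
    · simp only [List.map_cons, List.prod_cons, ind_true hx, one_mul]
      refine ih.trans (ind_mono ?_)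
      intro h; simpa [hx] using h
    · simp only [List.map_cons, List.prod_cons, ind_false hx, zero_mul]
      exact ind_nonneg _

lemma tight_single {V : Type} {k : ℕ} {E : Multiset V → Prop} {l : List V} (hl : l.length = k)
    (h : E l) : Tight k E l := by
  intro i hi
  have : i = 0 := by omega
  subst this
  simpa [← hl] using h

end

lemma connect (η : ℝ) (hη : 0 < η) (h : ℕ) : ∃ c : ℝ, 0 < c ∧ 
    ∀ (V : Type) [Fintype V] [Nonempty V] (E : Multiset V → Prop), Dir V h η E → 
    ∀ a b : List V, a.length = h → b.length = h →
      c ≤ Ex ((h+1) * h) (fun x => ind (Tight (h+1) E (a ++ x ++ b))) := by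
  induction h with
  | zero =>
    refine ⟨1, one_pos, ?_⟩
    intro V _ _ E _ a b ha hb
    obtain rfl := List.length_eq_zero_iff.mp ha
    obtain rfl := List.length_eq_zero_iff.mp hb
    simp only [Ex]
    rw [ind_true]
    exact tight_short (by simp)
  | succ h ih =>
    obtain ⟨c, hc, ih⟩ := ih
    refine ⟨(1/2)^(h+1) * (2 * η * c)^(h+1), by positivity, ?_⟩
    intro V _ _ E HE
    have hn : (0 : ℝ) < (Fintype.card V : ℝ) := by exact_mod_cast Fintype.card_pos
    have part1 : ∀ a b : List V, a.length = h+1 → b.length = h+1 →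
      (2 * η * c)^(h+1) ≤ Ex ((h+1) * h + (h+1)) (fun x => ind (Tight (h+2) E (a ++ x ++ b))) := by
      intro a b ha hb
      rw [weave_Ex]
      have hv : ∀ v, E (v ::ₘ (a : Multiset V)) ∧ E (v ::ₘ (b : Multiset V)) →
          c ≤ Ex ((h+1) * h) (fun u => ind (Tight (h+1) (lnk E v) (a ++ u ++ b))) := by
        rintro v ⟨hva, hvb⟩
        obtain ⟨a0, a', rfl⟩ : ∃ a0 a', a = a0 :: a' := List.exists_cons_of_length_eq_add_one ha
        obtain ⟨b', b0, rfl⟩ : ∃ b' b0, b = b' ++ [b0] := by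
          rcases List.eq_nil_or_concat b with rfl | ⟨L, x, rfl⟩
          · simp at hb
          · exact ⟨L, x, by simp⟩
        simp only [List.length_cons, List.length_append, List.length_nil] at ha hb
        have ha' : a'.length = h := by omega
        have hb' : b'.length = h := by omega
        refine (ih V (lnk E v) (HE.link v) a' b' ha' hb').trans ?_
        apply Ex_mono
        intro u _
        apply ind_mono
        intro T
        have T1 := tight_join (p := a' ++ u) (a := b') (q := [b0]) (h := h) hb'.ge T
          (tight_single (by simp [hb']) hvb)
        have T2 := tight_join (p := [a0]) (a := a') (q := u ++ b' ++ [b0]) (h := h) ha'.ge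
          (tight_single (E := lnk E v) (by simp [ha']) hva) (by simpa using T1)
        simpa using T2
      have hg : 2 * η * c ≤ Ex ((h+1) * h) (fun u =>
          (∑ v, ind (Tight (h+1) (lnk E v) (a ++ u ++ b))) / (Fintype.card V : ℝ)) := by
        rw [Ex_div, Ex_sum, le_div_iff₀ hn]
        have h1 := HE (a : Multiset V) (by simp [ha])
        have h2 := HE (b : Multiset V) (by simp [hb])
        have h3 := sum_ind_and (fun v => E (v ::ₘ (a : Multiset V))) (fun v => E (v ::ₘ (b : Multiset V)))
        have h4 : c * ∑ v, ind (E (v ::ₘ (a : Multiset V)) ∧ E (v ::ₘ (b : Multiset V))) ≤ 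
            ∑ v, Ex ((h+1) * h) (fun u => ind (Tight (h+1) (lnk E v) (a ++ u ++ b))) := by
          rw [Finset.mul_sum]
          apply Finset.sum_le_sum
          intro v _
          by_cases hh : E (v ::ₘ (a : Multiset V)) ∧ E (v ::ₘ (b : Multiset V))
          · rw [ind_true hh, mul_one]; exact hv v hh
          · rw [ind_false hh, mul_zero]; exact Ex_nonneg _ fun _ => ind_nonneg _
        refine le_trans ?_ h4
        have h5 : 2 * η * (Fintype.card V : ℝ) ≤ 
          ∑ v, ind (E (v ::ₘ (a : Multiset V)) ∧ E (v ::ₘ (b : Multiset V))) := by linarith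
        nlinarith
      have hpow := (pow_le_pow_left₀ (by positivity) hg (h+1)).trans (Ex_pow (h+1) _ (fun u => by
        have := Finset.sum_nonneg (s := (univ : Finset V)) fun v _ => 
          ind_nonneg (Tight (h+1) (lnk E v) (a ++ u ++ b))
        positivity))
      refine hpow.trans ?_
      apply Ex_mono
      intro u hu
      rw [← Ex_prod]
      apply Ex_mono
      intro vs hvs
      refine (prod_ind _ vs).trans (ind_mono ?_)
      intro hT
      have := weave_tight (E := E) vs a (u ++ b) ha (by simp [hu, hb, hvs]; ring) (by simpa using hT)
      rw [weave_append vs u b hb (by rw [hu, hvs]; ring) (by rintro rfl; simp at hvs)] at this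
      simpa using this
    intro a b ha hb
    rw [show (h+1+1) * (h+1) = ((h+1) * h + (h+1)) + (h+1) by ring, Ex_append, Ex_swap]
    have e := Ex_ext (Tight (h+2) E) (1/2) (by norm_num) b (tight_short (by omega)) (fun l hl => by
      refine le_trans ?_ (HE.ext hl)
      nlinarith) (h+1)
    refine (mul_le_mul_of_nonneg_right e (by positivity)).trans ?_
    rw [mul_comm, ← Ex_mul]
    apply Ex_mono
    intro y hy
    by_cases hT : Tight (h+2) E (y ++ b)
    · rw [ind_true hT, mul_one]
      refine (part1 a y ha hy).trans ?_
      apply Ex_mono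
      intro x _
      apply ind_mono
      intro hx
      have := tight_join (p := a ++ x) (a := y) (q := b) (h := h+1) hy.ge hx hT
      simpa using this
    · rw [ind_false hT, mul_zero]
      exact Ex_nonneg _ fun _ => ind_nonneg _

/-- `p ++ q` can absorb `v`. -/
def Absb {V : Type} (h : ℕ) (E : Multiset V → Prop) (v : V) (l : List V) : Prop :=
  ∃ c p q, l = c ++ p ++ q ∧ p.length = h ∧ q.length = h ∧ Tight (h+1) E (p ++ v :: q)

lemma absorb_count {V : Type} [Fintype V] [Nonempty V] {g : ℕ} {η : ℝ} (hη : 0 < η)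
    {E : Multiset V → Prop} (HE : Dir V (g+1) η E) (v : V) :
    (2 * η) ^ (2 * (g+1)) ≤ Ex (2 * (g+1)) (fun t => ind (Tight (g+2) E t ∧ Absb (g+1) E v t)) := by
  have e := Ex_ext (fun l => Tight (g+2) E l ∧ Tight (g+1) (lnk E v) l) (2 * η) (by positivity) []
    ⟨tight_short (by simp), tight_short (by simp)⟩ (fun l hl => by
      have h1 := HE.ext hl.1
      have h2 := (HE.link v).ext hl.2
      have h3 := sum_ind_and (fun x => Tight (g+2) E (x :: l)) (fun x => Tight (g+1) (lnk E v) (x :: l))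
      linarith) (2 * (g+1))
  refine e.trans ?_
  apply Ex_mono
  intro t ht
  apply ind_mono
  rintro ⟨h1, h2⟩
  simp only [List.append_nil] at h1 h2
  refine ⟨h1, [], t.take (g+1), t.drop (g+1), by simp, by simp; omega, by simp; omega, ?_⟩
  exact tight_link (by simp; omega) (by simp; omega) (by simpa using h2)

end Proof

section Proof
open scoped Classical

lemma ind_split (P Q : Prop) : ind P ≤ ind (P ∧ Q) + ind (¬ Q) := by
  by_cases u1 : P <;> by_cases u2 : Q <;> simp [ind, u1, u2]

lemma select {V Q : Type} [Fintype V] [Nonempty V] [Fintype Q] [Nonempty Q] (N : ℕ) (c : ℝ)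
    (hc : 0 < c) (Inv : List V → Prop) (R : Q → List V → Prop)
    (H : ∀ p, Inv p → ∀ q, c ≤ Ex N (fun l => ind (Inv (p ++ l) ∧ R q l)))
    (p0 : List V) (h0 : Inv p0) (hnd : p0.Nodup) (M : ℕ)
    (hM : (N : ℝ) * (p0.length + N * M + N) ≤ c / 2 * (Fintype.card V : ℝ)) :
    ∃ ls : List (List V), ls.length = M ∧ (p0 ++ ls.flatten).Nodup ∧ Inv (p0 ++ ls.flatten) ∧
      (∀ l ∈ ls, l.length = N) ∧
      ∑ q, (1/2 : ℝ) ^ (ls.countP (fun l => decide (R q l))) ≤ 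
        (Fintype.card Q : ℝ) * (1 - c / 4) ^ M := by
  have hn : (0 : ℝ) < (Fintype.card V : ℝ) := by exact_mod_cast Fintype.card_pos
  have hc1 : c ≤ 1 := by
    refine (H p0 h0 (Classical.arbitrary Q)).trans ?_
    refine (Ex_mono N fun l _ => ind_le_one _).trans (Ex_const N 1).le
  induction M with
  | zero => exact ⟨[], by simp, by simpa using hnd, by simpa using h0, by simp, by simp⟩
  | succ M ih =>
    obtain ⟨ls, h1, h2, h3, h4, h5⟩ := ih (by
      refine le_trans ?_ hM
      push_cast
      have : (0 : ℝ) ≤ (N : ℝ) := by positivity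
      gcongr
      linarith)
    set p := p0 ++ ls.flatten with hp
    set w : Q → ℝ := fun q => (1/2 : ℝ) ^ (ls.countP (fun l => decide (R q l))) with hw
    have hwpos : ∀ q, 0 < w q := fun q => by positivity
    have hlen : p.length = p0.length + N * M := by
      rw [hp, List.length_append, List.length_flatten]
      congr 1
      rw [List.map_congr_left (g := fun _ => N) (fun l hl => h4 l hl)]
      simp [h1, mul_comm]
    have hbad : Ex N (fun l => ind (¬ (l.Nodup ∧ ∀ x ∈ l, x ∉ p.toFinset))) ≤ c / 2 := by
      refine (Ex_bad N p.toFinset).trans ?_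
      rw [div_le_iff₀ hn]
      refine le_trans ?_ hM
      have : ((p.toFinset.card : ℕ) : ℝ) ≤ p0.length + N * M := by
        exact_mod_cast hlen ▸ p.toFinset_card_le
      push_cast
      have : (0 : ℝ) ≤ (N : ℝ) := by positivity
      gcongr
      linarith
    have hq : ∀ q, c / 2 ≤ Ex N (fun l => ind ((Inv (p ++ l) ∧ R q l) ∧ 
        (l.Nodup ∧ ∀ x ∈ l, x ∉ p.toFinset))) := by
      intro q
      have a1 := H p h3 q
      have a2 : Ex N (fun l => ind (Inv (p ++ l) ∧ R q l)) ≤ 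
        Ex N (fun l => ind ((Inv (p ++ l) ∧ R q l) ∧ (l.Nodup ∧ ∀ x ∈ l, x ∉ p.toFinset)) + 
          ind (¬ (l.Nodup ∧ ∀ x ∈ l, x ∉ p.toFinset))) := by
        apply Ex_mono
        intro l _
        exact ind_split _ _
      rw [Ex_add] at a2
      linarith
    have hsum : c / 2 * ∑ q, w q ≤ Ex N (fun l => ∑ q, w q * ind ((Inv (p ++ l) ∧ R q l) ∧ 
        (l.Nodup ∧ ∀ x ∈ l, x ∉ p.toFinset))) := by
      rw [Ex_sum, Finset.mul_sum]
      apply Finset.sum_le_sum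
      intro q _
      rw [Ex_mul, mul_comm]
      exact mul_le_mul_of_nonneg_left (hq q) (hwpos q).le
    obtain ⟨l, hl, hl2⟩ := Ex_exists N hsum
    have hpos : 0 < ∑ q, w q := Finset.sum_pos (fun q _ => hwpos q) ⟨Classical.arbitrary Q, by simp⟩
    obtain ⟨q0, -, hq0⟩ := Finset.exists_lt_of_sum_lt (s := (univ : Finset Q)) (f := fun _ => (0:ℝ)) 
      (lt_of_lt_of_le (by simpa using (by positivity : 0 < c / 2 * ∑ q, w q)) hl2)
    have hg := ind_pos (pos_of_mul_pos_right hq0 (hwpos q0).le)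
    have hfl : p0 ++ (ls ++ [l]).flatten = p ++ l := by simp [hp]
    refine ⟨ls ++ [l], by simp [h1], ?_, ?_, ?_, ?_⟩
    · rw [hfl, List.nodup_append]
      refine ⟨h2, hg.2.1, ?_⟩
      rintro a ha b hb rfl
      exact hg.2.2 a hb (by simpa using ha)
    · rw [hfl]; exact hg.1.1
    · intro l' hl'
      rcases List.mem_append.mp hl' with h | h
      · exact h4 l' h
      · rw [List.mem_singleton.mp h, hl]
    · have key : ∀ q, (1/2 : ℝ) ^ ((ls ++ [l]).countP (fun l => decide (R q l))) ≤ 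
          w q - (1/2) * (w q * ind ((Inv (p ++ l) ∧ R q l) ∧ 
            (l.Nodup ∧ ∀ x ∈ l, x ∉ p.toFinset))) := by
        intro q
        rw [List.countP_append, pow_add]
        change w q * _ ≤ _
        by_cases hR : R q l
        · have := mul_le_mul_of_nonneg_left (ind_le_one ((Inv (p ++ l) ∧ R q l) ∧ 
            (l.Nodup ∧ ∀ x ∈ l, x ∉ p.toFinset))) (hwpos q).le
          have e : [l].countP (fun l => decide (R q l)) = 1 := by simp [hR]
          rw [e, pow_one]
          linarith
        · rw [ind_false (by tauto)]
          simp [hR]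
      refine (Finset.sum_le_sum fun q _ => key q).trans ?_
      rw [Finset.sum_sub_distrib, ← Finset.mul_sum, pow_succ, ← mul_assoc]
      have : ∑ q, w q * (1 - c/4) ≤ (Fintype.card Q : ℝ) * (1 - c / 4) ^ M * (1 - c/4) := by
        rw [← Finset.sum_mul]
        exact mul_le_mul_of_nonneg_right h5 (by linarith)
      rw [← Finset.sum_mul] at this
      linarith

lemma count_asymp (d : ℕ) (c β : ℝ) (hc : 0 < c) (hβ : 0 < β) : ∃ σ : ℝ, 0 < σ ∧ ∃ n0 : ℕ,
    ∀ n : ℕ, n0 ≤ n → ∀ x : ℕ, (1 - c/4 : ℝ) ≥ 0 → 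
      (1/2 : ℝ)^x ≤ (n:ℝ)^d * (1 - c/4)^(⌊β * n⌋₊) → σ * n ≤ x := by
  refine ⟨c * β / 16, by positivity, ?_⟩
  have h1 := (Real.isLittleO_log_id_atTop.comp_tendsto tendsto_natCast_atTop_atTop).bound 
    (show 0 < c * β / (16 * (d+1)) by positivity)
  obtain ⟨n1, hn1⟩ := Filter.eventually_atTop.mp h1
  obtain ⟨n2, hn2⟩ := exists_nat_gt (4 / β)
  refine ⟨max (max n1 n2) 1, ?_⟩
  intro n hn x hc4 hx
  have hn1' := hn1 n (le_trans (le_trans (le_max_left _ _) (le_max_left _ _)) hn)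
  have hn2' : n2 ≤ n := le_trans (le_trans (le_max_right _ _) (le_max_left _ _)) hn
  have hn3 : 1 ≤ n := le_trans (le_max_right _ _) hn
  have hnpos : (0:ℝ) < n := by exact_mod_cast hn3
  simp only [Function.comp, id, Real.norm_eq_abs, abs_of_pos hnpos] at hn1'
  have hlog : (d:ℝ) * Real.log n ≤ c * β / 16 * n := by
    have hl : Real.log n ≤ c * β / (16 * (d+1)) * n := (le_abs_self _).trans hn1'
    have hl0 : 0 ≤ Real.log n := Real.log_nonneg (by exact_mod_cast hn3)
    have : (d + 1 : ℝ) * Real.log n ≤ c * β / 16 * n := by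
      have := mul_le_mul_of_nonneg_left hl (by positivity : (0:ℝ) ≤ d + 1)
      refine this.trans (le_of_eq ?_)
      field_simp
    linarith
  have hM : β * n - 1 ≤ (⌊β * n⌋₊ : ℝ) := (Nat.sub_one_lt_floor _).le
  have hbn : 4 ≤ β * n := by
    have : (4 / β) < n := hn2.trans_le (by exact_mod_cast hn2')
    rw [div_lt_iff₀ hβ] at this
    linarith
  have h2 : (1 - c/4 : ℝ)^(⌊β * n⌋₊) ≤ Real.exp (-(c/4) * ⌊β * n⌋₊) := by
    rw [mul_comm (-(c/4)), Real.exp_nat_mul]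
    apply pow_le_pow_left₀ hc4
    have := Real.add_one_le_exp (-(c/4))
    linarith
  have h3 : (n:ℝ)^d = Real.exp (d * Real.log n) := by
    rw [Real.exp_nat_mul, Real.exp_log hnpos]
  have h4 : Real.exp (-(x:ℝ)) ≤ (1/2 : ℝ)^x := by
    rw [show -(x:ℝ) = x * (-1) by ring, Real.exp_nat_mul]
    apply pow_le_pow_left₀ (Real.exp_pos _).le
    rw [Real.exp_neg, one_div]
    apply inv_anti₀ (by norm_num)
    have := Real.add_one_le_exp (1:ℝ)
    linarith
  have h5 : Real.exp (-(x:ℝ)) ≤ Real.exp (d * Real.log n + -(c/4) * ⌊β * n⌋₊) := by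
    rw [Real.exp_add, ← h3]
    exact h4.trans (hx.trans (mul_le_mul_of_nonneg_left h2 (by positivity)))
  have h6 := Real.exp_le_exp.mp h5
  have h7 : c * (β * n - 1) ≤ c * ⌊β * n⌋₊ := mul_le_mul_of_nonneg_left hM hc.le
  have h8 : c * 4 ≤ c * (β * n) := mul_le_mul_of_nonneg_left hbn hc.le
  nlinarith

lemma absorb {V : Type} {h : ℕ} {E : Multiset V → Prop} (p0 e : List V) (Z : List V) : 
    ∀ segs : List (List V), Tight (h+1) E (p0 ++ segs.flatten ++ e) → 
    (∀ z ∈ Z, Z.length ≤ segs.countP (fun l => decide (Absb h E z l))) →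
    ∃ segs' : List (List V), Tight (h+1) E (p0 ++ segs'.flatten ++ e) ∧ 
      segs'.flatten.Perm (segs.flatten ++ Z) := by
  induction Z with
  | nil => intro segs h _; exact ⟨segs, h, by simp⟩
  | cons z Z ih =>
    intro segs T hcount
    have h1 := hcount z (by simp)
    obtain ⟨l, hl, hlz⟩ := List.countP_pos_iff.mp (lt_of_lt_of_le (by simp) h1)
    obtain ⟨c, p, q, rfl, hp, hq, Tz⟩ := of_decide_eq_true hlz
    obtain ⟨s1, s2, rfl⟩ := List.append_of_mem hl
    obtain ⟨segs', hs1, hs2⟩ := ih (s1 ++ (c ++ p ++ z :: q) :: s2) (by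
      have t1 : Tight (h+1) E ((p0 ++ s1.flatten ++ c) ++ p) := 
        tight_left (l := q ++ s2.flatten ++ e) (by simpa using T)
      have t2 : Tight (h+1) E (q ++ (s2.flatten ++ e)) := 
        tight_right (p := p0 ++ s1.flatten ++ c ++ p) (by simpa using T)
      have t3 := tight_join hp.ge t1 Tz
      have t4 := tight_join (p := p0 ++ s1.flatten ++ c ++ p ++ [z]) (a := q) hq.ge (by simpa using t3) t2
      simpa using t4) (by
      intro z' hz'
      have := hcount z' (by simp [hz'])
      rw [List.countP_append, List.countP_cons] at this ⊢
      simp only [List.length_cons] at this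
      split_ifs at this <;> omega)
    refine ⟨segs', hs1, hs2.trans ?_⟩
    rw [List.perm_iff_count]
    intro a
    simp only [List.flatten_append, List.flatten_cons, List.count_append, List.count_cons]
    ring

lemma join_all {V : Type} {h : ℕ} {E : Multiset V → Prop} (e : List V) (he : e.length = h) 
    (tiles : List (List V)) : ∀ (p : List V) (Rs : List (List V)), Tight (h+1) E p → h ≤ p.length →
    (∀ t ∈ tiles, Tight (h+1) E t ∧ h ≤ t.length) → 
    (∀ a b : List V, a.length = h → b.length = h → 
      tiles.length + 1 ≤ Rs.countP (fun c => decide (Tight (h+1) E (a ++ c ++ b)))) →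
    ∃ (mid : List V) (Rs' : List (List V)), Tight (h+1) E (p ++ mid ++ e) ∧ 
      (mid ++ Rs'.flatten).Perm (tiles.flatten ++ Rs.flatten) ∧ 
      tiles.flatten.length ≤ mid.length := by
  have step : ∀ (p t : List V) (Rs : List (List V)) (s : ℕ), Tight (h+1) E p → h ≤ p.length → 
    Tight (h+1) E t → h ≤ t.length →
    (∀ a b : List V, a.length = h → b.length = h → 
      s + 1 ≤ Rs.countP (fun c => decide (Tight (h+1) E (a ++ c ++ b)))) →
    ∃ c Rs', Rs.Perm (c :: Rs') ∧ Tight (h+1) E (p ++ c ++ t) ∧ 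
      (∀ a b : List V, a.length = h → b.length = h → 
      s ≤ Rs'.countP (fun c => decide (Tight (h+1) E (a ++ c ++ b)))) := by
    intro p t Rs s Tp hp Tt ht hc
    have ha : (p.drop (p.length - h)).length = h := by simp; omega
    have hb : (t.take h).length = h := by simp; omega
    obtain ⟨c, hcR, hcT⟩ := List.countP_pos_iff.mp (lt_of_lt_of_le (Nat.succ_pos s) (hc _ _ ha hb))
    have hcT := of_decide_eq_true hcT
    refine ⟨c, Rs.erase c, List.perm_cons_erase hcR, ?_, ?_⟩
    · have t1 := tight_join (p := p.take (p.length - h)) (a := p.drop (p.length - h)) 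
        (q := c ++ t.take h) ha.ge (by simpa using Tp) (by simpa using hcT)
      have t2 := tight_join (p := p ++ c) (a := t.take h) (q := t.drop h) hb.ge 
        (by simpa using t1) (by simpa using Tt)
      simpa using t2
    · intro a b ha hb
      have := hc a b ha hb
      rw [(List.perm_cons_erase hcR).countP_eq, List.countP_cons] at this
      split_ifs at this <;> omega
  induction tiles with
  | nil =>
    intro p Rs Tp hp _ hc
    obtain ⟨c, Rs', h1, h2, _⟩ := step p e Rs 0 Tp hp (tight_short (by omega)) he.ge (by simpa using hc)
    refine ⟨c, Rs', h2, ?_, by simp⟩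
    simpa using (h1.flatten).symm
  | cons t tiles ih =>
    intro p Rs Tp hp ht hc
    obtain ⟨c, Rs1, h1, h2, h3⟩ := step p t Rs (tiles.length + 1) Tp hp (ht t (by simp)).1 
      (ht t (by simp)).2 (by simpa using hc)
    obtain ⟨mid, Rs', h4, h5, h7⟩ := ih (p ++ c ++ t) Rs1 h2 (by simp; omega) 
      (fun t' ht' => ht t' (by simp [ht'])) h3
    refine ⟨c ++ t ++ mid, Rs', by simpa using h4, ?_, by
      simp only [List.flatten_cons, List.length_append] at *; omega⟩
    have h6 := h1.flatten
    rw [List.perm_iff_count] at h5 h6 ⊢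
    intro a
    have h5 := h5 a
    have h6 := h6 a
    simp only [List.flatten_cons, List.count_append] at h5 h6 ⊢
    omega

end Proof

section Proof
open scoped Classical

lemma clean {V : Type} (j M : ℕ) (s : ℕ) : ∀ (S A : Finset (Finset V)), S.card = s → 
    (∀ a ∈ A, ∀ x ⊆ a, x.card = j → x ∈ S) → M * S.card < A.card → 
    ∃ B ⊆ A, B.Nonempty ∧ ∀ b ∈ B, ∀ x ⊆ b, x.card = j → M < (B.filter (fun a => x ⊆ a)).card := by
  induction s with
  | zero =>
    intro S A hS h1 h2
    refine ⟨A, subset_rfl, Finset.card_pos.mp (by omega), ?_⟩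
    intro b hb x hx hj
    have := h1 b hb x hx hj
    rw [Finset.card_eq_zero.mp hS] at this
    simp at this
  | succ s ih =>
    intro S A hS h1 h2
    by_cases hex : ∃ x ∈ S, (A.filter (fun a => x ⊆ a)).card ≤ M
    · obtain ⟨x, hx, hxM⟩ := hex
      have hcard := Finset.card_filter_add_card_filter_not (s := A) (fun a => x ⊆ a)
      have hS' : (S.erase x).card = s := by rw [Finset.card_erase_of_mem hx]; omega
      obtain ⟨B, hB1, hB2, hB3⟩ := ih (S.erase x) (A.filter (fun a => ¬ x ⊆ a)) hS' (by
        intro a ha y hy hyj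
        rw [Finset.mem_filter] at ha
        refine Finset.mem_erase.mpr ⟨?_, h1 a ha.1 y hy hyj⟩
        rintro rfl
        exact ha.2 hy) (by
        rw [hS'] 
        rw [hS, Nat.mul_succ] at h2
        omega)
      exact ⟨B, hB1.trans (Finset.filter_subset _ _), hB2, hB3⟩
    · push Not at hex
      refine ⟨A, subset_rfl, Finset.card_pos.mp (by omega), ?_⟩
      intro b hb x hx hj
      exact hex x (h1 b hb x hx hj)

lemma dense_path {V : Type} (j M : ℕ) (hM : j + 1 ≤ M) (W : Finset V) (A : Finset (Finset V))
    (hA : ∀ a ∈ A, a ⊆ W ∧ a.card = j + 1) (hc : M * (W.card.choose j) < A.card) :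
    ∃ l : List V, l.length = M ∧ l.Nodup ∧ (∀ x ∈ l, x ∈ W) ∧
      Tight (j+1) (fun s => ∃ a ∈ A, a.val = s) l := by
  obtain ⟨B, hBA, ⟨b0, hb0⟩, hB⟩ := clean j M _ (W.powersetCard j) A rfl (by
    intro a ha x hx hj
    exact Finset.mem_powersetCard.mpr ⟨hx.trans (hA a ha).1, hj⟩) (by rwa [Finset.card_powersetCard])
  have main : ∀ m, j + 1 ≤ m → m ≤ M → ∃ l : List V, l.length = m ∧ l.Nodup ∧ (∀ x ∈ l, x ∈ W) ∧
      Tight (j+1) (fun s => ∃ a ∈ B, a.val = s) l := by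
    intro m hm
    induction m, hm using Nat.le_induction with
    | base =>
      intro _
      have hl : b0.toList.length = j + 1 := by rw [Finset.length_toList]; exact (hA b0 (hBA hb0)).2
      refine ⟨b0.toList, hl, Finset.nodup_toList _, fun x hx => (hA b0 (hBA hb0)).1 (by simpa using hx), ?_⟩
      exact tight_single hl ⟨b0, hb0, by simp⟩
    | succ m hm ih =>
      intro hmM
      obtain ⟨l, h1, h2, h3, h4⟩ := ih (by omega)
      obtain ⟨b, hb, hbl⟩ := h4 0 (by omega)
      simp only [List.drop_zero] at hbl
      have hnd : (l.take j).Nodup := h2.sublist (List.take_sublist _ _)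
      have hsub : (l.take j).toFinset ⊆ b := by
        intro x hx
        rw [List.mem_toFinset] at hx
        have : x ∈ b.val := by
          rw [hbl]
          exact Multiset.mem_coe.mpr ((List.take_sublist_take_left (by omega)).subset hx)
        exact this
      have hcard : (l.take j).toFinset.card = j := by
        rw [List.toFinset_card_of_nodup hnd]; simp; omega
      have hdeg := hB b hb _ hsub hcard
      have : ∃ a ∈ B.filter (fun a => (l.take j).toFinset ⊆ a), 
          a ∉ l.toFinset.image (fun x => insert x (l.take j).toFinset) := by
        apply Finset.exists_mem_notMem_of_card_lt_card
        refine lt_of_le_of_lt Finset.card_image_le (lt_of_le_of_lt (List.toFinset_card_le _) (by omega))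
      obtain ⟨a, ha, ha2⟩ := this
      rw [Finset.mem_filter] at ha
      have hac := (hA a (hBA ha.1)).2
      obtain ⟨x, hxa, hxS⟩ := Finset.exists_mem_notMem_of_card_lt_card (s := (l.take j).toFinset) (t := a) (by omega)
      have hins : insert x (l.take j).toFinset = a := by
        apply Finset.eq_of_subset_of_card_le
        · exact Finset.insert_subset hxa ha.2
        · rw [Finset.card_insert_of_notMem hxS]; omega
      have hxl : x ∉ l := by
        intro hx
        exact ha2 (Finset.mem_image.mpr ⟨x, by simpa using hx, hins⟩)
      refine ⟨x :: l, by simp [h1], List.nodup_cons.mpr ⟨hxl, h2⟩, ?_, ?_⟩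
      · intro y hy
        rcases List.mem_cons.mp hy with rfl | hy
        · exact (hA a (hBA ha.1)).1 hxa
        · exact h3 y hy
      · refine tight_cons.mpr ⟨fun _ => ⟨a, ha.1, ?_⟩, h4⟩
        rw [← hins, Finset.insert_val_of_notMem hxS, List.toFinset_val, hnd.dedup]
  obtain ⟨l, h1, h2, h3, h4⟩ := main M hM le_rfl
  refine ⟨l, h1, h2, h3, ?_⟩
  intro i hi
  obtain ⟨a, ha, h⟩ := h4 i hi
  exact ⟨a, hBA ha, h⟩

lemma tight_mono {V : Type} {k : ℕ} {E E' : Multiset V → Prop} (H : ∀ s, E s → E' s) {l : List V}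
    (h : Tight k E l) : Tight k E' l := fun i hi => H _ (h i hi)

lemma mk_tile {V : Type} {h b : ℕ} {E : Multiset V → Prop} {xs u : List V} (hx : xs.length = b)
    (hu : u.length = h + h * b) (H : ∀ x ∈ xs, Tight h (lnk E x) u) : 
    ∃ t : List V, t.length = h + (h+1) * b ∧ Tight (h+1) E t ∧ t.Perm (xs ++ u) := by
  have hp : (u.take h ++ weave h xs (u.drop h)).Perm (xs ++ u) := by
    refine ((weave_perm h xs (u.drop h)).append_left _).trans ?_
    rw [← List.append_assoc]
    refine (List.perm_append_comm.append_right _).trans ?_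
    rw [List.append_assoc, List.take_append_drop]
  refine ⟨u.take h ++ weave h xs (u.drop h), ?_, ?_, hp⟩
  · rw [hp.length_eq]; simp [hx, hu]; ring
  · refine weave_tight xs _ _ (by simp [hu]) (by simp [hu, hx]) ?_
    simpa using H

lemma three_tiles {V : Type} {h b : ℕ} {E : Multiset V → Prop} {X u : List V} (hx : X.length = 3 * b)
    (hu : u.length = 3 * (h + h * b)) (H : ∀ x ∈ X, Tight h (lnk E x) u) : 
    ∃ t1 t2 t3 : List V, (∀ t ∈ [t1, t2, t3], t.length = h + (h+1) * b ∧ Tight (h+1) E t) ∧ 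
      (t1 ++ t2 ++ t3).Perm (X ++ u) := by
  obtain ⟨X1, X2, X3, rfl, a1, a2, a3⟩ : ∃ X1 X2 X3, X = X1 ++ X2 ++ X3 ∧ X1.length = b ∧ X2.length = b ∧ X3.length = b :=
    ⟨X.take b, (X.drop b).take b, X.drop (2*b), by 
      rw [show 2 * b = b + b by ring, ← List.drop_drop, List.append_assoc, List.take_append_drop, List.take_append_drop],
      by simp; omega, by simp; omega, by simp; omega⟩
  obtain ⟨u1, u2, u3, rfl, c1, c2, c3⟩ : ∃ u1 u2 u3, u = u1 ++ u2 ++ u3 ∧ u1.length = h + h * b ∧ u2.length = h + h * b ∧ u3.length = h + h * b := by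
    generalize h + h * b = b at hu
    exact ⟨u.take b, (u.drop b).take b, u.drop (2*b), by 
      rw [show 2 * b = b + b by ring, ← List.drop_drop, List.append_assoc, List.take_append_drop, List.take_append_drop],
      by simp; omega, by simp; omega, by simp; omega⟩
  obtain ⟨t1, b1, d1, e1⟩ := mk_tile (E := E) a1 c1 (fun x hx => by
    have := H x (by simp [hx]); rw [List.append_assoc] at this; exact tight_left this)
  obtain ⟨t2, b2, d2, e2⟩ := mk_tile (E := E) a2 c2 (fun x hx => by
    have := H x (by simp [hx]); exact tight_infix this)
  obtain ⟨t3, b3, d3, e3⟩ := mk_tile (E := E) a3 c3 (fun x hx => by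
    have := H x (by simp [hx]); exact tight_right this)
  refine ⟨t1, t2, t3, ?_, ?_⟩
  · intro t ht
    simp only [List.mem_cons, List.not_mem_nil, or_false] at ht
    rcases ht with rfl | rfl | rfl
    exacts [⟨b1, d1⟩, ⟨b2, d2⟩, ⟨b3, d3⟩]
  · rw [List.perm_iff_count] at *
    intro a
    have := e1 a; have := e2 a; have := e3 a
    simp only [List.count_append] at *
    omega

end Proof

section Proof
open scoped Classical

lemma sparse_sum {V : Type} (h : ℕ) (E : Multiset V → Prop) (W : Finset V) :
    ∑ A ∈ W.powersetCard h, ∑ x ∈ W, ind (E (x ::ₘ A.val)) ≤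
      h * (W.card.choose h : ℝ) + (h + 1) * (((W.powersetCard (h+1)).filter (fun e => E e.val)).card : ℝ) := by
  have h1 : ∀ A ∈ W.powersetCard h, ∑ x ∈ W, ind (E (x ::ₘ A.val)) ≤
      (h : ℝ) + ((W.filter (fun x => x ∉ A ∧ E (x ::ₘ A.val))).card : ℝ) := by
    intro A hA
    have hA' := Finset.mem_powersetCard.mp hA
    have : ∀ x ∈ W, ind (E (x ::ₘ A.val)) ≤ (if x ∈ A then (1:ℝ) else 0) + 
        (if x ∉ A ∧ E (x ::ₘ A.val) then (1:ℝ) else 0) := by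
      intro x _
      unfold ind
      split_ifs <;> first | (norm_num; done) | tauto
    refine (Finset.sum_le_sum this).trans ?_
    rw [Finset.sum_add_distrib, Finset.sum_boole, Finset.sum_boole]
    gcongr
    rw [Finset.filter_mem_eq_inter, Finset.inter_eq_right.mpr hA'.1]
    exact hA'.2.le
  refine (Finset.sum_le_sum h1).trans ?_
  rw [Finset.sum_add_distrib, Finset.sum_const, Finset.card_powersetCard, nsmul_eq_mul, mul_comm]
  gcongr
  have h2 : ∑ A ∈ W.powersetCard h, (W.filter (fun x => x ∉ A ∧ E (x ::ₘ A.val))).card ≤ 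
      ∑ e ∈ (W.powersetCard (h+1)).filter (fun e => E e.val), e.card := by
    rw [← Finset.card_sigma, ← Finset.card_sigma]
    refine Finset.card_le_card_of_injOn (fun p => ⟨insert p.2 p.1, p.2⟩) ?_ ?_
    · rintro ⟨A, x⟩ hp
      simp only [Finset.coe_sigma, Set.mem_sigma_iff, Finset.mem_coe, Finset.mem_filter, Finset.mem_powersetCard] at hp ⊢
      obtain ⟨⟨a1, a2⟩, a3, a4, a5⟩ := hp
      refine ⟨⟨⟨Finset.insert_subset a3 a1, by rw [Finset.card_insert_of_notMem a4, a2]⟩, ?_⟩, by simp⟩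
      rwa [Finset.insert_val_of_notMem a4]
    · rintro ⟨A, x⟩ hp ⟨B, y⟩ hq heq
      simp only [Finset.coe_sigma, Set.mem_sigma_iff, Finset.mem_coe, Finset.mem_filter, Finset.mem_powersetCard] at hp hq
      simp only [Sigma.mk.injEq] at heq
      obtain ⟨e1, e2⟩ := heq
      have e2 := eq_of_heq e2
      subst e2
      have : A = B := by
        rw [← Finset.erase_insert hp.2.2.1, ← Finset.erase_insert hq.2.2.1, e1]
      subst this; rfl
  have h3 : ∑ e ∈ (W.powersetCard (h+1)).filter (fun e => E e.val), e.card = 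
     ((W.powersetCard (h+1)).filter (fun e => E e.val)).card * (h+1) := by
    apply Finset.sum_const_nat
    intro e he
    exact (Finset.mem_powersetCard.mp (Finset.mem_filter.mp he).1).2
  rw [h3] at h2
  rw [mul_comm]
  exact_mod_cast h2

lemma fiber_path {V : Type} (j M L : ℕ) (hM : j + 1 ≤ M) (δ : ℝ) (E : Multiset V → Prop)
    (W S : Finset V) (hS : S.card = 2 * L) (hL : 0 < L)
    (hsum : (W.card.choose (j+1) : ℝ) * L * (1 + δ) ≤ ∑ A ∈ W.powersetCard (j+1), ∑ x ∈ S, ind (E (x ::ₘ A.val)))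
    (hW : (2:ℝ)^(2*L) * (M * (W.card.choose j : ℝ)) < δ * (W.card.choose (j+1))) :
    ∃ X ⊆ S, L ≤ X.card ∧ ∃ u : List V, u.length = M ∧ u.Nodup ∧ (∀ x ∈ u, x ∈ W) ∧
      ∀ x ∈ X, Tight (j+1) (lnk E x) u := by
  set P := W.powersetCard (j+1) with hP
  have hPc : P.card = W.card.choose (j+1) := by rw [hP, Finset.card_powersetCard]
  let N : Finset V → Finset V := fun A => S.filter (fun x => E (x ::ₘ A.val))
  have hN : ∀ A, ∑ x ∈ S, ind (E (x ::ₘ A.val)) = ((N A).card : ℝ) := by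
    intro A
    unfold ind
    rw [Finset.sum_boole]
  simp only [hN] at hsum
  set P' := P.filter (fun A => L ≤ (N A).card) with hP'
  have hle : ∑ A ∈ P, ((N A).card : ℝ) ≤ ∑ A ∈ P, ((L:ℝ) + if L ≤ (N A).card then (L:ℝ) else 0) := by
    apply Finset.sum_le_sum
    intro A _
    have hNS : (N A).card ≤ 2 * L := hS ▸ Finset.card_filter_le _ _
    split_ifs with hh
    · have : ((N A).card : ℝ) ≤ (2 * L : ℕ) := by exact_mod_cast hNS
      push_cast at this; linarith
    · have : ((N A).card : ℝ) ≤ (L : ℕ) := by exact_mod_cast (by omega)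
      linarith
  rw [Finset.sum_add_distrib, Finset.sum_const, hPc, nsmul_eq_mul, ← Finset.sum_filter, Finset.sum_const, nsmul_eq_mul, ← hP'] at hle
  have hL' : (0:ℝ) < L := by exact_mod_cast hL
  have hbig : δ * (W.card.choose (j+1)) ≤ (P'.card : ℝ) := by
    have : L * (δ * (W.card.choose (j+1))) ≤ L * (P'.card : ℝ) := by nlinarith
    exact le_of_mul_le_mul_left this hL'
  have hpig : (S.powerset).card * (M * W.card.choose j) < P'.card := by
    rw [Finset.card_powerset, hS]
    have := hW.trans_le hbig
    exact_mod_cast this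
  obtain ⟨X, hX, hXc⟩ := Finset.exists_lt_card_fiber_of_mul_lt_card_of_maps_to (s := P') (t := S.powerset) (f := N) (by
    intro A _
    exact Finset.mem_powerset.mpr (Finset.filter_subset _ _)) hpig
  obtain ⟨u, u1, u2, u3, u4⟩ := dense_path j M hM W (P'.filter (fun A => N A = X)) (by
    intro a ha
    exact Finset.mem_powersetCard.mp (Finset.mem_filter.mp (Finset.mem_filter.mp ha).1).1) hXc
  refine ⟨X, Finset.mem_powerset.mp hX, ?_, u, u1, u2, u3, ?_⟩
  · obtain ⟨A, hA⟩ := Finset.card_pos.mp (lt_of_le_of_lt (Nat.zero_le _) hXc)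
    rw [Finset.mem_filter] at hA
    rw [← hA.2]
    exact (Finset.mem_filter.mp hA.1).2
  · intro x hx
    refine tight_mono ?_ u4
    rintro s ⟨A, hA, rfl⟩
    rw [Finset.mem_filter] at hA
    rw [← hA.2] at hx
    exact (Finset.mem_filter.mp hx).2

lemma heavy_one {α : Type} (g : α → ℝ) (Y : ℝ) (ts : List α) (H : ts.length * Y < (ts.map g).sum) :
    ∃ t ∈ ts, Y ≤ g t := by
  by_contra hc
  push Not at hc
  have := List.sum_le_card_nsmul (ts.map g) Y (by
    intro x hx
    obtain ⟨t, ht, rfl⟩ := List.mem_map.mp hx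
    exact (hc t ht).le)
  simp at this
  linarith

lemma heavy_two {α : Type} (g : α → ℝ) (Y G : ℝ) (hY : 0 ≤ Y) (ts : List α) (hG : ∀ t ∈ ts, g t ≤ G) (hG0 : 0 ≤ G)
    (H : ts.length * Y + G < (ts.map g).sum) :
    ∃ T T' rest, ts.Perm (T :: T' :: rest) ∧ Y ≤ g T ∧ Y ≤ g T' := by
  obtain ⟨T, hT, h1⟩ := heavy_one g Y ts (by linarith)
  have hp := List.perm_cons_erase hT
  have hs := (hp.map g).sum_eq
  have hl := hp.length_eq
  simp only [List.map_cons, List.sum_cons, List.length_cons] at hs hl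
  have hTG := hG T hT
  rw [hl] at H
  push_cast at H
  obtain ⟨T', hT', h2⟩ := heavy_one g Y (ts.erase T) (by nlinarith)
  exact ⟨T, T', _, hp.trans ((List.perm_cons_erase hT').cons T), h1, h2⟩

end Proof

section Proof
open scoped Classical

/-- A family of disjoint tiles avoiding `F`. -/
def Tiling {V : Type} (h L : ℕ) (E : Multiset V → Prop) (F : Finset V) (ts : List (List V)) : Prop :=
  (∀ t ∈ ts, t.length = L ∧ Tight (h+1) E t) ∧ ts.flatten.Nodup ∧ ∀ x ∈ ts.flatten, x ∉ F

lemma tiling_len {V : Type} {L : ℕ} {ts : List (List V)}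
    (H : ∀ t ∈ ts, t.length = L) : ts.flatten.length = ts.length * L := by
  induction ts with
  | nil => simp
  | cons t ts ih =>
    simp only [List.flatten_cons, List.length_append, List.length_cons]
    rw [ih (fun t ht => H t (by simp [ht])), H t (by simp)]; ring

lemma sum_flat {V : Type} (P : Finset (Finset V)) (f : Finset V → V → ℝ) (ts : List (List V)) :
    ∑ A ∈ P, (ts.flatten.map (f A)).sum = (ts.map (fun t => ∑ A ∈ P, (t.map (f A)).sum)).sum := by
  induction ts with
  | nil => simp
  | cons t ts ih =>
    simp only [List.flatten_cons, List.map_append, List.sum_append, Finset.sum_add_distrib, ih, List.map_cons, List.sum_cons]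

set_option maxHeartbeats 1000000 in
lemma augment (g b : ℕ) (hg : 1 ≤ g) (hb : 1 ≤ b) (η γ : ℝ) (hη : 0 < η) (hγ : 0 < γ) :
    ∃ n0 : ℕ, ∀ (V : Type) [Fintype V] (E : Multiset V → Prop), n0 ≤ Fintype.card V →
      Dir V (g+1) η E → ∀ F : Finset V, (F.card : ℝ) ≤ η / 4 * Fintype.card V → 
      ∀ ts, Tiling (g+1) (g+1+(g+2)*b) E F ts → 
        (F.card : ℝ) + ts.flatten.length + γ * Fintype.card V < Fintype.card V →
      ∃ ts', Tiling (g+1) (g+1+(g+2)*b) E F ts' ∧ ts'.length = ts.length + 1 := by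
  obtain ⟨L, hL⟩ : ∃ L, L = g+1+(g+2)*b := ⟨_, rfl⟩
  obtain ⟨M, hM⟩ : ∃ M, M = 3 * ((g+1) + (g+1)*b) := ⟨_, rfl⟩
  rw [← hL]
  obtain ⟨n1, hn1⟩ := exists_nat_gt ((2^(2*L) * M * (g+1) * (2/η) + g + 1) / γ)
  obtain ⟨n2, hn2⟩ := exists_nat_gt ((L + (g+1) + (g+2) * L) / (η/2))
  refine ⟨n1 + n2, ?_⟩
  intro V _ E hn HE F hF ts hts hsmall
  obtain ⟨ht1, ht2, ht3⟩ := hts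
  set n := Fintype.card V with hnV
  have hflat : ts.flatten.length = ts.length * L := tiling_len (fun t ht => (ht1 t ht).1)
  have hnr : (n1 : ℝ) + n2 ≤ n := by exact_mod_cast hn
  have hn1' : 2^(2*L) * M * (g+1) * (2/η) + g + 1 < γ * n := by
    rw [div_lt_iff₀ hγ] at hn1
    nlinarith [Nat.cast_nonneg (α := ℝ) n2]
  have hn2' : (L + (g+1) + (g+2) * L : ℝ) < η / 2 * n := by
    rw [div_lt_iff₀ (by positivity)] at hn2
    nlinarith [Nat.cast_nonneg (α := ℝ) n1]
  set Fl := ts.flatten.toFinset with hFl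
  have hFlc : Fl.card = ts.flatten.length := List.toFinset_card_of_nodup ht2
  have hdisj : Disjoint F Fl := by
    rw [Finset.disjoint_right]
    intro x hx
    exact ht3 x (by simpa [hFl] using hx)
  set W := (F ∪ Fl)ᶜ with hW
  have hWc : (W.card : ℝ) = n - F.card - ts.flatten.length := by
    have h1 := Finset.card_add_card_compl (F ∪ Fl)
    rw [Finset.card_union_of_disjoint hdisj, hFlc] at h1
    rw [← hnV] at h1
    rw [← h1]; push_cast; ring
  have hWbig : 2^(2*L) * M * (g+1) * (2/η) + g + 1 < (W.card : ℝ) := by linarith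
  have hWg : g + 1 ≤ W.card := by
    have : (g:ℝ) + 1 < W.card := lt_of_le_of_lt (by have : (0:ℝ) ≤ 2^(2*L) * M * (g+1) * (2/η) := by positivity
                                                    linarith) hWbig
    exact_mod_cast this.le
  have hWin : ∀ x ∈ W, x ∉ F ∧ x ∉ ts.flatten := by
    intro x hx
    rw [hW, Finset.mem_compl, Finset.mem_union, not_or] at hx
    exact ⟨hx.1, by simpa [hFl] using hx.2⟩
  set C : ℝ := (W.card.choose (g+1) : ℝ) with hC
  have hCpos : 0 < C := by
    rw [hC]; exact_mod_cast Nat.choose_pos hWg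
  by_cases hcase : L * W.card.choose (g+1) < ((W.powersetCard (g+1+1)).filter (fun e => E e.val)).card
  · obtain ⟨l, l1, l2, l3, l4⟩ := dense_path (g+1) L (by rw [hL]; nlinarith) W _ (by
      intro a ha
      exact Finset.mem_powersetCard.mp (Finset.mem_filter.mp ha).1) hcase
    refine ⟨l :: ts, ⟨?_, ?_, ?_⟩, by simp⟩
    · intro t ht
      rcases List.mem_cons.mp ht with rfl | ht
      · refine ⟨l1, tight_mono ?_ l4⟩
        rintro s ⟨a, ha, rfl⟩
        exact (Finset.mem_filter.mp ha).2
      · exact ht1 t ht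
    · rw [List.flatten_cons, List.nodup_append']
      exact ⟨l2, ht2, fun x hx hx' => (hWin x (l3 x hx)).2 hx'⟩
    · intro x hx
      rw [List.flatten_cons, List.mem_append] at hx
      rcases hx with hx | hx
      · exact (hWin x (l3 x hx)).1
      · exact ht3 x hx
  · push Not at hcase
    have hcase' : (((W.powersetCard (g+1+1)).filter (fun e => E e.val)).card : ℝ) ≤ L * C := by
      rw [hC]; exact_mod_cast hcase
    have hsp := sparse_sum (g+1) E W
    set P := W.powersetCard (g+1) with hP
    have hPc : (P.card : ℝ) = C := by rw [hP, Finset.card_powersetCard]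
    have hlow : ∀ A ∈ P, (1/2+η) * n ≤ ∑ x ∈ W, ind (E (x ::ₘ A.val)) + η/4*n + (ts.flatten.map (fun x => ind (E (x ::ₘ A.val)))).sum := by
      intro A hA
      have := HE A.val (Finset.mem_powersetCard.mp hA).2
      rw [← hnV] at this
      refine this.trans ?_
      have e1 : ∑ x : V, ind (E (x ::ₘ A.val)) = ∑ x ∈ W, ind (E (x ::ₘ A.val)) + ∑ x ∈ Wᶜ, ind (E (x ::ₘ A.val)) :=
        (Finset.sum_add_sum_compl W _).symm
      have e2 : Wᶜ = F ∪ Fl := by rw [hW, compl_compl]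
      rw [e1, e2, Finset.sum_union hdisj, hFl, List.sum_toFinset _ ht2]
      have : ∑ x ∈ F, ind (E (x ::ₘ A.val)) ≤ F.card := by
        refine (Finset.sum_le_card_nsmul _ _ 1 (fun x _ => ind_le_one _)).trans (by simp)
      linarith
    have hsum := Finset.sum_le_sum hlow
    rw [Finset.sum_add_distrib, Finset.sum_add_distrib, Finset.sum_const, Finset.sum_const, nsmul_eq_mul, nsmul_eq_mul, hPc, 
      sum_flat P (fun A x => ind (E (x ::ₘ A.val)))] at hsum
    set gg : List V → ℝ := fun t => ∑ A ∈ P, (t.map (fun x => ind (E (x ::ₘ A.val)))).sum with hgg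
    have hggle : ∀ t ∈ ts, gg t ≤ C * L := by
      intro t ht
      rw [← hPc]
      refine (Finset.sum_le_card_nsmul _ _ (L:ℝ) ?_).trans (by simp)
      intro A _
      refine (List.sum_le_card_nsmul _ 1 ?_).trans ?_
      · intro x hx
        obtain ⟨y, _, rfl⟩ := List.mem_map.mp hx
        exact ind_le_one _
      · simp [(ht1 t ht).1]
    have hmL : (ts.length : ℝ) * L ≤ n := by
      have : (ts.flatten.length : ℝ) = ts.length * L := by rw [hflat]; push_cast; ring
      rw [← this]
      have : (0:ℝ) ≤ W.card := by positivity
      have : (0:ℝ) ≤ F.card := by positivity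
      linarith
    obtain ⟨T, T', rest, hperm, hT, hT'⟩ := heavy_two gg (C * L * (1/2+η/4)) (C * L) (by positivity) ts hggle (by positivity) (by
      have a1 : (ts.length:ℝ) * (C * L * (1/2+η/4)) ≤ C * (1/2+η/4) * n := by
        have : 0 ≤ C * (1/2+η/4) := by positivity
        nlinarith
      have a2 : C * (L + (g+1) + (g+2) * L : ℝ) < C * (η / 2 * n) := mul_lt_mul_of_pos_left hn2' hCpos
      push_cast at hsp
      have a3 : ((g:ℝ)+1+1) * (((W.powersetCard (g+1+1)).filter (fun e => E e.val)).card : ℝ) ≤ (g+1+1) * (L * C) := by gcongr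
      have a4 : (ts.length:ℝ) * (C * L * (1/2+η/4)) + C * L + (g+1) * C + (g+2) * (L * C) < C * (1/2 + η/4) * n + C * (η/2*n) := by linarith
      linarith)
    have hpf := hperm.flatten
    have hnd := hpf.nodup_iff.mp ht2
    simp only [List.flatten_cons] at hpf hnd
    rw [← List.append_assoc] at hpf hnd
    have hnd' := List.nodup_append'.mp hnd
    have hTm := (ht1 T (hperm.mem_iff.mpr (by simp))).1
    have hTm' := (ht1 T' (hperm.mem_iff.mpr (by simp))).1
    have hScard : (T ++ T').toFinset.card = 2 * L := by
      rw [List.toFinset_card_of_nodup hnd'.1]; simp [hTm, hTm']; ring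
    have hLpos : 0 < L := by rw [hL]; omega
    obtain ⟨X, hX1, hX2, u, u1, u2, u3, u4⟩ := fiber_path g M L (by rw [hM]; omega) (η/2) E W (T++T').toFinset hScard hLpos (by
      rw [← hC, ← hP]
      have : ∑ A ∈ P, ∑ x ∈ (T ++ T').toFinset, ind (E (x ::ₘ A.val)) = gg T + gg T' := by
        rw [hgg, ← Finset.sum_add_distrib]
        apply Finset.sum_congr rfl
        intro A _
        rw [List.sum_toFinset _ hnd'.1]; simp
      rw [this]; linarith) (by
      have hid : (W.card.choose (g+1) : ℝ) * (g+1) = W.card.choose g * (W.card - g) := by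
        have := Nat.choose_succ_right_eq W.card g
        have h2 : ((W.card - g : ℕ) : ℝ) = W.card - g := Nat.cast_sub (by omega)
        rw [← h2]; exact_mod_cast this
      have hgpos : (0:ℝ) < W.card.choose g := by exact_mod_cast Nat.choose_pos (by omega)
      have : (2:ℝ)^(2*L) * (M * (W.card.choose g : ℝ)) * (g+1) < η / 2 * W.card.choose (g+1) * (g+1) := by
        have e : η / 2 * W.card.choose (g+1) * (g+1) = W.card.choose g * (η/2 * (W.card - g)) := by
          rw [mul_assoc, hid]; ring
        rw [e]
        have e2 : (2:ℝ)^(2*L) * M * (g+1) < η/2 * (W.card - g) := by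
          have : 2^(2*L) * M * (g+1) * (2/η) < (W.card - g : ℝ) := by linarith
          have e3 := mul_lt_mul_of_pos_left this (show 0 < η/2 by positivity)
          calc (2:ℝ)^(2*L) * M * (g+1) = η/2 * (2^(2*L) * M * (g+1) * (2/η)) := by field_simp
            _ < _ := e3
        calc (2:ℝ)^(2*L) * (M * (W.card.choose g : ℝ)) * (g+1) = W.card.choose g * ((2:ℝ)^(2*L) * M * (g+1)) := by ring
          _ < _ := mul_lt_mul_of_pos_left e2 hgpos
      exact lt_of_mul_lt_mul_right this (by positivity))
    have hLb : 3 * b ≤ L := by rw [hL]; nlinarith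
    have hXl : (X.toList.take (3*b)).length = 3*b := by simp; omega
    have hXm : ∀ x ∈ X.toList.take (3*b), x ∈ X := fun x hx => by simpa using List.mem_of_mem_take hx
    obtain ⟨t1, t2, t3, q1, q2⟩ := three_tiles (E := E) hXl (by rw [u1, hM]) (fun x hx => u4 x (hXm x hx))
    have hpn : (t1 ++ t2 ++ t3 ++ rest.flatten).Perm (X.toList.take (3*b) ++ u ++ rest.flatten) := q2.append_right _
    have hXT : ∀ x ∈ X.toList.take (3*b), x ∈ T ++ T' := fun x hx => by
      have := hX1 (hXm x hx); rwa [List.mem_toFinset] at this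
    refine ⟨t1 :: t2 :: t3 :: rest, ⟨?_, ?_, ?_⟩, by rw [hperm.length_eq]; simp⟩
    · intro t ht
      simp only [List.mem_cons] at ht
      rcases ht with rfl | rfl | rfl | ht
      · rw [hL]; exact q1 _ (by simp)
      · rw [hL]; exact q1 _ (by simp)
      · rw [hL]; exact q1 _ (by simp)
      · exact ht1 t (hperm.mem_iff.mpr (by simp [ht]))
    · have : (t1 ++ t2 ++ t3 ++ rest.flatten).Nodup := by
        rw [hpn.nodup_iff, List.nodup_append', List.nodup_append']
        refine ⟨⟨(Finset.nodup_toList X).sublist (List.take_sublist _ _), u2, ?_⟩, hnd'.2.1, ?_⟩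
        · intro x hx hx'
          exact (hWin x (u3 x hx')).2 (hpf.mem_iff.mpr (List.mem_append_left _ (hXT x hx)))
        · intro x hx hx'
          rcases List.mem_append.mp hx with hx | hx
          · exact hnd'.2.2 (hXT x hx) hx'
          · exact (hWin x (u3 x hx)).2 (hpf.mem_iff.mpr (List.mem_append_right _ hx'))
      simpa [List.append_assoc] using this
    · intro x hx
      have hx : x ∈ t1 ++ t2 ++ t3 ++ rest.flatten := by simpa [List.append_assoc] using hx
      rw [hpn.mem_iff] at hx
      rcases List.mem_append.mp hx with hx | hx
      · rcases List.mem_append.mp hx with hx | hx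
        · exact ht3 x (hpf.mem_iff.mpr (List.mem_append_left _ (hXT x hx)))
        · exact (hWin x (u3 x hx)).1
      · exact ht3 x (hpf.mem_iff.mpr (List.mem_append_right _ hx))

end Proof

section Proof
open scoped Classical

lemma tiling (g b : ℕ) (hg : 1 ≤ g) (hb : 1 ≤ b) (η γ : ℝ) (hη : 0 < η) (hγ : 0 < γ) :
    ∃ n0 : ℕ, ∀ (V : Type) [Fintype V] (E : Multiset V → Prop), n0 ≤ Fintype.card V →
      Dir V (g+1) η E → ∀ F : Finset V, (F.card : ℝ) ≤ η / 4 * Fintype.card V → 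
      ∃ ts, Tiling (g+1) (g+1+(g+2)*b) E F ts ∧ 
        (Fintype.card V : ℝ) ≤ (F.card : ℝ) + ts.flatten.length + γ * Fintype.card V := by
  obtain ⟨n0, H⟩ := augment g b hg hb η γ hη hγ
  refine ⟨n0, ?_⟩
  intro V _ E hn HE F hF
  by_contra hc
  push Not at hc
  have hall : ∀ m : ℕ, ∃ ts, Tiling (g+1) (g+1+(g+2)*b) E F ts ∧ ts.length = m := by
    intro m
    induction m with
    | zero => exact ⟨[], ⟨by simp, by simp, by simp⟩, rfl⟩
    | succ m ih =>
      obtain ⟨ts, h1, h2⟩ := ih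
      obtain ⟨ts', h3, h4⟩ := H V E hn HE F hF ts h1 (hc ts h1)
      exact ⟨ts', h3, by omega⟩
  obtain ⟨ts, h1, h2⟩ := hall (Fintype.card V + 1)
  have h3 := tiling_len (fun t ht => (h1.1 t ht).1)
  have h4 := h1.2.1.length_le_card
  rw [h3, h2] at h4
  have h5 := Nat.le_mul_of_pos_right (Fintype.card V + 1) (show 0 < g + 1 + (g+2)*b by omega)
  omega

lemma abs_path (g : ℕ) (η ε : ℝ) (hη : 0 < η) (hε : 0 < ε) : ∃ σ : ℝ, 0 < σ ∧ ∃ n0 : ℕ,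
    ∀ (V : Type) [Fintype V] [Nonempty V] (E : Multiset V → Prop), n0 ≤ Fintype.card V → 
    Dir V (g+1) η E → ∃ (p0 : List V) (segs : List (List V)), p0.length = g+1 ∧ (p0 ++ segs.flatten).Nodup ∧ 
      Tight (g+2) E (p0 ++ segs.flatten) ∧ ((p0 ++ segs.flatten).length : ℝ) ≤ ε * Fintype.card V ∧
      ∀ v, σ * Fintype.card V ≤ segs.countP (fun l => decide (Absb (g+1) E v l)) := by
  obtain ⟨c1, hc1, H1⟩ := connect η hη (g+1)
  obtain ⟨N, hN⟩ : ∃ N, N = (g+1+1)*(g+1) := ⟨_, rfl⟩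
  rw [← hN] at H1
  obtain ⟨K, hK⟩ : ∃ K, K = N + 2*(g+1) := ⟨_, rfl⟩
  have hK0 : (0:ℝ) < K := by rw [hK]; positivity
  obtain ⟨c, hc⟩ : ∃ c, c = min (c1 * (2*η)^(2*(g+1))) 1 := ⟨_, rfl⟩
  have hc0 : 0 < c := by rw [hc]; positivity
  have hc1' : c ≤ c1 * (2*η)^(2*(g+1)) := hc ▸ min_le_left _ _
  have hc1'' : c ≤ 1 := hc ▸ min_le_right _ _
  obtain ⟨β, hβ⟩ : ∃ β, β = min (ε/(2*K)) (c/(4*K^2)) := ⟨_, rfl⟩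
  have hβ0 : 0 < β := by rw [hβ]; positivity
  have hβ1 : K * β ≤ ε / 2 := by
    have : β ≤ ε/(2*K) := hβ ▸ min_le_left _ _
    rw [le_div_iff₀ (by positivity)] at this
    linarith
  have hβ2 : K^2 * β ≤ c / 4 := by
    have : β ≤ c/(4*K^2) := hβ ▸ min_le_right _ _
    rw [le_div_iff₀ (by positivity)] at this
    linarith
  obtain ⟨σ, hσ, n1, H2⟩ := count_asymp 1 c β hc0 hβ0
  refine ⟨σ, hσ, ?_⟩
  obtain ⟨n2, hn2⟩ := exists_nat_gt ((g+1) / (ε/2))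
  obtain ⟨n3, hn3⟩ := exists_nat_gt (K*(g+1+K) / (c/4))
  refine ⟨n1 + n2 + n3 + (g+1), ?_⟩
  intro V _ _ E hn HE
  set n := Fintype.card V with hnV
  have hn2' : (g+1 : ℝ) ≤ ε / 2 * n := by
    rw [div_lt_iff₀ (by positivity)] at hn2
    have : (n2:ℝ) ≤ n := by exact_mod_cast (by omega)
    nlinarith
  have hn3' : (K*(g+1+K) : ℝ) ≤ c/4 * n := by
    rw [div_lt_iff₀ (by positivity)] at hn3
    have : (n3:ℝ) ≤ n := by exact_mod_cast (by omega)
    nlinarith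
  have hfl : (⌊β * n⌋₊ : ℝ) ≤ β * n := Nat.floor_le (by positivity)
  obtain ⟨S, hS1, hS2⟩ := Finset.exists_subset_card_eq (s := (Finset.univ : Finset V)) (n := g+1) (by rw [Finset.card_univ]; omega)
  have hlen : S.toList.length = g+1 := by rw [Finset.length_toList, hS2]
  obtain ⟨segs, s1, s2, s3, s4, s5⟩ := select (V := V) (Q := V) K c hc0 
    (fun p => Tight (g+2) E p ∧ g+1 ≤ p.length) (fun v l => Absb (g+1) E v l) (by
      rintro p ⟨hp1, hp2⟩ v
      refine hc1'.trans ?_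
      rw [hK, Ex_append, Ex_swap]
      have ha : (p.drop (p.length - (g+1))).length = g+1 := by simp; omega
      have hac := absorb_count hη HE v
      calc c1 * (2*η)^(2*(g+1)) ≤ c1 * Ex (2*(g+1)) (fun t => ind (Tight (g+2) E t ∧ Absb (g+1) E v t)) := by gcongr
        _ = Ex (2*(g+1)) (fun t => c1 * ind (Tight (g+2) E t ∧ Absb (g+1) E v t)) := (Ex_mul _ _ _).symm
        _ ≤ _ := by
          apply Ex_mono
          intro t ht
          by_cases hT : Tight (g+2) E t ∧ Absb (g+1) E v t
          · rw [ind_true hT, mul_one]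
            have hb : (t.take (g+1)).length = g+1 := by simp; omega
            refine (H1 V E HE _ _ ha hb).trans ?_
            apply Ex_mono
            intro x _
            apply ind_mono
            intro hx
            refine ⟨⟨?_, by simp; omega⟩, ?_⟩
            · have t1 := tight_join (p := p.take (p.length - (g+1))) (a := p.drop (p.length - (g+1))) 
                (q := x ++ t.take (g+1)) ha.ge (by simpa using hp1) (by simpa using hx)
              have t2 := tight_join (p := p ++ x) (a := t.take (g+1)) (q := t.drop (g+1)) hb.ge 
                (by simpa using t1) (by simpa using hT.1)
              simpa using t2
            · obtain ⟨c', p', q', rfl, h1, h2, h3⟩ := hT.2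
              exact ⟨x ++ c', p', q', by simp, h1, h2, h3⟩
          · rw [ind_false hT, mul_zero]
            exact Ex_nonneg _ (fun _ => ind_nonneg _))
    S.toList ⟨tight_short (by omega), by omega⟩ (Finset.nodup_toList S) ⌊β * n⌋₊ (by
      rw [hlen, ← hnV]
      push_cast
      nlinarith [mul_le_mul_of_nonneg_left hfl (show 0 ≤ (K:ℝ)^2 by positivity), mul_le_mul_of_nonneg_right hβ2 (Nat.cast_nonneg (α := ℝ) n)])
  refine ⟨S.toList, segs, hlen, s2, s3.1, ?_, ?_⟩
  · rw [List.length_append, hlen, tiling_len s4, s1]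
    push_cast
    nlinarith [mul_le_mul_of_nonneg_right hβ1 (Nat.cast_nonneg (α := ℝ) n)]
  · intro v
    refine H2 n (by omega) _ (by linarith) ?_
    rw [pow_one]
    refine le_trans ?_ s5
    exact Finset.single_le_sum (f := fun q => (1/2 : ℝ) ^ (segs.countP (fun l => decide (Absb (g+1) E q l)))) (fun _ _ => by positivity) (Finset.mem_univ v)

lemma reservoir (h : ℕ) (η : ℝ) (hη : 0 < η) : ∃ κ : ℝ, 0 < κ ∧ ∀ ε : ℝ, 0 < ε → ∃ σ : ℝ, 0 < σ ∧ ∃ n0 : ℕ,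
    ∀ (V : Type) [Fintype V] [Nonempty V] (E : Multiset V → Prop), n0 ≤ Fintype.card V → 
    Dir V h η E → ∀ p0 : List V, p0.Nodup → (p0.length : ℝ) ≤ κ * Fintype.card V → 
    ∃ Rs : List (List V), (p0 ++ Rs.flatten).Nodup ∧ (Rs.flatten.length : ℝ) ≤ ε * Fintype.card V ∧ 
      ∀ a b : List V, a.length = h → b.length = h → 
        σ * Fintype.card V ≤ Rs.countP (fun c => decide (Tight (h+1) E (a ++ c ++ b))) := by
  obtain ⟨c1, hc1, H1⟩ := connect η hη h
  obtain ⟨N, hN⟩ : ∃ N, N = (h+1)*h := ⟨_, rfl⟩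
  rw [← hN] at H1
  obtain ⟨c, hc⟩ : ∃ c, c = min c1 1 := ⟨_, rfl⟩
  have hc0 : 0 < c := by rw [hc]; positivity
  have hc1' : c ≤ c1 := hc ▸ min_le_left _ _
  have hc1'' : c ≤ 1 := hc ▸ min_le_right _ _
  refine ⟨c / (8*(N+1)), by positivity, ?_⟩
  intro ε hε
  obtain ⟨β, hβ⟩ : ∃ β, β = min (ε/(N+1)) (c/(8*(N+1)^2)) := ⟨_, rfl⟩
  have hβ0 : 0 < β := by rw [hβ]; positivity
  have hβ1 : (N+1) * β ≤ ε := by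
    have : β ≤ ε/(N+1) := hβ ▸ min_le_left _ _
    rw [le_div_iff₀ (by positivity)] at this
    linarith
  have hβ2 : (N+1)^2 * β ≤ c / 8 := by
    have : β ≤ c/(8*(N+1)^2) := hβ ▸ min_le_right _ _
    rw [le_div_iff₀ (by positivity)] at this
    linarith
  obtain ⟨σ, hσ, n1, H2⟩ := count_asymp (2*h) c β hc0 hβ0
  refine ⟨σ, hσ, ?_⟩
  obtain ⟨n3, hn3⟩ := exists_nat_gt ((N+1)*(N+1) / (c/8))
  refine ⟨n1 + n3, ?_⟩
  intro V _ _ E hn HE p0 hnd hp0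
  set n := Fintype.card V with hnV
  have hn3' : ((N+1)*(N+1) : ℝ) ≤ c/8 * n := by
    rw [div_lt_iff₀ (by positivity)] at hn3
    have : (n3:ℝ) ≤ n := by exact_mod_cast (by omega)
    nlinarith
  have hfl : (⌊β * n⌋₊ : ℝ) ≤ β * n := Nat.floor_le (by positivity)
  have hN0 : (0:ℝ) ≤ N := by positivity
  have hn0 : (0:ℝ) ≤ n := by positivity
  have hM0 : (0:ℝ) ≤ (⌊β * n⌋₊ : ℝ) := by positivity
  obtain ⟨Rs, s1, s2, s3, s4, s5⟩ := select (V := V) (Q := (Fin h → V) × (Fin h → V)) N c hc0 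
    (fun _ => True) (fun q l => Tight (h+1) E (List.ofFn q.1 ++ l ++ List.ofFn q.2)) (by
      rintro p - q
      refine hc1'.trans ((H1 V E HE _ _ (List.length_ofFn (f := q.1)) (List.length_ofFn (f := q.2))).trans ?_)
      apply Ex_mono
      intro x _
      exact ind_mono (fun hx => ⟨trivial, hx⟩))
    p0 trivial hnd ⌊β * n⌋₊ (by
      rw [← hnV]
      have e1 : (N+1) * (p0.length : ℝ) ≤ c / 8 * n := by
        calc (N+1) * (p0.length : ℝ) ≤ (N+1) * (c / (8*(N+1)) * n) := by gcongr
          _ = c/8*n := by field_simp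
      have e2 : (N+1)^2 * (⌊β * n⌋₊ : ℝ) ≤ c / 8 * n := by
        calc (N+1)^2 * (⌊β * n⌋₊ : ℝ) ≤ (N+1)^2 * (β * n) := by gcongr
          _ = ((N+1)^2 * β) * n := by ring
          _ ≤ _ := by gcongr
      have e3 : (0:ℝ) ≤ p0.length := by positivity
      nlinarith)
  refine ⟨Rs, s2, ?_, ?_⟩
  · rw [tiling_len s4, s1]
    push_cast
    nlinarith [mul_le_mul_of_nonneg_right hβ1 hn0]
  · intro a b ha hb
    refine H2 n (by omega) _ (by linarith) ?_
    have hcard : (Fintype.card ((Fin h → V) × (Fin h → V)) : ℝ) = (n:ℝ)^(2*h) := by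
      rw [Fintype.card_prod, Fintype.card_fun, Fintype.card_fin]; push_cast; rw [← pow_add, two_mul]
    rw [hcard] at s5
    refine le_trans ?_ s5
    have key := Finset.single_le_sum (f := fun q : (Fin h → V) × (Fin h → V) => (1/2 : ℝ) ^ (Rs.countP (fun l => decide (Tight (h+1) E (List.ofFn q.1 ++ l ++ List.ofFn q.2))))) (fun _ _ => by positivity) (Finset.mem_univ (fun i => a.get (i.cast ha.symm), fun i => b.get (i.cast hb.symm)))
    have ea : List.ofFn (fun i : Fin h => a.get (i.cast ha.symm)) = a := by
      subst ha; simp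
    have eb : List.ofFn (fun i : Fin h => b.get (i.cast hb.symm)) = b := by
      subst hb; simp
    simp only [ea, eb] at key
    exact key

end Proof

section Proof
open scoped Classical

set_option maxHeartbeats 1000000 in
lemma tight_ham (g : ℕ) (hg : 1 ≤ g) (η : ℝ) (hη : 0 < η) : ∃ n0 : ℕ,
    ∀ (V : Type) [Fintype V] [Nonempty V] (E : Multiset V → Prop), n0 ≤ Fintype.card V → 
    Dir V (g+1) η E → ∃ p0 l : List V, p0.length = g+1 ∧ (p0 ++ l).Nodup ∧ (∀ x, x ∈ p0 ++ l) ∧ 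
      Tight (g+2) E (p0 ++ l ++ p0) := by
  obtain ⟨κ, hκ, HR⟩ := reservoir (g+1) η hη
  obtain ⟨σ, hσ, nA, HA⟩ := abs_path g η (min κ (η/8)) hη (by positivity)
  obtain ⟨τ, hτ, nR, HR⟩ := HR (min (σ/4) (η/8)) (by positivity)
  obtain ⟨b, hb⟩ := exists_nat_gt (2/τ)
  have hbpos : 1 ≤ b := by
    have : (0:ℝ) < b := lt_trans (by positivity) hb
    exact_mod_cast this
  have hb' : 2 < τ * b := by
    rw [div_lt_iff₀ hτ] at hb; linarith
  obtain ⟨nT, HT⟩ := tiling g b hg hbpos η (σ/4) hη (by positivity)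
  refine ⟨nA + nR + nT + b, ?_⟩
  intro V _ _ E hn HE
  set n := Fintype.card V with hnV
  have hnb : (b:ℝ) ≤ n := by exact_mod_cast (by omega)
  have hn0 : (0:ℝ) ≤ n := by positivity
  obtain ⟨p0, segs, a1, a2, a3, a4, a5⟩ := HA V E (by omega) HE
  have a4k : ((p0 ++ segs.flatten).length : ℝ) ≤ κ * n := a4.trans (by gcongr; exact min_le_left _ _)
  have a4e : ((p0 ++ segs.flatten).length : ℝ) ≤ η/8 * n := a4.trans (by gcongr; exact min_le_right _ _)
  obtain ⟨Rs, r1, r2, r3⟩ := HR V E (by omega) HE (p0 ++ segs.flatten) a2 a4k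
  have r2s : (Rs.flatten.length : ℝ) ≤ σ/4 * n := r2.trans (by gcongr; exact min_le_left _ _)
  have r2e : (Rs.flatten.length : ℝ) ≤ η/8 * n := r2.trans (by gcongr; exact min_le_right _ _)
  have hFc : (p0 ++ segs.flatten ++ Rs.flatten).toFinset.card = (p0 ++ segs.flatten).length + Rs.flatten.length := by
    rw [List.toFinset_card_of_nodup r1, List.length_append]
  obtain ⟨ts, ⟨t1, t2, t3⟩, t4⟩ := HT V E (by omega) HE (p0 ++ segs.flatten ++ Rs.flatten).toFinset (by
    rw [hFc]; push_cast at *; linarith)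
  rw [hFc] at t4
  have hts : (ts.length : ℝ) * b ≤ n := by
    have h1 := tiling_len (fun t ht => (t1 t ht).1)
    have h2 := t2.length_le_card
    rw [h1] at h2
    have : ts.length * b ≤ ts.length * (g + 1 + (g+2)*b) := Nat.mul_le_mul_left _ (by nlinarith)
    exact_mod_cast this.trans h2
  have hts' : (ts.length : ℝ) + 1 ≤ τ * n := by
    have hb0 : (0:ℝ) < b := by exact_mod_cast hbpos
    have : ((ts.length : ℝ) + 1) * b ≤ (τ * n) * b := by nlinarith
    exact le_of_mul_le_mul_right this hb0
  obtain ⟨mid, Rs', m1, m2, m3⟩ := join_all (h := g+1) (E := E) p0 a1 ts (p0 ++ segs.flatten) Rs a3 (by simp; omega) (by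
    intro t ht
    exact ⟨(t1 t ht).2, by rw [(t1 t ht).1]; omega⟩) (by
    intro a b ha hb
    have := hts'.trans (r3 a b ha hb)
    exact_mod_cast this)
  have hndall : (p0 ++ segs.flatten ++ (mid ++ Rs'.flatten)).Nodup := by
    rw [(m2.append_left _).nodup_iff]
    rw [List.nodup_append'] at r1 ⊢
    refine ⟨r1.1, ?_, ?_⟩
    · rw [List.nodup_append']
      refine ⟨t2, r1.2.1, ?_⟩
      intro x hx hx'
      exact t3 x hx (by rw [List.mem_toFinset]; exact List.mem_append_right _ hx')
    · intro x hx hx'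
      rcases List.mem_append.mp hx' with hx' | hx'
      · exact t3 x hx' (by rw [List.mem_toFinset]; exact List.mem_append_left _ hx)
      · exact r1.2.2 hx hx'
  have hnd : (p0 ++ segs.flatten ++ mid).Nodup := by
    rw [← List.append_assoc] at hndall
    exact (List.nodup_append'.mp hndall).1
  set Z := ((p0 ++ segs.flatten ++ mid).toFinsetᶜ).toList with hZ
  have hZlen : Z.length + (p0 ++ segs.flatten ++ mid).length = n := by
    rw [hZ, Finset.length_toList, ← List.toFinset_card_of_nodup hnd, add_comm, Finset.card_add_card_compl]
  have hZs : (Z.length : ℝ) ≤ σ * n := by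
    have h1 : (Z.length : ℝ) + ((p0 ++ segs.flatten).length + mid.length) = n := by
      rw [← hZlen, List.length_append (bs := mid)]; push_cast; ring
    have h2 : (ts.flatten.length : ℝ) ≤ mid.length := by exact_mod_cast m3
    push_cast at t4
    have : 0 ≤ σ * n := by positivity
    linarith
  obtain ⟨segs', s1, s2⟩ := absorb (h := g+1) (E := E) p0 (mid ++ p0) Z segs (by simpa using m1) (by
    intro z _
    have := hZs.trans (a5 z)
    exact_mod_cast this)
  have hperm : (p0 ++ (segs'.flatten ++ mid)).Perm (p0 ++ segs.flatten ++ mid ++ Z) := by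
    rw [List.perm_iff_count] at s2 ⊢
    intro a
    have := s2 a
    simp only [List.count_append] at this ⊢
    omega
  refine ⟨p0, segs'.flatten ++ mid, a1, ?_, ?_, by simpa using s1⟩
  · rw [hperm.nodup_iff, List.nodup_append']
    refine ⟨hnd, Finset.nodup_toList _, ?_⟩
    intro x hx hx'
    rw [hZ, Finset.mem_toList, Finset.mem_compl, List.mem_toFinset] at hx'
    exact hx' hx
  · intro x
    rw [hperm.mem_iff, List.mem_append, hZ, Finset.mem_toList, Finset.mem_compl, List.mem_toFinset]
    exact Classical.em _

end Proof

section Proof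
open scoped Classical

/-- The edge predicate extended to multisets. -/
def edgeP {n : ℕ} (H : Finset (Finset (Fin n))) (m : Multiset (Fin n)) : Prop :=
  ¬ m.Nodup ∨ m.toFinset ∈ H

lemma degree_le {n k : ℕ} (H : Finset (Finset (Fin n))) (hH : IsKGraph n (k+1) H) (A : Finset (Fin n))
    (hA : A.card = k) : (degree n H A : ℝ) ≤ ∑ x, ind (edgeP H (x ::ₘ A.val)) := by
  have h1 : ∑ x, ind (edgeP H (x ::ₘ A.val)) = ((Finset.univ.filter (fun x => edgeP H (x ::ₘ A.val))).card : ℝ) := by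
    unfold ind; rw [Finset.sum_boole]
  rw [h1, degree]
  have h2 : H.filter (fun e => A ⊆ e) ⊆ (Finset.univ.filter (fun x => edgeP H (x ::ₘ A.val))).image (fun x => insert x A) := by
    intro e he
    rw [Finset.mem_filter] at he
    have hc := hH e he.1
    obtain ⟨x, hxe, hxA⟩ := Finset.exists_mem_notMem_of_card_lt_card (s := A) (t := e) (by omega)
    have hins : insert x A = e := by
      apply Finset.eq_of_subset_of_card_le (Finset.insert_subset hxe he.2)
      rw [Finset.card_insert_of_notMem hxA]; omega
    refine Finset.mem_image.mpr ⟨x, Finset.mem_filter.mpr ⟨Finset.mem_univ _, Or.inr ?_⟩, hins⟩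
    rw [← Finset.insert_val_of_notMem hxA, Finset.val_toFinset, hins]
    exact he.1
  exact_mod_cast (Finset.card_le_card h2).trans Finset.card_image_le

lemma dir_of_degree {n g : ℕ} (hn : g + 2 ≤ n) (η : ℝ) (H : Finset (Finset (Fin n))) (hH : IsKGraph n (g+2) H)
    (hd : MinDegreeGe n (g+2) H ((1/2+η)*n)) : Dir (Fin n) (g+1) η (edgeP H) := by
  have key : ∀ A : Finset (Fin n), A.card = g+1 → (1/2+η)*n ≤ ∑ x, ind (edgeP H (x ::ₘ A.val)) := by
    intro A hA
    exact (hd A (by omega)).trans (degree_le H hH A hA)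
  intro m hm
  rw [Fintype.card_fin]
  by_cases hnd : m.Nodup
  · exact key ⟨m, hnd⟩ hm
  · obtain ⟨S, -, hS2⟩ := Finset.exists_subset_card_eq (s := (Finset.univ : Finset (Fin n))) (n := g+1) 
      (by rw [Finset.card_univ, Fintype.card_fin]; omega)
    refine (key S hS2).trans (Finset.sum_le_sum ?_)
    intro x _
    have : edgeP H (x ::ₘ m) := Or.inl (fun h => hnd (Multiset.nodup_cons.mp h).2)
    rw [ind_true this]
    exact ind_le_one _

lemma list_to_cycle {n g : ℕ} (hn : g + 2 ≤ n) (H : Finset (Finset (Fin n))) (p0 l : List (Fin n))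
    (hp0 : p0.length = g+1) (hnd : (p0 ++ l).Nodup) (hall : ∀ x, x ∈ p0 ++ l)
    (hT : Tight (g+2) (edgeP H) (p0 ++ l ++ p0)) : 
    ∃ f : ZMod n ≃ Fin n, ∀ s < n, (Finset.range (g+2)).image (fun t => f ((s + t : ℕ) : ZMod n)) ∈ H := by
  obtain ⟨L, hL⟩ : ∃ L, L = p0 ++ l := ⟨_, rfl⟩
  rw [← hL] at hnd hall hT
  have hlen : L.length = n := by
    rw [← List.toFinset_card_of_nodup hnd, show L.toFinset = Finset.univ from 
      Finset.eq_univ_iff_forall.mpr (fun x => by simpa using hall x), Finset.card_univ, Fintype.card_fin]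
  haveI : NeZero n := ⟨by omega⟩
  let f0 : ZMod n → Fin n := fun z => L[z.val]'(by rw [hlen]; exact ZMod.val_lt z)
  have hinj : Function.Injective f0 := by
    intro a b hab
    have := (List.Nodup.getElem_inj_iff hnd).mp hab
    exact ZMod.val_injective n this
  let f : ZMod n ≃ Fin n := Equiv.ofBijective f0 ((Fintype.bijective_iff_injective_and_card f0).2 
    ⟨hinj, by rw [ZMod.card, Fintype.card_fin]⟩)
  refine ⟨f, ?_⟩
  intro s hs
  have hf : ∀ t (ht : t < g+2), f ((s + t : ℕ) : ZMod n) = (L ++ p0)[s+t]'(by simp [hlen, hp0]; omega) := by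
    intro t ht
    change L[(((s + t : ℕ) : ZMod n)).val]'_ = _
    by_cases hc : s + t < n
    · rw [List.getElem_append_left (by omega)]
      congr 1
      rw [ZMod.val_natCast, Nat.mod_eq_of_lt hc]
    · rw [List.getElem_append_right (by omega)]
      have hv : ((s + t : ℕ) : ZMod n).val = s + t - n := by
        rw [ZMod.val_natCast, Nat.mod_eq_sub_mod (by omega), Nat.mod_eq_of_lt (by omega)]
      have : p0[s + t - L.length]'(by omega) = L[s + t - n]'(by omega) := by
        subst hL
        rw [List.getElem_append_left (by omega)]
        congr 1
        omega
      rw [this]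
      congr 1
  have hwin : ((L ++ p0).drop s).take (g+2) = (List.range (g+2)).map (fun t => f ((s + t : ℕ) : ZMod n)) := by
    apply List.ext_getElem
    · simp [hlen, hp0]; omega
    · intro i h1 h2
      simp only [List.length_map, List.length_range] at h2
      rw [List.getElem_map, List.getElem_range, hf i h2, List.getElem_take, List.getElem_drop]
  have hE := hT s (by simp [hlen, hp0]; omega)
  rw [hwin] at hE
  have hwnd : ((List.range (g+2)).map (fun t => f ((s + t : ℕ) : ZMod n))).Nodup := by
    apply List.Nodup.map_on _ List.nodup_range
    intro x hx y hy hxy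
    rw [List.mem_range] at hx hy
    have := f.injective hxy
    rw [ZMod.natCast_eq_natCast_iff'] at this
    have h1 : s + x ≡ s + y [MOD n] := this
    have h2 := Nat.ModEq.add_left_cancel' s h1
    exact Nat.ModEq.eq_of_lt_of_lt h2 (by omega) (by omega)
  rcases hE with hE | hE
  · exact absurd (Multiset.coe_nodup.mpr hwnd) hE
  · convert hE using 1
    ext x
    simp

end Proof

/-- Rödl–Ruciński–Szemerédi: minimum degree `(1/2 + η) n` forces a Hamilton
`ℓ`-cycle. -/
theorem min_degree_half_hamilton_cycle
    (k ℓ : ℕ) (hk : 3 ≤ k) (hl1 : 1 ≤ ℓ) (hl2 : ℓ ≤ k - 1)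
    (η : ℝ) (hη : 0 < η) :
    ∃ n₀ : ℕ, ∀ n : ℕ, n₀ < n → (k - ℓ) ∣ n →
      ∀ H : Finset (Finset (Fin n)), IsKGraph n k H →
        MinDegreeGe n k H ((1 / 2 + η) * n) →
        HasHamiltonLCycle n k ℓ H := by
  obtain ⟨g, rfl⟩ : ∃ g, k = g + 2 := ⟨k - 2, by omega⟩
  obtain ⟨n0, H0⟩ := tight_ham g (by omega) η hη
  refine ⟨n0 + g + 2, ?_⟩
  intro n hn hdvd H hH hd
  haveI : Nonempty (Fin n) := ⟨⟨0, by omega⟩⟩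
  obtain ⟨p0, l, h1, h2, h3, h4⟩ := H0 (Fin n) (edgeP H) (by rw [Fintype.card_fin]; omega) 
    (dir_of_degree (by omega) η H hH hd)
  obtain ⟨f, hf⟩ := list_to_cycle (by omega) H p0 l h1 h2 h3 h4
  obtain ⟨m, hm⟩ := hdvd
  have hpos : 0 < g + 2 - ℓ := by omega
  have hm0 : 0 < m := by
    rcases Nat.eq_zero_or_pos m with rfl | h
    · omega
    · exact h
  refine ⟨f, m, hm0, by rw [hm, mul_comm], ?_⟩
  intro j hj
  have hlt : j * (g + 2 - ℓ) < n := by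
    rw [hm, mul_comm (g + 2 - ℓ) m]
    exact Nat.mul_lt_mul_of_pos_right hj hpos
  have := hf _ hlt
  exact ⟨this, hH _ this⟩
end

section
/- Suppose k ≥ 3 and 1 ≤ ℓ ≤ k−1 is such that (k−ℓ) does not divide k. For every μ > 0 there exists an integer n₀ such that the following holds for all n ≥ n₀. Let H be a k-graph of order n with minimum degree δ(H) ≥ μn. Then for any two disjoint ordered ℓ-sets S and T of vertices of H, there exists an ℓ-path P in H from S to T such that P contains at most 8k⁵ vertices. -/
open Finset

/-- The edge of an `ℓ`-path starting at position `s * (k - ℓ)` of the vertex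
sequence `v`: it consists of the `k` consecutive vertices from that position. -/
def pathEdge (k ℓ : ℕ) {α : Type*} [DecidableEq α] (v : ℕ → α) (s : ℕ) : Finset α :=
  (Finset.range k).image (fun t => v (s * (k - ℓ) + t))

/-- `v` (restricted to its first `r` values) is a vertex sequence of an `ℓ`-path
all of whose edges satisfy the edge predicate `E`. -/
def IsPathSeq (k ℓ r : ℕ) {α : Type*} [DecidableEq α] (E : Finset α → Prop) (v : ℕ → α) : Prop :=
  k ≤ r ∧ (k - ℓ) ∣ (r - k) ∧ Set.InjOn v (Set.Iio r) ∧
    ∀ s : ℕ, s * (k - ℓ) + k ≤ r → E (pathEdge k ℓ v s)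

namespace DL

/-- `w` is a walk with `b` edges, all in `E`. -/
def IsWalk {α : Type*} [DecidableEq α] (ℓ d : ℕ) (E : Set (Finset α)) (b : ℕ) (w : ℕ → α) : Prop :=
  ∀ s < b, Set.InjOn (fun t => w (s * d + t)) (Set.Iio (ℓ + d)) ∧
    (Finset.range (ℓ + d)).image (fun t => w (s * d + t)) ∈ E

def Reach {α : Type*} [DecidableEq α] (ℓ d : ℕ) (E : Set (Finset α)) (Q : α → Prop)
    (b : ℕ) (A B : ℕ → α) : Prop :=
  ∃ w : ℕ → α, IsWalk ℓ d E b w ∧ (∀ i < ℓ, w i = A i) ∧ (∀ i < ℓ, w (b * d + i) = B i) ∧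
    ∀ p < b * d + ℓ, Q (w p)

section walks
variable {α : Type*} [DecidableEq α] {ℓ d : ℕ} {E : Set (Finset α)} {Q : α → Prop}

theorem concat {b₁ b₂ : ℕ} {w₁ w₂ : ℕ → α} (h₁ : IsWalk ℓ d E b₁ w₁) (h₂ : IsWalk ℓ d E b₂ w₂)
    (h : ∀ i < ℓ, w₁ (b₁ * d + i) = w₂ i) :
    ∃ w : ℕ → α, IsWalk ℓ d E (b₁ + b₂) w ∧ (∀ p < b₁ * d + ℓ, w p = w₁ p) ∧
      (∀ p, w (b₁ * d + p) = w₂ p) := by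
  have e2 : ∀ p, (fun p => if p < b₁ * d then w₁ p else w₂ (p - b₁ * d)) (b₁ * d + p) = w₂ p := by
    intro p; simp
  have e1 : ∀ p < b₁ * d + ℓ,
      (fun p => if p < b₁ * d then w₁ p else w₂ (p - b₁ * d)) p = w₁ p := by
    intro p hp
    by_cases hlt : p < b₁ * d
    · simp [hlt]
    · obtain ⟨i, rfl⟩ : ∃ i, p = b₁ * d + i := ⟨p - b₁ * d, by omega⟩
      rw [e2, h i (by omega)]
  refine ⟨_, ?_, e1, e2⟩
  generalize (fun p => if p < b₁ * d then w₁ p else w₂ (p - b₁ * d)) = w at e1 e2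
  intro s hs
  by_cases hs1 : s < b₁
  · have hsd : s * d + d ≤ b₁ * d := by
      calc s * d + d = (s + 1) * d := by ring
        _ ≤ b₁ * d := Nat.mul_le_mul_right _ hs1
    have key : ∀ t < ℓ + d, w (s * d + t) = w₁ (s * d + t) := fun t ht => e1 _ (by omega)
    refine ⟨(h₁ s hs1).1.congr (fun t ht => (key t ht).symm), ?_⟩
    rw [Finset.image_congr (g := fun t => w₁ (s * d + t))]
    · exact (h₁ s hs1).2
    · intro t ht; exact key t (by simpa using ht)
  · obtain ⟨s', rfl⟩ : ∃ s', s = b₁ + s' := ⟨s - b₁, by omega⟩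
    have key : (fun t => w ((b₁ + s') * d + t)) = fun t => w₂ (s' * d + t) := by
      funext t
      rw [show (b₁ + s') * d + t = b₁ * d + (s' * d + t) by ring, e2]
    rw [key]
    exact h₂ s' (by omega)

theorem Reach.trans {b₁ b₂ : ℕ} {A B C : ℕ → α} (h₁ : Reach ℓ d E Q b₁ A B)
    (h₂ : Reach ℓ d E Q b₂ B C) : Reach ℓ d E Q (b₁ + b₂) A C := by
  obtain ⟨w₁, a1, a2, a3, a4⟩ := h₁
  obtain ⟨w₂, c1, c2, c3, c4⟩ := h₂
  obtain ⟨w, hw, e1, e2⟩ := concat a1 c1 (fun i hi => by rw [a3 i hi, c2 i hi])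
  refine ⟨w, hw, fun i hi => by rw [e1 i (by omega), a2 i hi], fun i hi => ?_, fun p hp => ?_⟩
  · rw [show (b₁ + b₂) * d + i = b₁ * d + (b₂ * d + i) by ring, e2, c3 i hi]
  · by_cases hlt : p < b₁ * d + ℓ
    · rw [e1 p hlt]; exact a4 p hlt
    · obtain ⟨i, rfl⟩ : ∃ i, p = b₁ * d + i := ⟨p - b₁ * d, by omega⟩
      rw [e2]; refine c4 i ?_
      have : (b₁ + b₂) * d = b₁ * d + b₂ * d := by ring
      omega

theorem Reach.congr {b : ℕ} {A B A' B' : ℕ → α} (h : Reach ℓ d E Q b A B)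
    (hA : ∀ i < ℓ, A i = A' i) (hB : ∀ i < ℓ, B i = B' i) : Reach ℓ d E Q b A' B' := by
  obtain ⟨w, a1, a2, a3, a4⟩ := h
  exact ⟨w, a1, fun i hi => by rw [a2 i hi, hA i hi], fun i hi => by rw [a3 i hi, hB i hi], a4⟩

theorem Reach.mono {b : ℕ} {A B : ℕ → α} {E' : Set (Finset α)} {Q' : α → Prop}
    (h : Reach ℓ d E Q b A B) (hE : E ⊆ E') (hQ : ∀ x, Q x → Q' x) : Reach ℓ d E' Q' b A B := by
  obtain ⟨w, a1, a2, a3, a4⟩ := h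
  exact ⟨w, fun s hs => ⟨(a1 s hs).1, hE (a1 s hs).2⟩, a2, a3, fun p hp => hQ _ (a4 p hp)⟩

theorem walk_reverse {b : ℕ} {w : ℕ → α} (h : IsWalk ℓ d E b w) :
    IsWalk ℓ d E b (fun p => w (b * d + ℓ - 1 - p)) := by
  intro s hs
  obtain ⟨h1, h2⟩ := h (b - 1 - s) (by omega)
  have key : ∀ t < ℓ + d, b * d + ℓ - 1 - (s * d + t) = (b - 1 - s) * d + (ℓ + d - 1 - t) := by
    intro t ht
    obtain ⟨c, rfl⟩ : ∃ c, b = s + 1 + c := ⟨b - 1 - s, by omega⟩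
    have e1 : s + 1 + c - 1 - s = c := by omega
    rw [e1]
    have : (s + 1 + c) * d = s * d + d + c * d := by ring
    omega
  constructor
  · intro t ht t' ht' heq
    simp only [Set.mem_Iio] at ht ht'
    simp only [key t ht, key t' ht'] at heq
    have := h1 (show ℓ + d - 1 - t < ℓ + d by omega) (show ℓ + d - 1 - t' < ℓ + d by omega) heq
    omega
  · convert h2 using 1
    ext x
    simp only [Finset.mem_image, Finset.mem_range]
    constructor
    · rintro ⟨t, ht, rfl⟩
      exact ⟨ℓ + d - 1 - t, by omega, by rw [key t ht]⟩
    · rintro ⟨t, ht, rfl⟩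
      refine ⟨ℓ + d - 1 - t, by omega, ?_⟩
      rw [key _ (by omega)]
      congr 2; omega

end walks

section perm
variable {α : Type*} [DecidableEq α] {ℓ d : ℕ} {e : Finset α}

/-- periodic sequence -/
def per {k : ℕ} (hk : 0 < k) (g : Fin k ≃ e) (p : ℕ) : α := (g ⟨p % k, Nat.mod_lt _ hk⟩ : α)

theorem reach_rot {E : Set (Finset α)} (he : e ∈ E) (hk : 0 < ℓ + d) (g : Fin (ℓ + d) ≃ e) (o b : ℕ) :
    Reach ℓ d E (· ∈ e) b (fun p => per hk g (p + o)) (fun p => per hk g (p + o + b * d)) := by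
  refine ⟨fun p => per hk g (p + o), ?_, fun _ _ => rfl, fun i _ => ?_, fun p _ => ?_⟩
  · intro s hs
    have inj : Set.InjOn (fun t => per hk g (s * d + t + o)) (Set.Iio (ℓ + d)) := by
      intro t ht t' ht' h
      simp only [per] at h
      have h2 := g.injective (Subtype.ext h)
      simp only [Fin.mk.injEq] at h2
      have h3 : (s * d + o) + t ≡ (s * d + o) + t' [MOD (ℓ + d)] := by
        unfold Nat.ModEq; convert h2 using 2 <;> ring
      have h4 := Nat.ModEq.add_left_cancel' _ h3
      exact Nat.ModEq.eq_of_lt_of_lt h4 ht ht'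
    refine ⟨inj, ?_⟩
    have : (Finset.range (ℓ + d)).image (fun t => per hk g (s * d + t + o)) = e := by
      apply Finset.eq_of_subset_of_card_le
      · intro x hx
        simp only [Finset.mem_image] at hx
        obtain ⟨t, _, rfl⟩ := hx
        exact (g _).2
      · rw [Finset.card_image_of_injOn (by simpa using inj), Finset.card_range]
        have := Fintype.card_congr g
        simp at this; omega
    simpa [this] using he
  · simp only []; congr 1; ring
  · exact (g _).2

theorem exists_rot (hd : ¬ d ∣ ℓ) (hd0 : 0 < d) (j : ℕ) :
    ∃ t i, t ≤ ℓ + d ∧ ℓ ≤ i ∧ i + 1 < ℓ + d ∧ i + t * d ≡ j [MOD (ℓ + d)] := by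
  set k := ℓ + d with hk
  set g := Nat.gcd d k with hg
  have hgd : g ∣ d := Nat.gcd_dvd_left _ _
  have hgk : g ∣ k := Nat.gcd_dvd_right _ _
  have hg0 : 0 < g := Nat.gcd_pos_of_pos_left _ hd0
  have hlt : g < d := by
    refine lt_of_le_of_ne (Nat.le_of_dvd hd0 hgd) ?_
    intro h
    rw [h] at hgk
    exact hd ((Nat.dvd_add_left (dvd_refl d)).1 hgk)
  -- choose i
  obtain ⟨i, hi1, hi2, hi3⟩ : ∃ i, ℓ ≤ i ∧ i < ℓ + g ∧ i ≡ j [MOD g] := by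
    refine ⟨ℓ + ((j : ℤ) - ℓ).natMod g, by omega, ?_, ?_⟩
    · have := Int.natMod_lt (m := ((j : ℤ) - ℓ)) hg0.ne'
      omega
    · rw [← Int.natCast_modEq_iff]
      push_cast
      have : (((j : ℤ) - ℓ).natMod g : ℤ) = ((j : ℤ) - ℓ) % g := by
        unfold Int.natMod
        exact Int.toNat_of_nonneg (Int.emod_nonneg _ (by exact_mod_cast hg0.ne'))
      rw [this]
      calc (ℓ : ℤ) + ((j : ℤ) - ℓ) % g ≡ ℓ + (j - ℓ) [ZMOD g] := (Int.mod_modEq _ _).add_left _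
        _ = j := by ring
  obtain ⟨c, hc⟩ := (Nat.modEq_iff_dvd.1 hi3)
  have hk0 : 0 < k := by omega
  have bez : (g : ℤ) = d * Nat.gcdA d k + k * Nat.gcdB d k := Nat.gcd_eq_gcd_ab d k
  refine ⟨(c * Nat.gcdA d k).natMod k, i, ?_, hi1, by omega, ?_⟩
  · exact (Int.natMod_lt hk0.ne').le
  · rw [← Int.natCast_modEq_iff]
    push_cast
    have : (((c * Nat.gcdA d k).natMod k : ℕ) : ℤ) = (c * Nat.gcdA d k) % k := by
      unfold Int.natMod
      exact Int.toNat_of_nonneg (Int.emod_nonneg _ (by exact_mod_cast hk0.ne'))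
    rw [this]
    calc (i : ℤ) + (c * Nat.gcdA d k) % k * d ≡ i + (c * Nat.gcdA d k) * d [ZMOD k] :=
          ((Int.mod_modEq _ _).mul_right _).add_left _
      _ ≡ i + (c * Nat.gcdA d k) * d + k * (Nat.gcdB d k * c) [ZMOD k] := by
          apply Int.modEq_iff_dvd.2
          exact ⟨Nat.gcdB d k * c, by ring⟩
      _ = i + c * (d * Nat.gcdA d k + k * Nat.gcdB d k) := by ring
      _ = i + c * g := by rw [← bez]
      _ = j := by linarith

theorem reach_swap {E : Set (Finset α)} (he : e ∈ E) (hd : ¬ d ∣ ℓ) (hd0 : 0 < d) (hk : 0 < ℓ + d)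
    (g : Fin (ℓ + d) ≃ e) (j : ℕ) (hj : j + 1 < ℓ + d) :
    Reach ℓ d E (· ∈ e) (ℓ + d) (per hk g)
      (per hk ((Equiv.swap ⟨j, by omega⟩ ⟨j + 1, hj⟩).trans g)) := by
  obtain ⟨t, i, ht, hi1, hi2, hm⟩ := exists_rot hd hd0 j
  have h1 := reach_rot he hk g 0 t
  have h2 := reach_rot he hk ((Equiv.swap ⟨j, by omega⟩ ⟨j + 1, hj⟩).trans g) (t * d) (ℓ + d - t)
  have h1' := h1.congr (A' := per hk g)
    (B' := fun p => per hk ((Equiv.swap ⟨j, by omega⟩ ⟨j + 1, hj⟩).trans g) (p + t * d))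
    (fun i _ => rfl) (by
      intro p hp
      simp only [per, Equiv.trans_apply, add_zero]
      rw [Equiv.swap_apply_of_ne_of_ne]
      · intro h
        simp only [Fin.mk.injEq] at h
        have h3 : p + t * d ≡ i + t * d [MOD (ℓ + d)] := by
          refine Nat.ModEq.trans ?_ hm.symm
          unfold Nat.ModEq; rw [h, Nat.mod_eq_of_lt (by omega)]
        have h4 := Nat.ModEq.eq_of_lt_of_lt (Nat.ModEq.add_right_cancel' _ h3) (by omega) (by omega)
        omega
      · intro h
        simp only [Fin.mk.injEq] at h
        have h3 : p + t * d ≡ (i + 1) + t * d [MOD (ℓ + d)] := by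
          have : (i + 1) + t * d ≡ j + 1 [MOD (ℓ + d)] := by
            rw [show (i + 1) + t * d = (i + t * d) + 1 by ring]
            exact hm.add_right 1
          refine Nat.ModEq.trans ?_ this.symm
          unfold Nat.ModEq; rw [h, Nat.mod_eq_of_lt (by omega)]
        have h4 := Nat.ModEq.eq_of_lt_of_lt (Nat.ModEq.add_right_cancel' _ h3) (by omega) (by omega)
        omega)
  have h3 := h1'.trans h2
  rw [show t + (ℓ + d - t) = ℓ + d by omega] at h3
  refine h3.congr (fun _ _ => rfl) ?_
  intro p hp
  simp only [per]
  congr 3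
  rw [show p + t * d + (ℓ + d - t) * d = p + (ℓ + d) * d by
    obtain ⟨c, hc⟩ := Nat.exists_eq_add_of_le ht
    rw [show ℓ + d - t = c by omega, hc]; ring]
  simp

theorem reach_move {E : Set (Finset α)} (he : e ∈ E) (hd : ¬ d ∣ ℓ) (hd0 : 0 < d) (hk : 0 < ℓ + d)
    (m : ℕ) : ∀ (h : Fin (ℓ + d) ≃ e) (i : ℕ) (hq : i + m < ℓ + d),
    ∃ h' : Fin (ℓ + d) ≃ e, Reach ℓ d E (· ∈ e) (m * (ℓ + d)) (per hk h) (per hk h') ∧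
      h' ⟨i, by omega⟩ = h ⟨i + m, hq⟩ ∧ ∀ p : Fin (ℓ + d), (p : ℕ) < i → h' p = h p := by
  induction m with
  | zero =>
    intro h i hq
    refine ⟨h, ?_, rfl, fun _ _ => rfl⟩
    have := reach_rot he hk h 0 0
    simpa using this
  | succ m ih =>
    intro h i hq
    have hs := reach_swap he hd hd0 hk h (i + m) (by omega)
    obtain ⟨h', r, e1, e2⟩ := ih ((Equiv.swap ⟨i + m, by omega⟩ ⟨i + m + 1, by omega⟩).trans h) i
      (by omega)
    refine ⟨h', ?_, ?_, ?_⟩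
    · have := hs.trans r
      rwa [show ℓ + d + m * (ℓ + d) = (m + 1) * (ℓ + d) by ring] at this
    · rw [e1]; simp [add_assoc]
    · intro p hp
      rw [e2 p hp, Equiv.trans_apply, Equiv.swap_apply_of_ne_of_ne]
      · intro hh; rw [hh] at hp; simp at hp
      · intro hh; rw [hh] at hp; simp at hp; omega

theorem reach_perm {E : Set (Finset α)} (he : e ∈ E) (hd : ¬ d ∣ ℓ) (hd0 : 0 < d) (hk : 0 < ℓ + d)
    (g g' : Fin (ℓ + d) ≃ e) (i : ℕ) (hi : i ≤ ℓ + d) :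
    ∃ c ≤ i * (ℓ + d), ∃ h : Fin (ℓ + d) ≃ e,
      Reach ℓ d E (· ∈ e) (c * (ℓ + d)) (per hk g) (per hk h) ∧
      ∀ p : Fin (ℓ + d), (p : ℕ) < i → h p = g' p := by
  induction i with
  | zero =>
    refine ⟨0, by simp, g, ?_, fun p hp => by omega⟩
    have := reach_rot he hk g 0 0
    simpa using this
  | succ i ih =>
    obtain ⟨c, hc, h, r, ag⟩ := ih (by omega)
    obtain ⟨q, hq⟩ : ∃ q, h q = g' ⟨i, by omega⟩ := h.surjective _
    have hiq : i ≤ (q : ℕ) := by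
      by_contra hlt
      rw [ag q (by omega)] at hq
      have := g'.injective hq
      rw [this] at hlt
      simp at hlt
    obtain ⟨h', r', e1, e2⟩ := reach_move he hd hd0 hk ((q : ℕ) - i) h i (by omega)
    refine ⟨c + (q - i), ?_, h', ?_, ?_⟩
    · have : (i + 1) * (ℓ + d) = i * (ℓ + d) + (ℓ + d) := by ring
      omega
    · have := r.trans r'
      rwa [← add_mul] at this
    · intro p hp
      by_cases hpi : (p : ℕ) < i
      · rw [e2 p hpi, ag p hpi]
      · have : p = ⟨i, by omega⟩ := Fin.ext (by simp; omega)
        rw [this, e1, ← hq]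
        congr 1
        exact Fin.ext (by simp; omega)

theorem exists_enum (he : e.card = ℓ + d) {A : ℕ → α} (hA : Set.InjOn A (Set.Iio ℓ))
    (hAe : ∀ i < ℓ, A i ∈ e) : ∃ g : Fin (ℓ + d) ≃ e, ∀ i : Fin (ℓ + d), (i : ℕ) < ℓ → (g i : α) = A i := by
  obtain ⟨g, hg⟩ := Finset.exists_equiv_extend_of_card_eq (α := Fin (ℓ + d)) (t := e)
    (f := fun i => A i) (s := Finset.univ.filter (fun i : Fin (ℓ + d) => (i : ℕ) < ℓ))
    (by simp [he]) (by
      intro x hx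
      simp only [Finset.mem_image, Finset.mem_filter, Finset.mem_univ, true_and] at hx
      obtain ⟨i, hi, rfl⟩ := hx
      exact hAe _ hi) (by
      intro x hx y hy h
      simp only [Finset.coe_filter, Finset.mem_univ, true_and, Set.mem_ofPred_eq] at hx hy
      exact Fin.ext (hA hx hy h))
  exact ⟨g, fun i hi => hg i (by simp [hi])⟩

theorem reach_edge {E : Set (Finset α)} (heE : e ∈ E) (he : e.card = ℓ + d) (hd : ¬ d ∣ ℓ)
    (hd0 : 0 < d) {A B : ℕ → α} (hA : Set.InjOn A (Set.Iio ℓ)) (hAe : ∀ i < ℓ, A i ∈ e)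
    (hB : Set.InjOn B (Set.Iio ℓ)) (hBe : ∀ i < ℓ, B i ∈ e) :
    ∃ b ≤ (ℓ + d) ^ 3, Reach ℓ d E (· ∈ e) b A B := by
  obtain ⟨g, hg⟩ := exists_enum he hA hAe
  obtain ⟨g', hg'⟩ := exists_enum he hB hBe
  have hk : 0 < ℓ + d := by omega
  obtain ⟨c, hc, h, r, ag⟩ := reach_perm heE hd hd0 hk g g' (ℓ + d) le_rfl
  refine ⟨c * (ℓ + d), ?_, r.congr ?_ ?_⟩
  · calc c * (ℓ + d) ≤ (ℓ + d) * (ℓ + d) * (ℓ + d) := Nat.mul_le_mul_right _ hc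
      _ = (ℓ + d) ^ 3 := by ring
  · intro i hi
    simp only [per]
    rw [hg _ (by simp [Nat.mod_eq_of_lt (show i < ℓ + d by omega)]; exact hi)]
    simp [Nat.mod_eq_of_lt (show i < ℓ + d by omega)]
  · intro i hi
    simp only [per]
    rw [ag _ (Nat.mod_lt _ hk), hg' _ (by simp [Nat.mod_eq_of_lt (show i < ℓ + d by omega)]; exact hi)]
    simp [Nat.mod_eq_of_lt (show i < ℓ + d by omega)]

end perm
section scheme

/-- Label hypergraphs in which the labels `inr 0, …, inr (M-1)` can be embedded one by one. -/
inductive Degen {β : Type} [DecidableEq β] (k : ℕ) : ℕ → Set (Finset (β ⊕ ℕ)) → Prop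
  | base : Degen k 0 ∅
  | free {M : ℕ} {E : Set (Finset (β ⊕ ℕ))} : Degen k M E → Degen k (M + 1) E
  | edge {M : ℕ} {E : Set (Finset (β ⊕ ℕ))} {N : Finset (β ⊕ ℕ)} : Degen k M E →
      (∀ j, Sum.inr j ∈ N → j < M) → N.card = k - 1 →
      Degen k (M + 1) (insert (insert (Sum.inr M) N) E)

variable {β : Type} [DecidableEq β] {ℓ d : ℕ}

theorem Degen.lt {k M : ℕ} {E : Set (Finset (β ⊕ ℕ))} (h : Degen k M E) :
    ∀ e ∈ E, ∀ j, Sum.inr j ∈ e → j < M := by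
  induction h with
  | base => intro e he; simp at he
  | free _ ih => intro e he j hj; exact Nat.lt_succ_of_lt (ih e he j hj)
  | edge _ hN _ ih =>
    intro e he j hj
    rcases he with rfl | he
    · rw [Finset.mem_insert] at hj
      rcases hj with hj | hj
      · have := Sum.inr_injective hj; omega
      · exact Nat.lt_succ_of_lt (hN j hj)
    · exact Nat.lt_succ_of_lt (ih e he j hj)

theorem Degen.freeN {k M : ℕ} {E : Set (Finset (β ⊕ ℕ))} (h : Degen k M E) (m : ℕ) :
    Degen k (M + m) E := by
  induction m with
  | zero => exact h
  | succ m ih => exact ih.free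

/-- extend `A` by fresh labels -/
def ext (ℓ M : ℕ) (A : ℕ → β ⊕ ℕ) (p : ℕ) : β ⊕ ℕ := if p < ℓ then A p else Sum.inr (M + (p - ℓ))

theorem ext_inj {M : ℕ} {A : ℕ → β ⊕ ℕ} (hA : Set.InjOn A (Set.Iio ℓ))
    (hM : ∀ i < ℓ, ∀ j, A i = Sum.inr j → j < M) : Function.Injective (ext ℓ M A) := by
  intro p q h
  unfold ext at h
  split_ifs at h with h1 h2 h2
  · exact hA h1 h2 h
  · have := hM p h1 _ h; omega
  · have := hM q h2 _ h.symm; omega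
  · have := Sum.inr_injective h; omega

theorem ext_degen {M : ℕ} {E : Set (Finset (β ⊕ ℕ))} (hd : 0 < d) {A : ℕ → β ⊕ ℕ}
    (hA : Set.InjOn A (Set.Iio ℓ)) (hM : ∀ i < ℓ, ∀ j, A i = Sum.inr j → j < M)
    (hE : Degen (ℓ + d) M E) (q : ℕ) :
    Degen (ℓ + d) (M + q * d) (E ∪ {e | ∃ s < q, e = (Finset.range (ℓ + d)).image
      (fun t => ext ℓ M A (s * d + t))}) := by
  have hinj := ext_inj hA hM
  induction q with
  | zero => simpa using hE
  | succ q ih =>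
    have h1 := ih.freeN (d - 1)
    have h2 := h1.edge (N := (Finset.range (ℓ + d - 1)).image (fun t => ext ℓ M A (q * d + t))) (by
      intro j hj
      simp only [Finset.mem_image, Finset.mem_range] at hj
      obtain ⟨t, ht, hj⟩ := hj
      unfold ext at hj
      split_ifs at hj with hlt
      · have := hM _ hlt _ hj; omega
      · have := Sum.inr_injective hj; omega) (by
      rw [Finset.card_image_of_injective, Finset.card_range]
      intro t t' h
      have := hinj h
      omega)
    have e1 : M + q * d + (d - 1) + 1 = M + (q + 1) * d := by
      have : (q + 1) * d = q * d + d := by ring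
      omega
    rw [e1] at h2
    convert h2 using 1
    have e2 : (Finset.range (ℓ + d)).image (fun t => ext ℓ M A (q * d + t)) =
      insert (Sum.inr (M + q * d + (d - 1)))
        ((Finset.range (ℓ + d - 1)).image (fun t => ext ℓ M A (q * d + t))) := by
      obtain ⟨d, rfl⟩ : ∃ d', d = d' + 1 := ⟨d - 1, by omega⟩
      rw [← add_assoc, Nat.add_sub_cancel, Finset.range_add_one, Finset.image_insert]
      congr 1
      unfold ext
      rw [if_neg (by omega)]
      congr 1; omega
    rw [← e2]
    ext e
    simp only [Set.mem_union, Set.mem_ofPred_eq, Set.mem_insert_iff]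
    constructor
    · rintro (h | ⟨s, hs, rfl⟩)
      · exact Or.inr (Or.inl h)
      · rcases Nat.lt_succ_iff_lt_or_eq.1 hs with hs | rfl
        · exact Or.inr (Or.inr ⟨s, hs, rfl⟩)
        · exact Or.inl rfl
    · rintro (rfl | h | ⟨s, hs, rfl⟩)
      · exact Or.inr ⟨q, by omega, rfl⟩
      · exact Or.inl h
      · exact Or.inr ⟨s, by omega, rfl⟩

theorem exists_tuple {α : Type*} [Nonempty α] (s : Finset α) (hs : ℓ ≤ s.card) :
    ∃ C : ℕ → α, Set.InjOn C (Set.Iio ℓ) ∧ ∀ i < ℓ, C i ∈ s := by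
  classical
  refine ⟨fun i => if h : i < s.card then (s.equivFin.symm ⟨i, h⟩ : α) else Classical.arbitrary α,
    ?_, ?_⟩
  · intro i hi j hj h
    simp only [Set.mem_Iio] at hi hj
    simp only [dif_pos (lt_of_lt_of_le hi hs), dif_pos (lt_of_lt_of_le hj hs)] at h
    have := s.equivFin.symm.injective (Subtype.ext h)
    simpa using this
  · intro i hi
    simp only [dif_pos (lt_of_lt_of_le hi hs)]
    exact (s.equivFin.symm _).2

theorem chain (hd2 : 2 ≤ d) (hd : ¬ d ∣ ℓ) (f : Finset (β ⊕ ℕ)) (hf : f.card = ℓ + d)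
    (hfr : ∀ x ∈ f, ∃ j, x = Sum.inr j) {B : ℕ → β ⊕ ℕ} (hB : Set.InjOn B (Set.Iio ℓ))
    (hBf : ∀ i < ℓ, B i ∈ f) (j : ℕ) :
    ∀ (M : ℕ) (E : Set (Finset (β ⊕ ℕ))) (e : Finset (β ⊕ ℕ)) (A : ℕ → β ⊕ ℕ),
      Degen (ℓ + d) M E → e ∈ E → f ∈ E → e.card = ℓ + d → (∀ x ∈ e, ∃ j, x = Sum.inr j) →
      Set.InjOn A (Set.Iio ℓ) → (∀ i < ℓ, A i ∈ e) → (e \ f).card ≤ j + 2 →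
      ∃ M' E' b, E ⊆ E' ∧ Degen (ℓ + d) M' E' ∧ b ≤ (j + 2) * (ℓ + d) ^ 3 ∧
        Reach ℓ d E' (fun x => ∃ j, x = Sum.inr j) b A B := by
  induction j with
  | zero =>
    intro M E e A hE he hfE hec her hA hAe hcard
    have h1 := Finset.card_inter_add_card_sdiff e f
    obtain ⟨C, hC, hCe⟩ := exists_tuple (ℓ := ℓ) (e ∩ f) (by omega)
    obtain ⟨b, hb, r⟩ := reach_edge he hec hd (by omega) hA hAe hC
      (fun i hi => (Finset.mem_inter.1 (hCe i hi)).1)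
    obtain ⟨b', hb', r'⟩ := reach_edge hfE hf hd (by omega) hC
      (fun i hi => (Finset.mem_inter.1 (hCe i hi)).2) hB hBf
    exact ⟨M, E, b + b', subset_rfl, hE, by omega,
      (r.mono subset_rfl her).trans (r'.mono subset_rfl hfr)⟩
  | succ j ih =>
    intro M E e A hE he hfE hec her hA hAe hcard
    by_cases hsm : (e \ f).card ≤ j + 2
    · obtain ⟨M', E', b, h1, h2, h3, h4⟩ := ih M E e A hE he hfE hec her hA hAe hsm
      exact ⟨M', E', b, h1, h2, h3.trans (Nat.mul_le_mul_right _ (by omega)), h4⟩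
    obtain ⟨u, hu, v, hv, huv⟩ := Finset.one_lt_card.1 (show 1 < (e \ f).card by omega)
    obtain ⟨x, hx⟩ := Finset.card_pos.1 (show 0 < (f \ e).card by
      have h1 := Finset.card_inter_add_card_sdiff e f
      have h2 := Finset.card_inter_add_card_sdiff f e
      rw [Finset.inter_comm] at h2
      omega)
    have hue := (Finset.mem_sdiff.1 hu).1
    have hve := (Finset.mem_sdiff.1 hv).1
    have hxf := (Finset.mem_sdiff.1 hx).1
    have hxe := (Finset.mem_sdiff.1 hx).2
    have huvc : ({u, v} : Finset (β ⊕ ℕ)).card = 2 := Finset.card_pair huv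
    have hc0 : (e \ {u, v}).card = ℓ + d - 2 := by
      rw [Finset.card_sdiff_of_subset, hec, huvc]
      intro y hy; simp only [Finset.mem_insert, Finset.mem_singleton] at hy
      rcases hy with rfl | rfl <;> assumption
    have hNc : (insert x (e \ {u, v})).card = ℓ + d - 1 := by
      rw [Finset.card_insert_of_notMem (fun h => hxe (Finset.mem_sdiff.1 h).1), hc0]
      omega
    have hNlt : ∀ i, Sum.inr i ∈ insert x (e \ {u, v}) → i < M := by
      intro i hi
      rcases Finset.mem_insert.1 hi with h | h
      · exact hE.lt f hfE i (h ▸ hxf)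
      · exact hE.lt e he i (Finset.mem_sdiff.1 h).1
    have hE' := hE.edge hNlt hNc
    have hMN : (Sum.inr M : β ⊕ ℕ) ∉ insert x (e \ {u, v}) := fun h => lt_irrefl _ (hNlt M h)
    set e' := insert (Sum.inr M) (insert x (e \ {u, v})) with he'
    have hec' : e'.card = ℓ + d := by
      rw [he', Finset.card_insert_of_notMem hMN, hNc]; omega
    obtain ⟨C, hC, hCe⟩ := exists_tuple (ℓ := ℓ) (e \ {u, v}) (by omega)
    obtain ⟨b, hb, r⟩ := reach_edge he hec hd (by omega) hA hAe hC
      (fun i hi => (Finset.mem_sdiff.1 (hCe i hi)).1)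
    obtain ⟨M', E', b', h1, h2, h3, h4⟩ := ih (M + 1) (insert e' E) e' C hE' (Set.mem_insert _ _)
      (Set.mem_insert_of_mem _ hfE) hec' (by
        intro y hy
        simp only [he', Finset.mem_insert] at hy
        rcases hy with rfl | rfl | hy
        · exact ⟨_, rfl⟩
        · exact hfr _ hxf
        · exact her _ (Finset.mem_sdiff.1 hy).1) hC
      (fun i hi => Finset.mem_insert_of_mem (Finset.mem_insert_of_mem (hCe i hi))) (by
        have hsub : e' \ f ⊆ insert (Sum.inr M) ((e \ f) \ {u, v}) := by
          intro y hy
          simp only [he', Finset.mem_sdiff, Finset.mem_insert] at hy ⊢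
          rcases hy with ⟨rfl | rfl | hy, hyf⟩
          · exact Or.inl rfl
          · exact absurd hxf hyf
          · exact Or.inr ⟨⟨hy.1, hyf⟩, hy.2⟩
        have h5 := (Finset.card_le_card hsub).trans (Finset.card_insert_le _ _)
        have h6 : ((e \ f) \ {u, v}).card = (e \ f).card - 2 := by
          rw [Finset.card_sdiff_of_subset, huvc]
          intro y hy; simp only [Finset.mem_insert, Finset.mem_singleton] at hy
          rcases hy with rfl | rfl <;> assumption
        omega)
    have hEE' : E ⊆ E' := (Set.subset_insert _ _).trans h1
    refine ⟨M', E', b + b', hEE', h2, ?_, (r.mono hEE' her).trans h4⟩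
    calc b + b' ≤ (ℓ + d) ^ 3 + (j + 2) * (ℓ + d) ^ 3 := by omega
      _ = (j + 1 + 2) * (ℓ + d) ^ 3 := by ring

theorem scheme (hd2 : 2 ≤ d) (hd : ¬ d ∣ ℓ) :
    ∃ (M : ℕ) (E : Set (Finset ((Fin ℓ ⊕ Fin ℓ) ⊕ ℕ))) (b : ℕ) (w : ℕ → (Fin ℓ ⊕ Fin ℓ) ⊕ ℕ),
      Degen (ℓ + d) M E ∧ 1 ≤ b ∧ b * d + ℓ ≤ 8 * (ℓ + d) ^ 5 ∧ IsWalk ℓ d E b w ∧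
      (∀ i : Fin ℓ, w i = Sum.inl (Sum.inl i)) ∧ (∀ i : Fin ℓ, w (b * d + i) = Sum.inl (Sum.inr i)) ∧
      (∀ p, ℓ ≤ p → p < b * d → ∃ j, w p = Sum.inr j) := by
  let AS : ℕ → (Fin ℓ ⊕ Fin ℓ) ⊕ ℕ := fun i => if h : i < ℓ then Sum.inl (Sum.inl ⟨i, h⟩) else Sum.inr 0
  let AT : ℕ → (Fin ℓ ⊕ Fin ℓ) ⊕ ℕ := fun i =>
    if h : i < ℓ then Sum.inl (Sum.inr ⟨ℓ - 1 - i, by omega⟩) else Sum.inr 0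
  have hAS : Set.InjOn AS (Set.Iio ℓ) := by
    intro i hi j hj h
    simp only [Set.mem_Iio] at hi hj
    simpa [AS, hi, hj] using h
  have hAT : Set.InjOn AT (Set.Iio ℓ) := by
    intro i hi j hj h
    simp only [Set.mem_Iio] at hi hj
    simp [AT, hi, hj] at h
    omega
  have hASM : ∀ M, ∀ i < ℓ, ∀ j, AS i = Sum.inr j → j < M := by
    intro M i hi j h; simp [AS, hi] at h
  have hATM : ∀ M, ∀ i < ℓ, ∀ j, AT i = Sum.inr j → j < M := by
    intro M i hi j h; simp [AT, hi] at h
  have hd0 : 0 < d := by omega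
  have D1 := ext_degen hd0 hAS (hASM 0) Degen.base (ℓ + 1)
  set M1 := 0 + (ℓ + 1) * d
  set w1 := ext ℓ 0 AS with hw1
  have w1i : Function.Injective w1 := ext_inj hAS (hASM 0)
  have D2 := ext_degen hd0 hAT (hATM M1) D1 (ℓ + 1)
  set w3 := ext ℓ M1 AT with hw3
  have w3i : Function.Injective w3 := ext_inj hAT (hATM M1)
  set M2 := M1 + (ℓ + 1) * d
  set E2 := (∅ ∪ {e | ∃ s < ℓ + 1, e = (Finset.range (ℓ + d)).image (fun t => w1 (s * d + t))}) ∪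
    {e | ∃ s < ℓ + 1, e = (Finset.range (ℓ + d)).image (fun t => w3 (s * d + t))} with hE2
  have right1 : ∀ p, ℓ ≤ p → ∃ j, w1 p = Sum.inr j := by
    intro p hp; exact ⟨_, if_neg (by omega)⟩
  have right3 : ∀ p, ℓ ≤ p → ∃ j, w3 p = Sum.inr j := by
    intro p hp; exact ⟨_, if_neg (by omega)⟩
  have wi : ∀ {w : ℕ → (Fin ℓ ⊕ Fin ℓ) ⊕ ℕ} (s : ℕ), Function.Injective w →
      Function.Injective (fun t => w (s * d + t)) := by
    intro w s h t t' htt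
    have := h htt; omega
  have W1 : IsWalk ℓ d E2 (ℓ + 1) w1 := fun s hs =>
    ⟨(wi s w1i).injOn, Or.inl (Or.inr ⟨s, hs, rfl⟩)⟩
  have W3 : IsWalk ℓ d E2 (ℓ + 1) w3 := fun s hs =>
    ⟨(wi s w3i).injOn, Or.inr ⟨s, hs, rfl⟩⟩
  have W3r := walk_reverse W3
  have hld : ℓ ≤ ℓ * d := Nat.le_mul_of_pos_right _ hd0
  have hl1 : (ℓ + 1) * d = ℓ * d + d := by ring
  -- middle
  obtain ⟨M', E', b, hEE, hDe, hb, w2, W2, W2s, W2e, W2r⟩ := chain hd2 hd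
    ((Finset.range (ℓ + d)).image (fun t => w3 (ℓ * d + t)))
    (by rw [Finset.card_image_of_injective _ (wi ℓ w3i), Finset.card_range])
    (by
      intro x hx
      simp only [Finset.mem_image] at hx
      obtain ⟨t, _, rfl⟩ := hx
      exact right3 _ (by omega))
    (B := fun i => w3 ((ℓ + 1) * d + ℓ - 1 - i))
    (by
      intro i hi j hj h
      simp only [Set.mem_Iio] at hi hj
      have := w3i h
      omega)
    (by
      intro i hi
      simp only [Finset.mem_image, Finset.mem_range]
      exact ⟨ℓ + d - 1 - i, by omega, by congr 1; omega⟩)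
    (ℓ + d) M2 E2 ((Finset.range (ℓ + d)).image (fun t => w1 (ℓ * d + t)))
    (fun i => w1 ((ℓ + 1) * d + i)) D2 (W1 ℓ (by omega)).2 (W3 ℓ (by omega)).2
    (by rw [Finset.card_image_of_injective _ (wi ℓ w1i), Finset.card_range])
    (by
      intro x hx
      simp only [Finset.mem_image] at hx
      obtain ⟨t, _, rfl⟩ := hx
      exact right1 _ (by omega))
    (wi _ w1i).injOn
    (by
      intro i hi
      simp only [Finset.mem_image, Finset.mem_range]
      exact ⟨d + i, by omega, by congr 1; omega⟩)
    (by
      refine (Finset.card_le_card Finset.sdiff_subset).trans ?_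
      refine Finset.card_image_le.trans ?_
      simp)
  have up : ∀ {b w}, IsWalk ℓ d E2 b w → IsWalk ℓ d E' b w := fun h s hs =>
    ⟨(h s hs).1, hEE (h s hs).2⟩
  obtain ⟨wa, Wa, a1, a2⟩ := concat (up W1) W2 (fun i hi => (W2s i hi).symm)
  obtain ⟨wb, Wb, b1, b2⟩ := concat Wa (up W3r) (fun i hi => by
    rw [show (ℓ + 1 + b) * d + i = (ℓ + 1) * d + (b * d + i) by ring, a2, W2e i hi])
  have hbd : (ℓ + 1 + b) * d = (ℓ + 1) * d + b * d := by ring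
  have hbd2 : (ℓ + 1 + b + (ℓ + 1)) * d = (ℓ + 1) * d + b * d + (ℓ + 1) * d := by ring
  refine ⟨M', E', ℓ + 1 + b + (ℓ + 1), wb, hDe, by omega, ?_, Wb, ?_, ?_, ?_⟩
  · obtain ⟨k, hk⟩ : ∃ k, k = ℓ + d := ⟨_, rfl⟩
    rw [← hk] at hb ⊢
    have hk2 : 2 ≤ k := by omega
    have h1 : ℓ + 1 + b + (ℓ + 1) ≤ (k + 2) * k ^ 3 + 2 * k := by omega
    have h2 : (ℓ + 1 + b + (ℓ + 1)) * d ≤ ((k + 2) * k ^ 3 + 2 * k) * k :=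
      Nat.mul_le_mul h1 (by omega)
    have h3 : k ^ 4 * 2 ≤ k ^ 5 := by rw [pow_succ k 4]; exact Nat.mul_le_mul_left _ hk2
    have h4 : k ^ 2 ≤ k ^ 5 := Nat.pow_le_pow_right (by omega) (by omega)
    have h5 : k ≤ k ^ 5 := Nat.le_self_pow (by omega) _
    have h6 : ((k + 2) * k ^ 3 + 2 * k) * k = k ^ 5 + k ^ 4 * 2 + 2 * k ^ 2 := by ring
    omega
  · intro i
    rw [b1 _ (by omega), a1 _ (by omega), hw1]
    simp [ext, AS]
  · intro i
    rw [show (ℓ + 1 + b + (ℓ + 1)) * d + (i : ℕ) = (ℓ + 1 + b) * d + ((ℓ + 1) * d + i) by ring, b2]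
    have hi := i.2
    rw [show (ℓ + 1) * d + ℓ - 1 - ((ℓ + 1) * d + (i : ℕ)) = ℓ - 1 - i by omega, hw3]
    have : ℓ - 1 - (i : ℕ) < ℓ := by omega
    simp only [ext, AT, this, if_true, dif_pos]
    congr 2
    exact Fin.ext (by simp; omega)
  · intro p hp hpb
    by_cases h1 : p < (ℓ + 1 + b) * d + ℓ
    · rw [b1 p h1]
      by_cases h2 : p < (ℓ + 1) * d + ℓ
      · rw [a1 p h2]; exact right1 p hp
      · obtain ⟨i, rfl⟩ : ∃ i, p = (ℓ + 1) * d + i := ⟨p - (ℓ + 1) * d, by omega⟩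
        rw [a2]; exact W2r i (by omega)
    · obtain ⟨i, rfl⟩ : ∃ i, p = (ℓ + 1 + b) * d + i := ⟨p - (ℓ + 1 + b) * d, by omega⟩
      rw [b2]
      exact right3 _ (by omega)

end scheme
section counting

theorem markov {A B : Type*} [Fintype A] [Fintype B] (R : A → B → Prop) (c : ℝ) (hc : 0 ≤ c)
    (hB : 0 < Fintype.card B) [∀ a, DecidablePred (R a)]
    (h : c * Fintype.card A * Fintype.card B ≤
      ∑ a, (((Finset.univ.filter (fun b => R a b)).card : ℕ) : ℝ))
    [DecidablePred (fun a => (c / 2) * Fintype.card B ≤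
      (((Finset.univ.filter (fun b => R a b)).card : ℕ) : ℝ))] :
    (c / 2) * Fintype.card A ≤ (((Finset.univ.filter (fun a => (c / 2) * Fintype.card B ≤
      (((Finset.univ.filter (fun b => R a b)).card : ℕ) : ℝ))).card : ℕ) : ℝ) := by
  set P : A → Prop := fun a => (c / 2) * Fintype.card B ≤
      (((Finset.univ.filter (fun b => R a b)).card : ℕ) : ℝ) with hP
  have hB' : (0 : ℝ) < Fintype.card B := by exact_mod_cast hB
  have h1 : ∑ a, (((Finset.univ.filter (fun b => R a b)).card : ℕ) : ℝ) ≤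
      ∑ a, ((if P a then (Fintype.card B : ℝ) else 0) + (c / 2) * Fintype.card B) := by
    apply Finset.sum_le_sum
    intro a _
    by_cases ha : P a
    · rw [if_pos ha]
      have : (((Finset.univ.filter (fun b => R a b)).card : ℕ) : ℝ) ≤ Fintype.card B := by
        exact_mod_cast Finset.card_le_univ _
      have : 0 ≤ (c / 2) * (Fintype.card B : ℝ) := by positivity
      linarith
    · rw [if_neg ha, zero_add]
      exact (not_le.1 ha).le
  rw [Finset.sum_add_distrib, ← Finset.sum_filter, Finset.sum_const, Finset.sum_const,
    nsmul_eq_mul, nsmul_eq_mul, Finset.card_univ] at h1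
  have h2 := h.trans h1
  have h3 : (c / 2) * Fintype.card A * Fintype.card B ≤
    ((Finset.univ.filter P).card : ℝ) * Fintype.card B := by
    linarith
  have h4 := le_of_mul_le_mul_right h3 hB'
  exact h4.trans (le_of_eq (by congr))

theorem exists_inj {V W : Type*} [Fintype V] [Fintype W] (R : W → V → Prop) (c : ℝ) (hc : 0 < c)
    (m : ℕ) (hV : 0 < Fintype.card V) (hm : (m : ℝ) ≤ c / 4 * Fintype.card V)
    (hmV : m ≤ Fintype.card V)
    [∀ a, DecidablePred (R a)]
    (h : c * Fintype.card W * Fintype.card V ≤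
      ∑ a, (((Finset.univ.filter (fun b => R a b)).card : ℕ) : ℝ)) :
    ∃ f : Fin m ↪ V, ∀ [DecidablePred (fun z => ∀ j, R z (f j))], (c / 2) * (c / 4) ^ m * Fintype.card W ≤
      (((Finset.univ.filter (fun z => ∀ j, R z (f j))).card : ℕ) : ℝ) := by
  classical
  set n := Fintype.card V with hn
  have hZ := markov R c hc.le hV h
  set Z := Finset.univ.filter (fun a => (c / 2) * (n : ℝ) ≤
      (((Finset.univ.filter (fun b => R a b)).card : ℕ) : ℝ)) with hZdef
  have hn' : (0 : ℝ) < n := by exact_mod_cast hV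
  -- embeddings into neighbourhoods
  have hz : ∀ z ∈ Z, (c / 4 * n) ^ m ≤
      (((Finset.univ.filter (fun f : Fin m ↪ V => ∀ j, R z (f j))).card : ℕ) : ℝ) := by
    intro z hz
    have hz' := (Finset.mem_filter.1 hz).2
    have h1 : Fintype.card (Fin m ↪ {y // R z y}) ≤
        (Finset.univ.filter (fun f : Fin m ↪ V => ∀ j, R z (f j))).card := by
      rw [← Finset.card_univ]
      apply Finset.card_le_card_of_injOn
        (fun f : Fin m ↪ {y // R z y} => f.trans (Function.Embedding.subtype _))
      · intro f _
        simp only [Finset.coe_filter, Finset.mem_univ, true_and, Set.mem_ofPred_eq]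
        intro j
        exact (f j).2
      · intro f _ f' _ hff
        ext j
        exact DFunLike.congr_fun hff j
    rw [Fintype.card_embedding_eq, Fintype.card_fin, Fintype.card_subtype] at h1
    have h2 := (Nat.pow_sub_le_descFactorial _ m).trans h1
    refine le_trans ?_ (Nat.cast_le.2 h2)
    rw [Nat.cast_pow]
    apply pow_le_pow_left₀ (by positivity)
    set D := (Finset.univ.filter (fun b => R z b)).card
    have h4 : (D : ℝ) + 1 - m ≤ ((D + 1 - m : ℕ) : ℝ) := by
      have : D + 1 ≤ (D + 1 - m) + m := by omega
      have : ((D + 1 : ℕ) : ℝ) ≤ (((D + 1 - m) + m : ℕ) : ℝ) := by exact_mod_cast this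
      push_cast at this
      linarith
    linarith
  have hne : Nonempty (Fin m ↪ V) := by
    apply Function.Embedding.nonempty_of_card_le
    simpa using hmV
  have hcardF : (Fintype.card (Fin m ↪ V) : ℝ) ≤ (n : ℝ) ^ m := by
    rw [Fintype.card_embedding_eq, Fintype.card_fin]
    exact_mod_cast Nat.descFactorial_le_pow _ _
  have dc : ∑ f : Fin m ↪ V, (((Z.filter (fun z => ∀ j, R z (f j))).card : ℕ) : ℝ) =
      ∑ z ∈ Z, (((Finset.univ.filter (fun f : Fin m ↪ V => ∀ j, R z (f j))).card : ℕ) : ℝ) := by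
    exact_mod_cast Finset.sum_card_bipartiteAbove_eq_sum_card_bipartiteBelow
      (s := (Finset.univ : Finset (Fin m ↪ V))) (t := Z) (fun f z => ∀ j, R z (f j))
  have big : ∑ f : Fin m ↪ V, (c / 2) * (c / 4) ^ m * (Fintype.card W : ℝ) ≤
      ∑ f : Fin m ↪ V, (((Z.filter (fun z => ∀ j, R z (f j))).card : ℕ) : ℝ) := by
    rw [dc, Finset.sum_const, nsmul_eq_mul, Finset.card_univ]
    calc (Fintype.card (Fin m ↪ V) : ℝ) * ((c / 2) * (c / 4) ^ m * (Fintype.card W : ℝ))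
        ≤ (n : ℝ) ^ m * ((c / 2) * (c / 4) ^ m * (Fintype.card W : ℝ)) := by gcongr
      _ = ((c / 2) * Fintype.card W) * (c / 4 * n) ^ m := by rw [mul_pow]; ring
      _ ≤ (Z.card : ℝ) * (c / 4 * n) ^ m := by gcongr
      _ = ∑ z ∈ Z, (c / 4 * (n : ℝ)) ^ m := by rw [Finset.sum_const, nsmul_eq_mul]
      _ ≤ _ := Finset.sum_le_sum hz
  obtain ⟨f, _, hf⟩ := Finset.exists_le_of_sum_le Finset.univ_nonempty big
  refine ⟨f, fun {_} => hf.trans (Nat.cast_le.2 (Finset.card_le_card ?_))⟩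
  intro z hz
  simp only [Finset.mem_filter, Finset.mem_univ, true_and] at hz ⊢
  exact hz.2

open Classical in
theorem blowup (M m : ℕ) : ∀ c : ℝ, 0 < c → ∃ n₀ : ℕ, ∀ n ≥ n₀, ∀ X : (Fin M → Fin n) → Prop,
    c * (n : ℝ) ^ M ≤ (((Finset.univ.filter X).card : ℕ) : ℝ) →
    ∃ g : Fin M → Fin m → Fin n, (∀ i, Function.Injective (g i)) ∧
      ∀ φ : Fin M → Fin m, X (fun i => g i (φ i)) := by
  induction M with
  | zero =>
    intro c hc
    refine ⟨0, fun n _ X hX => ?_⟩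
    have : 0 < (Finset.univ.filter X).card := by
      rw [pow_zero, mul_one] at hX
      exact_mod_cast lt_of_lt_of_le hc hX
    obtain ⟨x, hx⟩ := Finset.card_pos.1 this
    refine ⟨fun i => i.elim0, fun i => i.elim0, fun φ => ?_⟩
    rw [Subsingleton.elim (fun i => _) x]
    exact (Finset.mem_filter.1 hx).2
  | succ M ih =>
    intro c hc
    obtain ⟨n₁, hn₁⟩ := ih ((c / 2) * (c / 4) ^ m) (by positivity)
    refine ⟨max n₁ (max (⌈(m : ℝ) / (c / 4)⌉₊) (m + 1)), fun n hn X hX => ?_⟩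
    have hn1 : n₁ ≤ n := (le_max_left _ _).trans hn
    have hn2 : ⌈(m : ℝ) / (c / 4)⌉₊ ≤ n := (le_max_left _ _).trans ((le_max_right _ _).trans hn)
    have hn3 : m + 1 ≤ n := (le_max_right _ _).trans ((le_max_right _ _).trans hn)
    have hmc : (m : ℝ) ≤ c / 4 * n := by
      have := (Nat.ceil_le.1 hn2)
      rw [div_le_iff₀ (by positivity)] at this
      linarith
    have key := exists_inj (V := Fin n) (W := Fin M → Fin n)
      (fun z y => X (Fin.cons y z)) c hc m (by simp; omega) (by simpa using hmc) (by simp; omega) (by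
        have h1 : (Finset.univ.filter X).card ≤ ∑ z : Fin M → Fin n,
            (Finset.univ.filter (fun y => X (Fin.cons y z))).card := by
          rw [← Finset.card_sigma]
          apply Finset.card_le_card_of_injOn (fun x => ⟨Fin.tail x, x 0⟩)
          · intro x hx
            simp only [Finset.coe_filter, Finset.mem_univ, true_and, Set.mem_ofPred_eq] at hx
            simp [hx]
          · intro x _ y _ hxy
            simp only [Sigma.mk.injEq, heq_eq_eq] at hxy
            rw [← Fin.cons_self_tail x, ← Fin.cons_self_tail y, hxy.1, hxy.2]
        have h2 : (((Finset.univ.filter X).card : ℕ) : ℝ) ≤ ∑ z : Fin M → Fin n,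
            (((Finset.univ.filter (fun y => X (Fin.cons y z))).card : ℕ) : ℝ) := by
          exact_mod_cast h1
        refine le_trans (le_of_eq ?_) (hX.trans h2)
        simp only [Fintype.card_fun, Fintype.card_fin]
        push_cast
        ring)
    obtain ⟨f, hf⟩ := key
    obtain ⟨g, hg1, hg2⟩ := hn₁ n hn1 (fun z => ∀ j, X (Fin.cons (f j) z)) (by
      refine le_trans (le_of_eq ?_) (hf.trans (le_of_eq (by congr)))
      simp only [Fintype.card_fun, Fintype.card_fin]
      push_cast
      ring)
    refine ⟨Fin.cons (fun j => f j) g, ?_, ?_⟩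
    · intro i
      refine Fin.cases ?_ (fun i => ?_) i
      · exact f.injective
      · exact hg1 i
    · intro φ
      have := hg2 (fun i => φ i.succ) (φ 0)
      convert this using 1
      funext i
      refine Fin.cases ?_ (fun i => ?_) i <;> simp

/-- evaluation of labels -/
def ev {β : Type} {n M : ℕ} (σ : β → Fin n) (z : Fin n) (x : Fin M → Fin n) : β ⊕ ℕ → Fin n :=
  Sum.elim σ (fun j => if h : j < M then x ⟨j, h⟩ else z)

def Good {β : Type} {n M : ℕ} (H : Finset (Finset (Fin n))) (E : Set (Finset (β ⊕ ℕ)))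
    (σ : β → Fin n) (z : Fin n) (x : Fin M → Fin n) : Prop :=
  Function.Injective x ∧ (∀ i b, x i ≠ σ b) ∧ ∀ e ∈ E, e.image (ev σ z x) ∈ H

theorem deg_le {n k : ℕ} (hk : 1 ≤ k) {H : Finset (Finset (Fin n))} (hH : IsKGraph n k H)
    {A : Finset (Fin n)} (hA : A.card = k - 1) :
    degree n H A ≤ (Finset.univ.filter (fun y => insert y A ∈ H)).card := by
  unfold degree
  refine le_trans (Finset.card_le_card ?_)
    (Finset.card_image_le (s := Finset.univ.filter (fun y => insert y A ∈ H))
      (f := fun y => insert y A))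
  intro e he
  obtain ⟨he, hAe⟩ := Finset.mem_filter.1 he
  obtain ⟨y, hy, rfl⟩ : ∃ y ∉ A, insert y A = e := by
    have h1 : (e \ A).card = 1 := by
      rw [Finset.card_sdiff_of_subset hAe, hH e he, hA]; omega
    obtain ⟨y, hy⟩ := Finset.card_eq_one.1 h1
    have hy' : y ∈ e \ A := by simp [hy]
    refine ⟨y, (Finset.mem_sdiff.1 hy').2, ?_⟩
    rw [← Finset.sdiff_union_of_subset hAe, hy]; rfl
  exact Finset.mem_image.2 ⟨y, by simp [he], rfl⟩

theorem ev_snoc {β : Type} {n M : ℕ} (σ : β → Fin n) (z : Fin n) (x : Fin M → Fin n) (y : Fin n)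
    (a : β ⊕ ℕ) (ha : ∀ j, a = Sum.inr j → j < M) :
    ev σ z (Fin.snoc x y : Fin (M + 1) → Fin n) a = ev σ z x a := by
  rcases a with b | j
  · rfl
  · have hj := ha j rfl
    simp only [ev, Sum.elim_inr]
    rw [dif_pos (by omega), dif_pos hj]
    exact Fin.snoc_castSucc (α := fun _ => Fin n) y x ⟨j, hj⟩

theorem ev_inj {β : Type} {n M : ℕ} {σ : β → Fin n} (hσ : Function.Injective σ) {z : Fin n}
    {x : Fin M → Fin n} (hx : Function.Injective x) (hxs : ∀ i b, x i ≠ σ b)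
    {N : Set (β ⊕ ℕ)} (hN : ∀ j, Sum.inr j ∈ N → j < M) : Set.InjOn (ev σ z x) N := by
  rintro (b | j) ha (b' | j') ha' h
  · simp only [ev, Sum.elim_inl] at h; rw [hσ h]
  · simp only [ev, Sum.elim_inl, Sum.elim_inr, dif_pos (hN _ ha')] at h
    exact absurd h.symm (hxs _ _)
  · simp only [ev, Sum.elim_inl, Sum.elim_inr, dif_pos (hN _ ha)] at h
    exact absurd h (hxs _ _)
  · simp only [ev, Sum.elim_inr, dif_pos (hN _ ha'), dif_pos (hN _ ha)] at h
    have := hx h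
    simp only [Fin.mk.injEq] at this
    rw [this]

open Classical in
/-- One extension step. -/
theorem density_step {β : Type} [Fintype β] {n M : ℕ}
    {H : Finset (Finset (Fin n))} {E E' : Set (Finset (β ⊕ ℕ))} {σ : β → Fin n} {z : Fin n}
    {c : ℝ} (hc : 0 ≤ c) (hM : ((M + Fintype.card β : ℕ) : ℝ) ≤ c * n) (hlt : ∀ e ∈ E, ∀ j, Sum.inr j ∈ e → j < M)
    (hX : c ^ M * (n : ℝ) ^ M ≤
      (((Finset.univ.filter (fun x : Fin M → Fin n => Good H E σ z x)).card : ℕ) : ℝ))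
    (hstep : ∀ x : Fin M → Fin n, Good H E σ z x → ∃ Y : Finset (Fin n), 2 * c * n ≤ (Y.card : ℝ) ∧
      ∀ y ∈ Y, ∀ e ∈ E', e ∉ E → e.image (ev σ z (Fin.snoc x y : Fin (M + 1) → Fin n)) ∈ H) :
    c ^ (M + 1) * (n : ℝ) ^ (M + 1) ≤
      (((Finset.univ.filter (fun x : Fin (M + 1) → Fin n => Good H E' σ z x)).card : ℕ) : ℝ) := by
  set X := Finset.univ.filter (fun x : Fin M → Fin n => Good H E σ z x) with hXd
  have hstep' : ∀ x ∈ X, ∃ Y : Finset (Fin n), c * n ≤ (Y.card : ℝ) ∧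
      ∀ y ∈ Y, Good H E' σ z (Fin.snoc x y : Fin (M + 1) → Fin n) := by
    intro x hx
    have hg : Good H E σ z x := (Finset.mem_filter.1 hx).2
    obtain ⟨Y, hY, hYe⟩ := hstep x hg
    refine ⟨Y \ (Finset.univ.image x ∪ Finset.univ.image σ), ?_, ?_⟩
    · have h1 := Finset.le_card_sdiff (Finset.univ.image x ∪ Finset.univ.image σ) Y
      have h2 : (Finset.univ.image x ∪ Finset.univ.image σ).card ≤ M + Fintype.card β := by
        refine (Finset.card_union_le _ _).trans (add_le_add ?_ ?_)
        · exact Finset.card_image_le.trans (by simp)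
        · exact Finset.card_image_le.trans (by simp)
      have h3 : Y.card ≤ (Y \ (Finset.univ.image x ∪ Finset.univ.image σ)).card +
        (M + Fintype.card β) := by omega
      have h4 : (Y.card : ℝ) ≤ ((Y \ (Finset.univ.image x ∪ Finset.univ.image σ)).card : ℝ) +
        ((M + Fintype.card β : ℕ) : ℝ) := by exact_mod_cast h3
      linarith
    · intro y hy
      simp only [Finset.mem_sdiff, Finset.mem_union, Finset.mem_image, Finset.mem_univ, true_and,
        not_or, not_exists] at hy
      obtain ⟨hyY, hyx, hys⟩ := hy
      refine ⟨?_, ?_, ?_⟩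
      · intro i j
        refine Fin.lastCases ?_ (fun i => ?_) i <;> refine Fin.lastCases ?_ (fun j => ?_) j
        · intro _; rfl
        · intro h; simp only [Fin.snoc_last, Fin.snoc_castSucc] at h; exact absurd h.symm (hyx j)
        · intro h; simp only [Fin.snoc_last, Fin.snoc_castSucc] at h; exact absurd h (hyx i)
        · intro h; simp only [Fin.snoc_castSucc] at h; rw [hg.1 h]
      · intro i b
        refine Fin.lastCases ?_ (fun i => ?_) i
        · simp only [Fin.snoc_last]; exact fun h => hys b h.symm
        · simp only [Fin.snoc_castSucc]; exact hg.2.1 i b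
      · intro e he
        by_cases heE : e ∈ E
        · rw [Finset.image_congr (g := ev σ z x)]
          · exact hg.2.2 e heE
          · intro a ha
            exact ev_snoc σ z x y a (fun j hj => hlt e heE j (hj ▸ ha))
        · exact hYe y hyY e he heE
  choose! Y hY hYg using hstep'
  have h1 : (X.sigma Y).card ≤
      (Finset.univ.filter (fun x : Fin (M + 1) → Fin n => Good H E' σ z x)).card := by
    apply Finset.card_le_card_of_injOn (fun p => Fin.snoc p.1 p.2)
    · rintro ⟨x, y⟩ hp
      simp only [Finset.coe_sigma, Set.mem_sigma_iff, Finset.mem_coe] at hp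
      simp only [Finset.coe_filter, Finset.mem_univ, true_and, Set.mem_ofPred_eq]
      exact hYg x hp.1 y hp.2
    · rintro ⟨x, y⟩ _ ⟨x', y'⟩ _ h
      obtain ⟨h1, h2⟩ := Fin.snoc_injective2 h
      simp only at h1 h2
      rw [h1, h2]
  rw [Finset.card_sigma] at h1
  calc c ^ (M + 1) * (n : ℝ) ^ (M + 1) = (c ^ M * (n : ℝ) ^ M) * (c * n) := by ring
    _ ≤ (X.card : ℝ) * (c * n) := by gcongr
    _ = ∑ x ∈ X, c * (n : ℝ) := by rw [Finset.sum_const, nsmul_eq_mul]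
    _ ≤ ∑ x ∈ X, ((Y x).card : ℝ) := Finset.sum_le_sum hY
    _ = ((∑ x ∈ X, (Y x).card : ℕ) : ℝ) := by push_cast; rfl
    _ ≤ _ := by exact_mod_cast h1

open Classical in
theorem density {β : Type} [Fintype β] [DecidableEq β] {n k : ℕ} (hk : 1 ≤ k)
    {H : Finset (Finset (Fin n))} (hH : IsKGraph n k H) {μ c : ℝ} (hdeg : MinDegreeGe n k H (μ * n))
    (hc : 0 ≤ c) (hcμ : 2 * c ≤ μ) (hc1 : 2 * c ≤ 1)
    {σ : β → Fin n} (hσ : Function.Injective σ) (z : Fin n)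
    {M : ℕ} {E : Set (Finset (β ⊕ ℕ))} (hE : Degen k M E) :
    ((M + Fintype.card β : ℕ) : ℝ) ≤ c * n → c ^ M * (n : ℝ) ^ M ≤
      (((Finset.univ.filter (fun x : Fin M → Fin n => Good H E σ z x)).card : ℕ) : ℝ) := by
  induction hE with
  | base =>
    intro _
    have : (Finset.univ.filter (fun x : Fin 0 → Fin n => Good H ∅ σ z x)) = Finset.univ := by
      apply Finset.filter_true_of_mem
      intro x _
      exact ⟨fun i => i.elim0, fun i => i.elim0, fun e he => absurd he (Set.notMem_empty _)⟩
    rw [this]; simp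
  | @free M E hD ih =>
    intro hM
    have hM' : ((M + Fintype.card β : ℕ) : ℝ) ≤ c * n := by
      refine le_trans ?_ hM; push_cast; linarith
    refine density_step hc hM' hD.lt (ih hM') (fun x _ => ⟨Finset.univ, ?_, ?_⟩)
    · rw [Finset.card_univ, Fintype.card_fin]
      have : (0 : ℝ) ≤ n := Nat.cast_nonneg _
      nlinarith
    · intro y _ e he he'; exact absurd he he'
  | @edge M E N hD hN hNc ih =>
    intro hM
    have hM' : ((M + Fintype.card β : ℕ) : ℝ) ≤ c * n := by
      refine le_trans ?_ hM; push_cast; linarith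
    refine density_step hc hM' hD.lt (ih hM') (fun x hx =>
      ⟨Finset.univ.filter (fun y => insert y (N.image (ev σ z x)) ∈ H), ?_, ?_⟩)
    · have hA : (N.image (ev σ z x)).card = k - 1 := by
        rw [Finset.card_image_of_injOn, hNc]
        exact ev_inj hσ hx.1 hx.2.1 (fun j hj => hN j hj)
      have h1 := hdeg _ hA
      have h2 : (degree n H (N.image (ev σ z x)) : ℝ) ≤ _ := Nat.cast_le.2 (deg_le hk hH hA)
      have : (0 : ℝ) ≤ n := Nat.cast_nonneg _
      have h3 : 2 * c * n ≤ μ * n := by gcongr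
      convert h3.trans (h1.trans h2)
    · intro y hy e he he'
      rcases he with rfl | he
      · rw [Finset.image_insert]
        have e1 : ev σ z (Fin.snoc x y : Fin (M + 1) → Fin n) (Sum.inr M) = y := by
          simp only [ev, Sum.elim_inr]
          rw [dif_pos (by omega)]
          exact Fin.snoc_last (α := fun _ => Fin n) y x
        rw [e1, Finset.image_congr (g := ev σ z x)]
        · exact (Finset.mem_filter.1 hy).2
        · intro a ha
          exact ev_snoc σ z x y a (fun j hj => hN j (hj ▸ ha))
      · exact absurd he he'

end counting

theorem main (ℓ d : ℕ) (hl1 : 1 ≤ ℓ) (hd2 : 2 ≤ d) (hd : ¬ d ∣ ℓ) (μ : ℝ) (hμ : 0 < μ) :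
    ∃ n₀ : ℕ, ∀ n ≥ n₀,
      ∀ H : Finset (Finset (Fin n)), IsKGraph n (ℓ + d) H → MinDegreeGe n (ℓ + d) H (μ * n) →
        ∀ S T : Fin ℓ → Fin n, Function.Injective S → Function.Injective T →
          (∀ i j, S i ≠ T j) →
          ∃ (b : ℕ) (v : ℕ → Fin n), 1 ≤ b ∧ b * d + ℓ ≤ 8 * (ℓ + d) ^ 5 ∧
            Set.InjOn v (Set.Iio (b * d + ℓ)) ∧
            (∀ s < b, (Finset.range (ℓ + d)).image (fun t => v (s * d + t)) ∈ H) ∧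
            (∀ i : Fin ℓ, v (i : ℕ) = S i) ∧
            (∀ i : Fin ℓ, v (b * d + (i : ℕ)) = T i) := by
  classical
  obtain ⟨M, E, b, w, hD, hb, hbd, hW, hwS, hwT, hwR⟩ := scheme (ℓ := ℓ) hd2 hd
  set c : ℝ := min μ 1 / 2 with hcdef
  have hc : 0 < c := by positivity
  have hcμ : 2 * c ≤ μ := by rw [hcdef]; linarith [min_le_left μ 1]
  have hc1 : 2 * c ≤ 1 := by rw [hcdef]; linarith [min_le_right μ 1]
  set r := b * d + ℓ with hr
  obtain ⟨n₁, hn₁⟩ := blowup M r (c ^ M) (by positivity)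
  refine ⟨max n₁ (max ⌈((M + (ℓ + ℓ) : ℕ) : ℝ) / c⌉₊ 1), ?_⟩
  intro n hn H hH hdeg S T hS hT hST
  have hn1 : n₁ ≤ n := (le_max_left _ _).trans hn
  have hn2 : ⌈((M + (ℓ + ℓ) : ℕ) : ℝ) / c⌉₊ ≤ n := (le_max_left _ _).trans ((le_max_right _ _).trans hn)
  have hn3 : 1 ≤ n := (le_max_right _ _).trans ((le_max_right _ _).trans hn)
  have hMc : ((M + Fintype.card (Fin ℓ ⊕ Fin ℓ) : ℕ) : ℝ) ≤ c * n := by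
    have := Nat.ceil_le.1 hn2
    rw [div_le_iff₀ hc] at this
    simp only [Fintype.card_sum, Fintype.card_fin]
    linarith
  let σ : Fin ℓ ⊕ Fin ℓ → Fin n := Sum.elim S T
  have hσ : Function.Injective σ := by
    rintro (i | i) (j | j) h
    · exact congrArg _ (hS h)
    · exact absurd h (hST i j)
    · exact absurd h.symm (hST j i)
    · exact congrArg _ (hT h)
  let z : Fin n := ⟨0, hn3⟩
  obtain ⟨g, hg1, hg2⟩ := hn₁ n hn1 (fun x => Good H E σ z x)
    (density (by omega) hH hdeg hc.le hcμ hc1 hσ z hD hMc)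
  have hdr : ℓ + d ≤ r := by
    have : 1 * d ≤ b * d := Nat.mul_le_mul_right _ hb
    omega
  have hr0 : 0 < r := by omega
  -- the path
  let v : ℕ → Fin n := fun p => Sum.elim σ
    (fun j => if h : j < M ∧ p < r then g ⟨j, h.1⟩ ⟨p, h.2⟩ else z) (w p)
  have hbl : ℓ ≤ b * d := by
    by_contra hcon
    have h1 := hwS ⟨b * d, by omega⟩
    have h2 := hwT ⟨0, by omega⟩
    simp only [add_zero] at h2
    rw [h1] at h2
    simp at h2
  -- structure of labels
  have hlab : ∀ p < r, (∃ i : Fin ℓ, p = i ∧ w p = Sum.inl (Sum.inl i)) ∨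
      (∃ i : Fin ℓ, p = b * d + i ∧ w p = Sum.inl (Sum.inr i)) ∨ (∃ j, w p = Sum.inr j) := by
    intro p hp
    by_cases h1 : p < ℓ
    · exact Or.inl ⟨⟨p, h1⟩, rfl, hwS ⟨p, h1⟩⟩
    · by_cases h2 : p < b * d
      · exact Or.inr (Or.inr (hwR p (by omega) h2))
      · refine Or.inr (Or.inl ⟨⟨p - b * d, by omega⟩, by simp; omega, ?_⟩)
        have := hwT ⟨p - b * d, by omega⟩
        simpa [show b * d + (p - b * d) = p by omega] using this
  have hlM : ∀ p < r, ∀ j, w p = Sum.inr j → j < M := by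
    intro p hp j hj
    obtain ⟨s, hs, t, ht, rfl⟩ : ∃ s < b, ∃ t < ℓ + d, p = s * d + t := by
      by_cases h1 : p / d < b
      · refine ⟨p / d, h1, p % d, ?_, ?_⟩
        · have := Nat.mod_lt p (show 0 < d by omega); omega
        · have := Nat.div_add_mod p d; rw [mul_comm] at this; omega
      · refine ⟨b - 1, by omega, p - (b - 1) * d, ?_, ?_⟩
        · have : (b - 1 + 1) * d = (b - 1) * d + d := by ring
          rw [Nat.sub_add_cancel hb] at this
          omega
        · have h2 : b * d ≤ p := (Nat.le_div_iff_mul_le (by omega)).1 (not_lt.1 h1)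
          have : (b - 1) * d ≤ b * d := Nat.mul_le_mul_right _ (by omega)
          omega
    exact hD.lt _ (hW s hs).2 j (Finset.mem_image.2 ⟨t, by simpa using ht, hj⟩)
  have vr : ∀ p (hp : p < r) j (hj : w p = Sum.inr j), v p = g ⟨j, hlM p hp j hj⟩ ⟨p, hp⟩ := by
    intro p hp j hj
    have := hlM p hp j hj
    simp only [v, hj, Sum.elim_inr]
    rw [dif_pos ⟨this, hp⟩]
  have vl : ∀ p a, w p = Sum.inl a → v p = σ a := by
    intro p a h; simp only [v, h, Sum.elim_inl]
  have gs : ∀ i a β, g i a ≠ σ β := by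
    intro i a β
    exact (hg2 (fun _ => a)).2.1 i β
  have gg : ∀ i i' a a', g i a = g i' a' → i = i' ∧ a = a' := by
    intro i i' a a' h
    by_cases hii : i = i'
    · subst hii
      exact ⟨rfl, hg1 i h⟩
    · have h1 := (hg2 (fun q => if q = i then a else a')).1
      have : i = i' := h1 (by simp [Ne.symm hii, h])
      exact absurd this hii
  refine ⟨b, v, hb, hbd, ?_, ?_, ?_, ?_⟩
  · intro p hp p' hp' h
    simp only [Set.mem_Iio] at hp hp'
    rcases hlab p hp with ⟨i, h1, h2⟩ | ⟨i, h1, h2⟩ | ⟨j, h2⟩ <;>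
    rcases hlab p' hp' with ⟨i', h1', h2'⟩ | ⟨i', h1', h2'⟩ | ⟨j', h2'⟩
    · rw [vl _ _ h2, vl _ _ h2'] at h
      have := Sum.inl_injective (hσ h); rw [h1, h1', this]
    · rw [vl _ _ h2, vl _ _ h2'] at h
      have := hσ h; simp at this
    · rw [vl _ _ h2, vr _ hp' _ h2'] at h
      exact absurd h.symm (gs _ _ _)
    · rw [vl _ _ h2, vl _ _ h2'] at h
      have := hσ h; simp at this
    · rw [vl _ _ h2, vl _ _ h2'] at h
      have := Sum.inr_injective (hσ h); rw [h1, h1', this]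
    · rw [vl _ _ h2, vr _ hp' _ h2'] at h
      exact absurd h.symm (gs _ _ _)
    · rw [vr _ hp _ h2, vl _ _ h2'] at h
      exact absurd h (gs _ _ _)
    · rw [vr _ hp _ h2, vl _ _ h2'] at h
      exact absurd h (gs _ _ _)
    · rw [vr _ hp _ h2, vr _ hp' _ h2'] at h
      have := (gg _ _ _ _ h).2
      simpa using this
  · intro s hs
    obtain ⟨inj, hmem⟩ := hW s hs
    have hsd : s * d + d ≤ b * d := by
      calc s * d + d = (s + 1) * d := by ring
        _ ≤ b * d := Nat.mul_le_mul_right _ hs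
    let φ : Fin M → Fin r := fun j =>
      if h : ∃ t, t < ℓ + d ∧ w (s * d + t) = Sum.inr (j : ℕ) then
        ⟨s * d + h.choose, by have := h.choose_spec.1; omega⟩ else ⟨0, hr0⟩
    have hφ := (hg2 φ).2.2 _ hmem
    rw [Finset.image_image] at hφ
    rw [Finset.image_congr (g := ev σ z (fun i => g i (φ i)) ∘ fun t => w (s * d + t))]
    · exact hφ
    · intro t ht
      simp only [Finset.coe_range, Set.mem_Iio] at ht
      simp only [Function.comp]
      have hp : s * d + t < r := by omega
      rcases hw : w (s * d + t) with a | j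
      · rw [vl _ _ hw]; rfl
      · rw [vr _ hp _ hw]
        have hj := hlM _ hp _ hw
        simp only [ev, Sum.elim_inr]
        rw [dif_pos hj]
        congr 1
        have hex : ∃ t, t < ℓ + d ∧ w (s * d + t) = Sum.inr j := ⟨t, ht, hw⟩
        have : hex.choose = t := inj hex.choose_spec.1 ht (by
          simp only; rw [hex.choose_spec.2, hw])
        apply Fin.ext
        simp only [φ]
        rw [dif_pos hex]
        simp only [this]
  · intro i; rw [vl _ _ (hwS i)]; rfl
  · intro i; rw [vl _ _ (hwT i)]; rfl

end DL

/-- Diameter lemma: if `(k-ℓ) ∤ k`, in a sufficiently large `k`-graph of minimum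
degree at least `μn`, any two disjoint ordered `ℓ`-sets `S` and `T` are joined
by an `ℓ`-path with at most `8k⁵` vertices. -/
theorem diameter_lemma
    (k ℓ : ℕ) (hk : 3 ≤ k) (hl1 : 1 ≤ ℓ) (hl2 : ℓ ≤ k - 1)
    (hnd : ¬ (k - ℓ) ∣ k) (μ : ℝ) (hμ : 0 < μ) :
    ∃ n₀ : ℕ, ∀ n ≥ n₀,
      ∀ H : Finset (Finset (Fin n)), IsKGraph n k H → MinDegreeGe n k H (μ * n) →
        ∀ S T : Fin ℓ → Fin n, Function.Injective S → Function.Injective T →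
          (∀ i j, S i ≠ T j) →
          ∃ (r : ℕ) (v : ℕ → Fin n), r ≤ 8 * k ^ 5 ∧
            IsPathSeq k ℓ r (· ∈ H) v ∧
            (∀ i : Fin ℓ, v (i : ℕ) = S i) ∧
            (∀ i : Fin ℓ, v (r - ℓ + (i : ℕ)) = T i) := by
  obtain ⟨d, rfl⟩ : ∃ d, k = ℓ + d := ⟨k - ℓ, by omega⟩
  have hkd : ℓ + d - ℓ = d := by omega
  rw [hkd] at hnd
  have hd : ¬ d ∣ ℓ := fun h => hnd (Dvd.dvd.add h (dvd_refl d))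
  have hd2 : 2 ≤ d := by
    by_contra hlt
    have : d = 1 := by omega
    exact hd (this ▸ one_dvd _)
  obtain ⟨n₀, h⟩ := DL.main ℓ d hl1 hd2 hd μ hμ
  refine ⟨n₀, fun n hn H hH hdeg S T hS hT hST => ?_⟩
  obtain ⟨b, v, hb, hbd, hinj, hed, hvS, hvT⟩ := h n hn H hH hdeg S T hS hT hST
  have hb' : b * d = (b - 1) * d + d := by
    obtain ⟨c, rfl⟩ : ∃ c, b = c + 1 := ⟨b - 1, by omega⟩
    rw [Nat.add_sub_cancel]; ring
  refine ⟨b * d + ℓ, v, hbd, ⟨by omega, ?_, hinj, ?_⟩, hvS, ?_⟩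
  · rw [hkd]
    exact ⟨b - 1, by rw [mul_comm d]; omega⟩
  · intro s hs
    rw [hkd] at hs
    have hsb : s < b := by
      by_contra hcon
      have : b * d ≤ s * d := Nat.mul_le_mul_right _ (not_lt.1 hcon)
      omega
    unfold pathEdge
    rw [hkd]
    exact hed s hsb
  · intro i
    rw [Nat.add_sub_cancel]
    exact hvT i
end

section
/- Suppose k ≥ 3 and 1 ≤ ℓ ≤ k−1 is such that (k−ℓ) does not divide k. Then there is a k-partite k-graph AP(k,ℓ) with the following properties: (1) AP(k,ℓ) has at most k⁴ vertices; (2) the vertex set of AP(k,ℓ) is the disjoint union of two sets S and X with |S| = k−ℓ; (3) AP(k,ℓ) contains an ℓ-path P with vertex set X and ordered ends P^beg and P^end; (4) AP(k,ℓ) contains an ℓ-path Q with vertex set S ∪ X and the same ordered ends P^beg and P^end; (5) no edge of AP(k,ℓ) contains more than one vertex of S; (6) no vertex class of AP(k,ℓ) contains more than one vertex of S. -/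
open Finset

/-- One bubble sweep: the last label has been moved down by `b` places. -/
def apG (k b x : ℕ) : ℕ :=
  if x + b + 1 < k then x else if x + b + 1 = k then k - 1 else x - 1

/-- Colour arrangement after `n` adjacent swaps. -/
def apH (k n x : ℕ) : ℕ := (apG k (n % (k - 1)) x + (k - 1) * (n / (k - 1))) % k

lemma apG_lt (k b x : ℕ) (hx : x < k) : apG k b x < k := by
  unfold apG; split_ifs <;> omega

lemma apG_inj (k b x x' : ℕ) (hb : b < k) (hx : x < k) (hx' : x' < k)
    (h : apG k b x = apG k b x') : x = x' := by
  unfold apG at h; split_ifs at h <;> omega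

lemma apH_lt (k n x : ℕ) (hk : 2 ≤ k) : apH k n x < k := Nat.mod_lt _ (by omega)

lemma apH_inj (k n x x' : ℕ) (hk : 2 ≤ k) (hx : x < k) (hx' : x' < k)
    (h : apH k n x = apH k n x') : x = x' := by
  have hb : n % (k - 1) < k - 1 := Nat.mod_lt _ (by omega)
  apply apG_inj k (n % (k - 1)) x x' (by omega) hx hx'
  have h2 : apG k (n % (k - 1)) x ≡ apG k (n % (k - 1)) x' [MOD k] :=
    Nat.ModEq.add_right_cancel' _ h
  exact Nat.ModEq.eq_of_lt_of_lt h2 (apG_lt _ _ _ hx) (apG_lt _ _ _ hx')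

lemma apH_zero (k x : ℕ) (hk : 2 ≤ k) (hx : x < k) : apH k 0 x = x := by
  have : apG k 0 x = x := by unfold apG; split_ifs <;> omega
  simp [apH, this, Nat.mod_eq_of_lt hx]

lemma apH_end (k d i : ℕ) (hk : 2 ≤ k) (hi : d + i < k) : apH k (d * (k - 1)) (d + i) = i := by
  have h1 : 0 < k - 1 := by omega
  have hg : apG k 0 (d + i) = d + i := by unfold apG; split_ifs <;> omega
  unfold apH
  rw [Nat.mul_mod_left, Nat.mul_div_cancel _ h1, hg]
  have : d + i + (k - 1) * d = i + k * d := by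
    obtain ⟨m, rfl⟩ : ∃ m, k = m + 1 := ⟨k - 1, by omega⟩
    simp; ring
  rw [this, Nat.add_mul_mod_self_left, Nat.mod_eq_of_lt (by omega)]

lemma apG_step (k b x0 x' : ℕ) (hb : b + 1 < k) (h0 : x0 ≤ k) (hy : x0 + b + 1 ≠ k)
    (hx : x' < x0) : ∃ x'' < x0, apG k (b + 1) x' = apG k b x'' := by
  by_cases h1 : x' + b + 2 = k
  · exact ⟨x' + 1, by omega, by unfold apG; split_ifs <;> omega⟩
  by_cases h2 : x' + b + 1 = k
  · exact ⟨x' - 1, by omega, by unfold apG; split_ifs <;> omega⟩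
  exact ⟨x', hx, by unfold apG; split_ifs <;> omega⟩

lemma apH_step (k n x0 x' : ℕ) (hk : 2 ≤ k) (h0 : x0 ≤ k) (hy : x0 ≠ k - 1 - n % (k - 1))
    (hx : x' < x0) : ∃ x'' < x0, apH k (n + 1) x' = apH k n x'' := by
  have hb : n % (k - 1) < k - 1 := Nat.mod_lt _ (by omega)
  obtain ⟨x'', hx'', he⟩ := apG_step k (n % (k - 1)) x0 x' (by omega) h0 (by omega) hx
  refine ⟨x'', hx'', ?_⟩
  unfold apH
  rw [← he]
  have hn := Nat.div_add_mod n (k - 1)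
  set b := n % (k - 1) with hbd
  set a := n / (k - 1) with had
  by_cases hc : b + 1 < k - 1
  · have h1 : (n + 1) % (k - 1) = b + 1 := by
      rw [← hn, add_assoc, Nat.mul_add_mod, Nat.mod_eq_of_lt hc]
    have h2 : (n + 1) / (k - 1) = a := by
      rw [← hn, add_assoc, Nat.mul_add_div (by omega), Nat.div_eq_of_lt hc, add_zero]
    rw [h1, h2]
  · have hc' : b + 1 = k - 1 := by omega
    have hn' : n + 1 = (k - 1) * (a + 1) := by rw [← hn, add_assoc, hc']; ring
    have h1 : (n + 1) % (k - 1) = 0 := by rw [hn', Nat.mul_mod_right]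
    have h2 : (n + 1) / (k - 1) = a + 1 := by rw [hn', Nat.mul_div_cancel_left _ (by omega)]
    rw [h1, h2, hc']
    have hg0 : apG k 0 x' = x' := by unfold apG; split_ifs <;> omega
    rw [hg0]
    by_cases hz : x' = 0
    · have : apG k (k - 1) x' = k - 1 := by unfold apG; split_ifs <;> omega
      rw [this, hz]; congr 1; ring
    · have : apG k (k - 1) x' = x' - 1 := by unfold apG; split_ifs <;> omega
      rw [this]
      have : x' + (k - 1) * (a + 1) = x' - 1 + (k - 1) * a + k := by
        rw [mul_add]; omega
      rw [this, Nat.add_mod_right]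

/-- Number of swaps performed before round `j`. -/
def apC (k d j : ℕ) : ℕ :=
  (j - d) / 2 + if (j - d) % 2 = 1 ∧ ¬ d ∣ (j - 1) * k + (k - 1 - ((j - d) / 2) % (k - 1))
    then 1 else 0

lemma apC_step (k d j : ℕ) (hd : ¬ d ∣ k) : apC k d (j + 1) = apC k d j ∨
    (apC k d (j + 1) = apC k d j + 1 ∧ ¬ d ∣ j * k + (k - 1 - apC k d j % (k - 1))) := by
  rcases lt_or_ge j d with h | h
  · left
    have h1 : j + 1 - d = 0 := by omega
    have h2 : j - d = 0 := by omega
    simp [apC, h1, h2]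
  obtain ⟨t, rfl⟩ := Nat.exists_eq_add_of_le h
  have e1 : d + t + 1 - d = t + 1 := by omega
  have e2 : d + t - d = t := by omega
  rcases Nat.even_or_odd' t with ⟨i, rfl | rfl⟩
  · have f1 : (2 * i + 1) / 2 = i := by omega
    have f2 : (2 * i + 1) % 2 = 1 := by omega
    have f3 : (2 * i) / 2 = i := by omega
    have f4 : (2 * i) % 2 = 0 := by omega
    simp only [apC, e1, e2, f1, f2, f3, f4, Nat.add_sub_cancel]
    by_cases hh : d ∣ (d + 2 * i) * k + (k - 1 - i % (k - 1))
    · left; simp [hh]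
    · right; simp [hh]
  · have f1 : (2 * i + 1 + 1) / 2 = i + 1 := by omega
    have f2 : (2 * i + 1 + 1) % 2 = 0 := by omega
    have f3 : (2 * i + 1) / 2 = i := by omega
    have f4 : (2 * i + 1) % 2 = 1 := by omega
    have f5 : d + (2 * i + 1) - 1 = d + 2 * i := by omega
    simp only [apC, e1, e2, f1, f2, f3, f4, f5]
    by_cases hh : d ∣ (d + 2 * i) * k + (k - 1 - i % (k - 1))
    · right
      simp only [hh]
      simp
      intro h2
      apply hd
      have : (d + (2 * i + 1)) * k + (k - 1 - i % (k - 1))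
        = ((d + 2 * i) * k + (k - 1 - i % (k - 1))) + k := by ring
      rw [this] at h2
      exact (Nat.dvd_add_right hh).1 h2
    · left; simp [hh]

lemma ap_rounds (k d : ℕ) (hk : 2 ≤ k) (hd : ¬ d ∣ k) :
    ∃ f u : ℕ → ℕ → ℕ, (∀ j x, x < k → f j x < k) ∧ (∀ j x, x < k → u j x < k) ∧
      (∀ j x, x < k → f j (u j x) = x) ∧ (∀ j x, x < k → u j (f j x) = x) ∧
      (∀ j x, j ≤ d → x < k → f j x = x) ∧
      (∀ i, d + i < k → f (d + 2 * (d * (k - 1))) (d + i) = i) ∧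
      (∀ j x0 x', x0 ≤ k → d ∣ j * k + x0 → x' < x0 → ∃ x'' < x0, f (j + 1) x' = f j x'') := by
  have hsurj : ∀ j x, ∃ z, x < k → (z < k ∧ apH k (apC k d j) z = x) := by
    intro j x
    by_cases hx : x < k
    · have hs : Set.SurjOn (apH k (apC k d j)) (Finset.range k) (Finset.range k) := by
        apply Finset.surjOn_of_injOn_of_card_le
        · intro z hz; simpa using apH_lt k _ z hk
        · intro z hz z' hz' h
          exact apH_inj k _ z z' hk (by simpa using hz) (by simpa using hz') h
        · exact le_rfl
      obtain ⟨z, hz, hzx⟩ := hs (show x ∈ (Finset.range k : Set ℕ) by simpa using hx)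
      exact ⟨z, fun _ => ⟨by simpa using hz, hzx⟩⟩
    · exact ⟨0, fun h => absurd h hx⟩
  choose u hu using hsurj
  refine ⟨fun j => apH k (apC k d j), u, fun j x hx => apH_lt _ _ _ hk,
    fun j x hx => (hu j x hx).1, fun j x hx => (hu j x hx).2, ?_, ?_, ?_, ?_⟩
  · intro j x hx
    have := hu j (apH k (apC k d j) x) (apH_lt _ _ _ hk)
    exact apH_inj k _ _ _ hk this.1 hx this.2
  · intro j x hj hx
    have : apC k d j = 0 := by simp [apC, Nat.sub_eq_zero_of_le hj]
    simp only [this]; exact apH_zero k x hk hx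
  · intro i hi
    have : apC k d (d + 2 * (d * (k - 1))) = d * (k - 1) := by
      simp [apC]
    simp only [this]; exact apH_end k d i hk hi
  · intro j x0 x' h0 hdv hx
    rcases apC_step k d j hd with h | ⟨h, hn⟩
    · exact ⟨x', hx, by simp only [h]⟩
    · simp only [h]
      apply apH_step k _ x0 x' hk h0 _ hx
      rintro rfl; exact hn hdv

/-- The combinatorial core, with natural numbers as vertices (the `Q`-positions). -/
lemma ap_core (k ℓ d : ℕ) (hk : 3 ≤ k) (hl : 1 ≤ ℓ) (hd1 : 1 ≤ d) (hkd : k = ℓ + d) (hd : ¬ d ∣ k) :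
    ∃ (m : ℕ) (W vp : ℕ → ℕ), d ∣ m ∧ d < m ∧ (m + 1) * k ≤ k ^ 4 ∧
      (∀ p, W p < k) ∧
      (∀ p < d * k, W p = p % k) ∧
      (∀ s a b, a < k → b < k → W (s * d + a) = W (s * d + b) → a = b) ∧
      (∀ p, W (vp p) = p % k) ∧
      (∀ p < m * k + ℓ, vp p < (m + 1) * k) ∧
      (∀ p p', vp p = vp p' → p = p') ∧
      (∀ p, ∀ i < d, vp p ≠ ℓ + i * (k + 1)) ∧
      (∀ q < (m + 1) * k, (∀ i < d, q ≠ ℓ + i * (k + 1)) → ∃ p < m * k + ℓ, vp p = q) ∧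
      (∀ i < ℓ, vp i = i) ∧
      (∀ i < ℓ, vp (m * k + i) = m * k + d + i) := by
  have hk0 : 0 < k := by omega
  obtain ⟨f, u, hf, hu, hfu, huf, hid, hend, hcut⟩ := ap_rounds k d (by omega) hd
  have enc1 : ∀ j x, x < k → (j * k + x) / k = j := by
    intro j x hx
    rw [mul_comm, Nat.mul_add_div hk0, Nat.div_eq_of_lt hx, add_zero]
  have enc2 : ∀ j x, x < k → (j * k + x) % k = x := by
    intro j x hx
    rw [mul_comm, Nat.mul_add_mod, Nat.mod_eq_of_lt hx]
  have dec : ∀ p, ∃ j x, x < k ∧ p = j * k + x := fun p =>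
    ⟨p / k, p % k, Nat.mod_lt _ hk0, (Nat.div_add_mod' p k).symm⟩
  have encinj : ∀ j x j' x', x < k → x' < k → j * k + x = j' * k + x' → j = j' ∧ x = x' := by
    intro j x j' x' hx hx' h
    have h1 := enc1 j x hx
    have h2 := enc2 j x hx
    rw [h, enc1 j' x' hx'] at h1
    rw [h, enc2 j' x' hx'] at h2
    exact ⟨h1.symm, h2.symm⟩
  obtain ⟨J, hJ⟩ : ∃ J : ℕ → ℕ → ℕ, ∀ j x, J j x = if ℓ ≤ x ∧ x - ℓ ≤ j then j + 1 else j :=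
    ⟨_, fun _ _ => rfl⟩
  obtain ⟨W, hW⟩ : ∃ W : ℕ → ℕ, ∀ p, W p = f (p / k) (p % k) := ⟨_, fun _ => rfl⟩
  obtain ⟨vp, hvp⟩ : ∃ vp : ℕ → ℕ, ∀ p,
      vp p = J (p / k) (p % k) * k + u (J (p / k) (p % k)) (p % k) := ⟨_, fun _ => rfl⟩
  have hWe : ∀ j x, x < k → W (j * k + x) = f j x := by
    intro j x hx; rw [hW, enc1 j x hx, enc2 j x hx]
  have hve : ∀ j x, x < k → vp (j * k + x) = J j x * k + u (J j x) x := by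
    intro j x hx; rw [hvp, enc1 j x hx, enc2 j x hx]
  have hu0 : ∀ j x, j ≤ d → x < k → u j x = x := by
    intro j x hj hx
    have := huf j x hx
    rwa [hid j x hj hx] at this
  obtain ⟨m, hm⟩ : ∃ m, m = d + 2 * (d * (k - 1)) := ⟨_, rfl⟩
  have hdm : d < m := by
    have : 0 < d * (k - 1) := Nat.mul_pos hd1 (by omega)
    omega
  refine ⟨m, W, vp, ?_, hdm, ?_, ?_, ?_, ?_, ?_, ?_, ?_, ?_, ?_, ?_, ?_⟩
  · rw [hm]; exact ⟨1 + 2 * (k - 1), by ring⟩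
  · obtain ⟨c, rfl⟩ : ∃ c, k = c + 2 := ⟨k - 2, by omega⟩
    have h1 : d ≤ c + 1 := by omega
    have h2 : d * (c + 1) ≤ (c + 1) * (c + 1) := Nat.mul_le_mul_right _ h1
    have h3 : m + 1 ≤ (c + 2) ^ 3 := by
      rw [hm]
      have : c + 2 - 1 = c + 1 := by omega
      rw [this]
      nlinarith [sq_nonneg c, Nat.zero_le (c ^ 3)]
    calc (m + 1) * (c + 2) ≤ (c + 2) ^ 3 * (c + 2) := Nat.mul_le_mul_right _ h3
      _ = (c + 2) ^ 4 := by ring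
  · intro p; rw [hW]; exact hf _ _ (Nat.mod_lt _ hk0)
  · intro p hp
    rw [hW]
    exact hid _ _ (le_of_lt ((Nat.div_lt_iff_lt_mul hk0).2 hp)) (Nat.mod_lt _ hk0)
  · have key : ∀ s a b, a < b → b < k → W (s * d + a) ≠ W (s * d + b) := by
      intro s a b hab hb he
      obtain ⟨j, x, hx, h1⟩ := dec (s * d + a)
      obtain ⟨j', x', hx', h2⟩ := dec (s * d + b)
      rw [h1, h2, hWe j x hx, hWe j' x' hx'] at he
      have hj1 : j ≤ j' := by
        by_contra hc
        have : (j' + 1) * k ≤ j * k := Nat.mul_le_mul_right _ (by omega)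
        rw [add_mul] at this; omega
      have hj2 : j' ≤ j + 1 := by
        by_contra hc
        have : (j + 2) * k ≤ j' * k := Nat.mul_le_mul_right _ (by omega)
        rw [add_mul] at this; omega
      rcases (show j' = j ∨ j' = j + 1 by omega) with rfl | rfl
      · have := huf j' x hx
        rw [he, huf j' x' hx'] at this
        omega
      · have h3 : (j + 1) * k = j * k + k := by ring
        obtain ⟨x0, hx0⟩ : ∃ x0, s * d = j * k + x0 := ⟨s * d - j * k, by omega⟩
        obtain ⟨x'', hx'', h4⟩ := hcut j x0 x' (by omega) (hx0 ▸ Dvd.intro_left _ rfl) (by omega)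
        rw [h4] at he
        have := huf j x hx
        rw [he, huf j x'' (by omega)] at this
        omega
    intro s a b ha hb he
    rcases lt_trichotomy a b with h | h | h
    · exact absurd he (key s a b h hb)
    · exact h
    · exact absurd he.symm (key s b a h ha)
  · intro p
    obtain ⟨j, x, hx, rfl⟩ := dec p
    rw [hve j x hx, hWe _ _ (hu _ _ hx), hfu _ _ hx, enc2 j x hx]
  · intro p hp
    obtain ⟨j, x, hx, rfl⟩ := dec p
    rw [hve j x hx]
    have hJm : J j x ≤ m := by
      rw [hJ]
      have hjm : j ≤ m := by
        by_contra hc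
        have : (m + 1) * k ≤ j * k := Nat.mul_le_mul_right _ (by omega)
        rw [add_mul] at this; omega
      split_ifs with h
      · rcases Nat.lt_or_ge j m with h' | h'
        · omega
        · have : j = m := by omega
          subst this; omega
      · exact hjm
    have h1 := hu (J j x) x hx
    have : J j x * k ≤ m * k := Nat.mul_le_mul_right _ hJm
    rw [add_mul]; omega
  · intro p p' h
    obtain ⟨j, x, hx, rfl⟩ := dec p
    obtain ⟨j', x', hx', rfl⟩ := dec p'
    rw [hve j x hx, hve j' x' hx'] at h
    obtain ⟨h1, h2⟩ := encinj _ _ _ _ (hu _ _ hx) (hu _ _ hx') h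
    have h3 := hfu (J j x) x hx
    rw [h2, h1, hfu _ _ hx'] at h3
    subst h3
    rw [hJ, hJ] at h1
    have : j = j' := by split_ifs at h1 <;> omega
    rw [this]
  · intro p i hi h
    obtain ⟨j, x, hx, rfl⟩ := dec p
    rw [hve j x hx, show ℓ + i * (k + 1) = i * k + (ℓ + i) by ring] at h
    obtain ⟨h1, h2⟩ := encinj _ _ _ _ (hu _ _ hx) (by omega) h
    rw [h1, hu0 i x (by omega) hx] at h2
    subst h2
    rw [hJ] at h1
    split_ifs at h1 <;> omega
  · intro q hq hS
    obtain ⟨j, z, hz, rfl⟩ := dec q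
    have hjm : j ≤ m := by
      by_contra hc
      have : (m + 1) * k ≤ j * k := Nat.mul_le_mul_right _ (by omega)
      omega
    have hxk := hf j z hz
    have hxz := huf j z hz
    obtain ⟨x, hxd⟩ : ∃ x, x = f j z := ⟨_, rfl⟩
    rw [← hxd] at hxk hxz
    have hne : ¬ (ℓ ≤ x ∧ x - ℓ = j) := by
      rintro ⟨h1, h2⟩
      apply hS j (by omega)
      rw [hu0 j x (by omega) hxk] at hxz
      rw [mul_add, ← hxz]; omega
    have fin : ∀ j0, J j0 x = j → vp (j0 * k + x) = j * k + z := by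
      intro j0 h
      rw [hve _ _ hxk, h, hxz]
    have bd : ∀ j0, j0 < m → j0 * k + x < m * k + ℓ := by
      intro j0 h
      have : (j0 + 1) * k ≤ m * k := Nat.mul_le_mul_right _ (by omega)
      rw [add_mul] at this; omega
    by_cases h1 : ℓ ≤ x
    · by_cases h2 : j < x - ℓ
      · exact ⟨j * k + x, bd j (by omega), fin j (by rw [hJ, if_neg]; omega)⟩
      · exact ⟨(j - 1) * k + x, bd _ (by omega),
          fin _ (by rw [hJ, if_pos] <;> omega)⟩
    · refine ⟨j * k + x, ?_, fin j (by rw [hJ, if_neg]; omega)⟩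
      have : j * k ≤ m * k := Nat.mul_le_mul_right _ hjm
      omega
  · intro i hi
    have h := hve 0 i (by omega)
    have hJ0 : J 0 i = 0 := by rw [hJ, if_neg]; omega
    rw [hJ0, hu0 0 i (by omega) (by omega)] at h
    simpa using h
  · intro i hi
    rw [hve m i (by omega)]
    have hJ0 : J m i = m := by rw [hJ, if_neg]; omega
    have h1 := hend i (by omega)
    rw [← hm] at h1
    have h2 := huf m (d + i) (by omega)
    rw [h1] at h2
    rw [hJ0, h2, add_assoc]

/-- Proposition 10: existence of the absorbing configuration `AP(k,ℓ)`: a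
`k`-partite `k`-graph (with class map `cls`) on at most `k⁴` vertices whose
vertex set splits into `S` (of size `k-ℓ`) and `X`, containing an `ℓ`-path `P`
with vertex set `X` and an `ℓ`-path `Q` with vertex set `S ∪ X` having the same
ordered ends, such that no edge and no vertex class contains two vertices
of `S`. -/
theorem AP_graph_exists
    (k ℓ : ℕ) (hk : 3 ≤ k) (hl1 : 1 ≤ ℓ) (hl2 : ℓ ≤ k - 1)
    (hnd : ¬ (k - ℓ) ∣ k) :
    ∃ (N : ℕ) (cls : Fin N → Fin k) (E : Finset (Finset (Fin N)))
      (S : Finset (Fin N)) (rP rQ : ℕ) (vP vQ : ℕ → Fin N),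
      N ≤ k ^ 4 ∧
      (∀ e ∈ E, e.card = k) ∧
      (∀ e ∈ E, ∀ x ∈ e, ∀ y ∈ e, x ≠ y → cls x ≠ cls y) ∧
      S.card = k - ℓ ∧
      IsPathSeq k ℓ rP (· ∈ E) vP ∧
      (Finset.range rP).image vP = Finset.univ \ S ∧
      IsPathSeq k ℓ rQ (· ∈ E) vQ ∧
      (Finset.range rQ).image vQ = Finset.univ ∧
      (∀ i < ℓ, vQ i = vP i) ∧
      (∀ i < ℓ, vQ (rQ - ℓ + i) = vP (rP - ℓ + i)) ∧
      (∀ e ∈ E, (e ∩ S).card ≤ 1) ∧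
      (∀ c : Fin k, (S.filter (fun x => cls x = c)).card ≤ 1) := by
  have hlk : ℓ < k := by omega
  obtain ⟨d, hd⟩ : ∃ d, k - ℓ = d := ⟨_, rfl⟩
  have hd1 : 1 ≤ d := by omega
  have hkd : k = ℓ + d := by omega
  rw [hd] at hnd
  obtain ⟨m, W, vp, hdm, hm, hN, hWk, hWid, hWinj, hWvp, hvlt, hvinj, hvS, hvsurj, hvbeg, hvend⟩ :=
    ap_core k ℓ d hk hl1 hd1 hkd hnd
  obtain ⟨N, hNd⟩ : ∃ N, N = (m + 1) * k := ⟨_, rfl⟩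
  have hNm : N = m * k + k := by rw [hNd]; ring
  have hN0 : 0 < N := by omega
  have hmk : d * k + k ≤ m * k := by
    have : (d + 1) * k ≤ m * k := Nat.mul_le_mul_right _ hm
    rw [add_mul] at this; omega
  have hkdk : k ≤ d * k := Nat.le_mul_of_pos_left _ hd1
  rw [← hNd] at hN hvlt hvsurj
  -- the vertex sequences
  obtain ⟨toN, htoN⟩ : ∃ g : ℕ → Fin N, ∀ p < N, (g p).val = p :=
    ⟨fun p => ⟨p % N, Nat.mod_lt _ hN0⟩, fun p hp => Nat.mod_eq_of_lt hp⟩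
  have toN_inj : ∀ p p', p < N → p' < N → toN p = toN p' → p = p' := by
    intro p p' hp hp' h
    have := congrArg Fin.val h
    rwa [htoN p hp, htoN p' hp'] at this
  have toN_val : ∀ x : Fin N, toN x.val = x := fun x => Fin.ext (htoN _ x.2)
  obtain ⟨cls, hcls⟩ : ∃ c : Fin N → Fin k, ∀ x, (c x).val = W x.val :=
    ⟨fun x => ⟨W x.val, hWk _⟩, fun _ => rfl⟩
  have hspos : ∀ i < d, ℓ + i * (k + 1) < d * k := by
    intro i hi
    have h1 : (i + 1) * k ≤ d * k := Nat.mul_le_mul_right _ hi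
    have h2 : i * (k + 1) = i * k + i := by ring
    have h3 : (i + 1) * k = i * k + k := by ring
    omega
  have hsN : ∀ i < d, ℓ + i * (k + 1) < N := by
    intro i hi
    have := hspos i hi
    omega
  have hsgap : ∀ i i', i < i' → ℓ + i * (k + 1) + (k + 1) ≤ ℓ + i' * (k + 1) := by
    intro i i' h
    have : (i + 1) * (k + 1) ≤ i' * (k + 1) := Nat.mul_le_mul_right _ h
    rw [add_mul] at this; omega
  have hsinj : ∀ i i', ℓ + i * (k + 1) = ℓ + i' * (k + 1) → i = i' := by
    intro i i' h
    rcases lt_trichotomy i i' with h' | h' | h'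
    · have := hsgap _ _ h'; omega
    · exact h'
    · have := hsgap _ _ h'; omega
  obtain ⟨S, hSd⟩ : ∃ S : Finset (Fin N),
      S = (Finset.range d).image (fun i => toN (ℓ + i * (k + 1))) := ⟨_, rfl⟩
  have hSmem : ∀ x, x ∈ S ↔ ∃ i < d, x.val = ℓ + i * (k + 1) := by
    intro x
    rw [hSd, Finset.mem_image]
    constructor
    · rintro ⟨i, hi, rfl⟩
      rw [Finset.mem_range] at hi
      exact ⟨i, hi, htoN _ (hsN i hi)⟩
    · rintro ⟨i, hi, h⟩
      exact ⟨i, Finset.mem_range.2 hi, by rw [← h, toN_val]⟩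
  obtain ⟨vP, hvP⟩ : ∃ v : ℕ → Fin N, ∀ p, v p = toN (vp p) := ⟨_, fun _ => rfl⟩
  obtain ⟨rP, hrP⟩ : ∃ r, r = m * k + ℓ := ⟨_, rfl⟩
  rw [← hrP] at hvlt hvsurj
  have hvPval : ∀ p < rP, (vP p).val = vp p := by
    intro p hp; rw [hvP]; exact htoN _ (hvlt p hp)
  -- rainbow windows
  have winP : ∀ s, s * d + k ≤ rP → ∀ a < k, ∀ b < k,
      cls (vP (s * d + a)) = cls (vP (s * d + b)) → a = b := by
    intro s hs a ha b hb h
    have h := congrArg Fin.val h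
    rw [hcls, hcls, hvPval _ (by omega), hvPval _ (by omega), hWvp, hWvp] at h
    have h' : a ≡ b [MOD k] := Nat.ModEq.add_left_cancel' _ h
    exact Nat.ModEq.eq_of_lt_of_lt h' ha hb
  have winQ : ∀ s, s * d + k ≤ N → ∀ a < k, ∀ b < k,
      cls (toN (s * d + a)) = cls (toN (s * d + b)) → a = b := by
    intro s hs a ha b hb h
    have h := congrArg Fin.val h
    rw [hcls, hcls, htoN _ (by omega), htoN _ (by omega)] at h
    exact hWinj s a b ha hb h
  have gen : ∀ (v : ℕ → Fin N) (s : ℕ), (∀ a < k, ∀ b < k,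
      cls (v (s * d + a)) = cls (v (s * d + b)) → a = b) →
      (pathEdge k ℓ v s).card = k ∧
      ∀ x ∈ pathEdge k ℓ v s, ∀ y ∈ pathEdge k ℓ v s, x ≠ y → cls x ≠ cls y := by
    intro v s h
    unfold pathEdge
    rw [hd]
    constructor
    · rw [Finset.card_image_of_injOn, Finset.card_range]
      intro a ha b hb hab
      exact h a (by simpa using ha) b (by simpa using hb) (congrArg cls hab)
    · intro x hx y hy hxy hc
      obtain ⟨a, ha, rfl⟩ := Finset.mem_image.1 hx
      obtain ⟨b, hb, rfl⟩ := Finset.mem_image.1 hy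
      exact hxy (by rw [h a (Finset.mem_range.1 ha) b (Finset.mem_range.1 hb) hc])
  obtain ⟨E, hE⟩ : ∃ E : Finset (Finset (Fin N)), ∀ e, e ∈ E ↔
      (∃ s, s * d + k ≤ rP ∧ e = pathEdge k ℓ vP s) ∨
      (∃ s, s * d + k ≤ N ∧ e = pathEdge k ℓ toN s) := by
    classical
    exact ⟨Finset.univ.filter (fun e => (∃ s, s * d + k ≤ rP ∧ e = pathEdge k ℓ vP s) ∨
      (∃ s, s * d + k ≤ N ∧ e = pathEdge k ℓ toN s)), fun e => by simp⟩
  have hvPS : ∀ p < rP, vP p ∉ S := by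
    intro p hp h
    obtain ⟨i, hi, h'⟩ := (hSmem _).1 h
    rw [hvPval p hp] at h'
    exact hvS p i hi h'
  refine ⟨N, cls, E, S, rP, N, vP, toN, hN, ?_, ?_, ?_, ?_, ?_, ?_, ?_, ?_, ?_, ?_, ?_⟩
  · intro e he
    rcases (hE e).1 he with ⟨s, hs, rfl⟩ | ⟨s, hs, rfl⟩
    · exact (gen vP s (winP s hs)).1
    · exact (gen toN s (winQ s hs)).1
  · intro e he
    rcases (hE e).1 he with ⟨s, hs, rfl⟩ | ⟨s, hs, rfl⟩
    · exact (gen vP s (winP s hs)).2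
    · exact (gen toN s (winQ s hs)).2
  · rw [hd, hSd, Finset.card_image_of_injOn, Finset.card_range]
    intro i hi i' hi' h
    have hi : i < d := by simpa using hi
    have hi' : i' < d := by simpa using hi'
    exact hsinj i i' (toN_inj _ _ (hsN i hi) (hsN i' hi') h)
  · refine ⟨by omega, ?_, ?_, ?_⟩
    · rw [hd, show rP - k = m * k - d by omega]
      exact Nat.dvd_sub (Dvd.dvd.mul_right hdm k) dvd_rfl
    · intro p hp p' hp' h
      have hp : p < rP := hp
      have hp' : p' < rP := hp'
      have := congrArg Fin.val h
      rw [hvPval p hp, hvPval p' hp'] at this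
      exact hvinj p p' this
    · intro s hs
      rw [hd] at hs
      exact (hE _).2 (Or.inl ⟨s, hs, rfl⟩)
  · ext x
    rw [Finset.mem_image, Finset.mem_sdiff]
    constructor
    · rintro ⟨p, hp, rfl⟩
      exact ⟨Finset.mem_univ _, hvPS p (Finset.mem_range.1 hp)⟩
    · rintro ⟨-, hx⟩
      obtain ⟨p, hp, h⟩ := hvsurj x.val x.2 (fun i hi h => hx ((hSmem x).2 ⟨i, hi, h⟩))
      exact ⟨p, Finset.mem_range.2 hp, by rw [hvP, h, toN_val]⟩
  · refine ⟨by omega, ?_, ?_, ?_⟩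
    · rw [hd, show N - k = m * k by omega]
      exact Dvd.dvd.mul_right hdm k
    · intro p hp p' hp' h
      exact toN_inj p p' hp hp' h
    · intro s hs
      rw [hd] at hs
      exact (hE _).2 (Or.inr ⟨s, hs, rfl⟩)
  · ext x
    simp only [Finset.mem_image, Finset.mem_univ, iff_true]
    exact ⟨x.val, Finset.mem_range.2 x.2, toN_val x⟩
  · intro i hi
    rw [hvP, hvbeg i hi]
  · intro i hi
    rw [hvP, show rP - ℓ + i = m * k + i by omega, hvend i hi,
      show N - ℓ + i = m * k + d + i by omega]
  · intro e he
    rw [Finset.card_le_one]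
    intro x hx y hy
    rw [Finset.mem_inter] at hx hy
    rcases (hE e).1 he with ⟨s, hs, rfl⟩ | ⟨s, hs, rfl⟩
    · exfalso
      obtain ⟨a, ha, h⟩ := Finset.mem_image.1 hx.1
      rw [Finset.mem_range] at ha
      rw [hd] at h
      exact hvPS (s * d + a) (by omega) (h ▸ hx.2)
    · obtain ⟨a, ha, h1⟩ := Finset.mem_image.1 hx.1
      obtain ⟨b, hb, h2⟩ := Finset.mem_image.1 hy.1
      rw [Finset.mem_range] at ha hb
      obtain ⟨i, hi, h3⟩ := (hSmem _).1 hx.2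
      obtain ⟨i', hi', h4⟩ := (hSmem _).1 hy.2
      simp only [hd] at h1 h2
      have h1 := congrArg Fin.val h1
      have h2 := congrArg Fin.val h2
      rw [htoN _ (by omega)] at h1 h2
      apply Fin.ext
      rcases lt_trichotomy i i' with h' | h' | h'
      · have := hsgap _ _ h'; omega
      · rw [h3, h4, h']
      · have := hsgap _ _ h'; omega
  · intro c
    rw [Finset.card_le_one]
    intro x hx y hy
    rw [Finset.mem_filter] at hx hy
    obtain ⟨i, hi, h3⟩ := (hSmem _).1 hx.1
    obtain ⟨i', hi', h4⟩ := (hSmem _).1 hy.1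
    have hcl : ∀ i < d, W (ℓ + i * (k + 1)) = ℓ + i := by
      intro i hi
      rw [hWid _ (hspos i hi), show ℓ + i * (k + 1) = ℓ + i + k * i by ring,
        Nat.add_mul_mod_self_left, Nat.mod_eq_of_lt (by omega)]
    have h := congrArg Fin.val (hx.2.trans hy.2.symm)
    rw [hcls, hcls, h3, h4, hcl i hi, hcl i' hi'] at h
    apply Fin.ext
    rw [h3, h4, show i = i' by omega]
end
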